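/- arXiv:2209.01201 — 4 statements merged into one kernel-verified Lean document; each statement's English description precedes it below -/
import Mathlib

section
/- Let K be a field and let G = G_1 ∪ G_2 be a decomposable finite simple graph on [n]: G_1 and G_2 are induced subgraphs of G with G = G_1 ∪ G_2, V(G_1) ∩ V(G_2) = {v}, and v is a free vertex (a vertex belonging to exactly one maximal clique) of both G_1 and G_2. Then the Hilbert series satisfy Hilb_{S/J_G}(t) = (1 − t)^2 · Hilb_{S_1/J_{G_1}}(t) · Hilb_{S_2/J_{G_2}}(t), where S_i = K[x_j, y_j : j ∈ V(G_i)] for i = 1, 2. -/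
open MvPolynomial

noncomputable section

/-- The binomial edge ideal of a simple graph `G` on vertex set `V`, inside
`K[x_v, y_v : v ∈ V] = MvPolynomial (V ⊕ V) K`. -/
def binomialEdgeIdeal (K : Type) [Field K] {V : Type} (G : SimpleGraph V) :
    Ideal (MvPolynomial (V ⊕ V) K) :=
  Ideal.span {f | ∃ i j, G.Adj i j ∧
    f = X (Sum.inl i) * X (Sum.inr j) - X (Sum.inl j) * X (Sum.inr i)}

/-- The Hilbert series `Σ_d dim_K (S/I)_d t^d` (with rational coefficients) of
the standard graded quotient `S/I` of a polynomial ring `S = MvPolynomial σ K`;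
the degree-`d` component of `S/I` is the image of the space of homogeneous
polynomials of degree `d` under the quotient map. -/
def quotientHilbertSeries {σ K : Type} [Field K]
    (I : Ideal (MvPolynomial σ K)) : PowerSeries ℚ :=
  PowerSeries.mk fun d =>
    (Module.finrank K ((homogeneousSubmodule σ K d).map
      (Ideal.Quotient.mkₐ K I).toLinearMap) : ℚ)

/-- A vertex is a free vertex of `G` if it belongs to exactly one maximal
clique of `G`. -/
def IsFreeVertex {W : Type} (G : SimpleGraph W) (w : W) : Prop :=
  ∃! C : Set W, Maximal (fun D => G.IsClique D) C ∧ w ∈ C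


def SimpV {V : Type} (G : SimpleGraph V) (v : V) : Prop :=
  ∀ a b, G.Adj v a → G.Adj v b → a ≠ b → G.Adj a b

theorem simpV_of_free {V : Type} [Finite V] {G : SimpleGraph V} {v : V}
    (h : IsFreeVertex G v) : SimpV G v := by
  obtain ⟨C, ⟨hC, hv⟩, huniq⟩ := h
  have key : ∀ a, G.Adj v a → a ∈ C := by
    intro a ha
    have hcl : G.IsClique ({v, a} : Set V) := by
      rw [SimpleGraph.isClique_pair]; exact fun _ => ha
    obtain ⟨D, hle, hD⟩ := (Set.toFinite {D : Set V | G.IsClique D}).exists_le_maximal hcl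
    have : D = C := huniq D ⟨hD, hle (by simp)⟩
    rw [← this]; exact hle (by simp)
  intro a b ha hb hab
  exact hC.1 (key a ha) (key b hb) hab

def Gc {V : Type} (G : SimpleGraph V) (u : V) : SimpleGraph V where
  Adj a b := a ≠ b ∧ (G.Adj a b ∨ (G.Adj u a ∧ G.Adj u b))
  symm := ⟨fun a b h => ⟨h.1.symm, h.2.imp (fun h => h.symm) (fun h => ⟨h.2, h.1⟩)⟩⟩
  loopless := ⟨fun a h => h.1 rfl⟩

def Gd {V : Type} (G : SimpleGraph V) (u : V) : SimpleGraph V where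
  Adj a b := G.Adj a b ∧ a ≠ u ∧ b ≠ u
  symm := ⟨fun a b h => ⟨h.1.symm, h.2.2, h.2.1⟩⟩
  loopless := ⟨fun a h => G.loopless.irrefl a h.1⟩

theorem simpV_Gc {V : Type} {G : SimpleGraph V} {u w : V} (h : SimpV G w ∨ w = u) :
    SimpV (Gc G u) w := by
  intro a b ha hb hab
  simp only [Gc] at *
  have := fun x => G.loopless.irrefl x
  have s := fun x y (h : G.Adj x y) => h.symm
  unfold SimpV at h
  refine ⟨hab, ?_⟩
  rcases h with h | rfl
  · obtain ⟨_, ha | ha⟩ := ha <;> obtain ⟨_, hb | hb⟩ := hb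
    · exact Or.inl (h a b ha hb hab)
    · by_cases hau : a = u
      · subst hau; exact Or.inl hb.2
      · exact Or.inr ⟨(h a u ha hb.1.symm hau).symm, hb.2⟩
    · by_cases hbu : b = u
      · subst hbu; exact Or.inl ha.2.symm
      · exact Or.inr ⟨ha.2, (h b u hb ha.1.symm hbu).symm⟩
    · exact Or.inr ⟨ha.2, hb.2⟩
  · grind

theorem simpV_Gd {V : Type} {G : SimpleGraph V} {u w : V} (h : SimpV G w ∨ w = u) :
    SimpV (Gd G u) w := by
  intro a b ha hb hab
  simp only [Gd] at *
  unfold SimpV at h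
  grind

theorem edge_mem (K : Type) [Field K] {V : Type} {G : SimpleGraph V} {i j : V} (h : G.Adj i j) :
    (X (Sum.inl i) * X (Sum.inr j) - X (Sum.inl j) * X (Sum.inr i) : MvPolynomial (V ⊕ V) K)
      ∈ binomialEdgeIdeal K G := Ideal.subset_span ⟨i, j, h, rfl⟩

theorem bei_mono (K : Type) [Field K] {V : Type} {G H : SimpleGraph V} (h : G ≤ H) :
    binomialEdgeIdeal K G ≤ binomialEdgeIdeal K H := by
  apply Ideal.span_mono
  rintro f ⟨i, j, hij, rfl⟩
  exact ⟨i, j, h hij, rfl⟩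

open Classical in
/-- kill the variables at `u` -/
def killU (K : Type) [Field K] {V : Type} (u : V) :
    MvPolynomial (V ⊕ V) K →ₐ[K] MvPolynomial (V ⊕ V) K :=
  aeval (Sum.elim (fun i => if i = u then 0 else X (Sum.inl i))
    (fun i => if i = u then 0 else X (Sum.inr i)))

theorem killU_mem (K : Type) [Field K] {V : Type} {G : SimpleGraph V} (u : V)
    {f : MvPolynomial (V ⊕ V) K} (hf : f ∈ binomialEdgeIdeal K G) :
    killU K u f ∈ binomialEdgeIdeal K (Gd G u) := by
  suffices h : binomialEdgeIdeal K G ≤ (binomialEdgeIdeal K (Gd G u)).comap (killU K u) from h hf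
  apply Ideal.span_le.2
  rintro f ⟨i, j, hij, rfl⟩
  simp only [SetLike.mem_coe, Ideal.mem_comap, killU, map_sub, map_mul, aeval_X, Sum.elim_inl,
    Sum.elim_inr]
  by_cases hi : i = u <;> by_cases hj : j = u <;> simp only [hi, hj, if_true, if_false, mul_zero,
    zero_mul, sub_zero, Ideal.zero_mem]
  exact edge_mem K ⟨hij, hi, hj⟩

theorem sub_killU_mem (K : Type) [Field K] {V : Type} (u : V) (f : MvPolynomial (V ⊕ V) K) :
    f - killU K u f ∈ Ideal.span {(X (Sum.inl u) : MvPolynomial (V ⊕ V) K), X (Sum.inr u)} := by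
  rw [← Ideal.Quotient.mk_eq_mk_iff_sub_mem]
  have : (Ideal.Quotient.mkₐ K (Ideal.span {(X (Sum.inl u) : MvPolynomial (V ⊕ V) K),
      X (Sum.inr u)})) = (Ideal.Quotient.mkₐ K (Ideal.span
      {(X (Sum.inl u) : MvPolynomial (V ⊕ V) K), X (Sum.inr u)})).comp (killU K u) := by
    apply MvPolynomial.algHom_ext
    rintro (i | i)
    · by_cases h : i = u
      · subst h
        simp only [AlgHom.comp_apply, killU, aeval_X, Sum.elim_inl, if_true, map_zero]
        exact Ideal.Quotient.eq_zero_iff_mem.2 (Ideal.subset_span (by simp))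
      · simp [killU, h]
    · by_cases h : i = u
      · subst h
        simp only [AlgHom.comp_apply, killU, aeval_X, Sum.elim_inr, if_true, map_zero]
        exact Ideal.Quotient.eq_zero_iff_mem.2 (Ideal.subset_span (by simp))
      · simp [killU, h]
  exact congrArg (fun g => g f) this

theorem ohtani (K : Type) [Field K] {V : Type} {G : SimpleGraph V} (u : V)
    {f : MvPolynomial (V ⊕ V) K} (hf : f ∈ binomialEdgeIdeal K (Gc G u)) :
    f - killU K u f ∈ binomialEdgeIdeal K G := by
  have hdG : binomialEdgeIdeal K (Gd G u) ≤ binomialEdgeIdeal K G :=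
    bei_mono K (fun a b h => h.1)
  suffices h : ∀ h, h * f - killU K u (h * f) ∈ binomialEdgeIdeal K G by simpa using h 1
  refine Submodule.span_induction (p := fun f _ => ∀ h, h * f - killU K u (h * f) ∈
    binomialEdgeIdeal K G) ?_ ?_ ?_ ?_ hf
  · rintro f ⟨a, b, hab, rfl⟩ h
    by_cases hG : G.Adj a b
    · have := Ideal.mul_mem_left _ h (edge_mem K hG)
      exact Ideal.sub_mem _ this (hdG (killU_mem K u this))
    · have hab' := hab.2.resolve_left hG
      have ha : a ≠ u := hab'.1.ne'
      have hb : b ≠ u := hab'.2.ne'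
      rw [map_mul]
      have e : killU K u (X (Sum.inl a) * X (Sum.inr b) - X (Sum.inl b) * X (Sum.inr a)) =
        X (Sum.inl a) * X (Sum.inr b) - X (Sum.inl b) * X (Sum.inr a) := by
        simp [killU, ha, hb]
      rw [e, ← sub_mul]
      obtain ⟨p, q, hpq⟩ := Ideal.mem_span_pair.1 (sub_killU_mem K u h)
      rw [← hpq]
      have e1 := edge_mem K hab'.1
      have e2 := edge_mem K hab'.2
      have : (p * X (Sum.inl u) + q * X (Sum.inr u)) *
          (X (Sum.inl a) * X (Sum.inr b) - X (Sum.inl b) * X (Sum.inr a)) =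
          (p * X (Sum.inl a) + q * X (Sum.inr a)) *
            (X (Sum.inl u) * X (Sum.inr b) - X (Sum.inl b) * X (Sum.inr u)) -
          (p * X (Sum.inl b) + q * X (Sum.inr b)) *
            (X (Sum.inl u) * X (Sum.inr a) - X (Sum.inl a) * X (Sum.inr u)) := by
          ring
      rw [this]
      exact Ideal.sub_mem _ (Ideal.mul_mem_left _ _ e2) (Ideal.mul_mem_left _ _ e1)
  · intro h; simp
  · intro f g _ _ hf hg h
    have := Ideal.add_mem _ (hf h) (hg h)
    convert this using 1
    simp only [mul_add, map_add]; ring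
  · intro c f _ hf h
    have := hf (h * c)
    simpa [mul_assoc] using this

section base
variable {K : Type} [Field K] {V C : Type} (c : V → C)

def gMap : V ⊕ V → ((V ⊕ (C ⊕ C)) →₀ ℕ) :=
  Sum.elim (fun i => Finsupp.single (Sum.inl i) 1 + Finsupp.single (Sum.inr (Sum.inl (c i))) 1)
    (fun i => Finsupp.single (Sum.inl i) 1 + Finsupp.single (Sum.inr (Sum.inr (c i))) 1)

def psiMap : ((V ⊕ V) →₀ ℕ) →ₗ[ℕ] ((V ⊕ (C ⊕ C)) →₀ ℕ) := Finsupp.linearCombination ℕ (gMap c)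

theorem psi_single (z : V ⊕ V) : psiMap c (Finsupp.single z 1) = gMap c z := by
  simp [psiMap]

theorem psi_exists {e : (V ⊕ V) →₀ ℕ} {t : V ⊕ (C ⊕ C)} (h : psiMap c e t ≠ 0) :
    ∃ z, e z ≠ 0 ∧ gMap c z t ≠ 0 := by
  by_contra hcon
  push Not at hcon
  apply h
  simp only [psiMap, Finsupp.linearCombination_apply, Finsupp.sum, Finsupp.finsetSum_apply,
    Finsupp.smul_apply]
  apply Finset.sum_eq_zero
  intro z hz
  rw [hcon z (Finsupp.mem_support_iff.1 hz), smul_zero]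

theorem exists_single_add {α : Type} {e : α →₀ ℕ} {z : α} (h : e z ≠ 0) :
    ∃ e0, e = Finsupp.single z 1 + e0 := by
  refine ⟨e - Finsupp.single z 1, ?_⟩
  rw [add_tsub_cancel_of_le]
  rw [Finsupp.single_le_iff]; omega

def phiMap (K : Type) [Field K] : MvPolynomial (V ⊕ V) K →ₐ[K] MvPolynomial (V ⊕ (C ⊕ C)) K :=
  aeval (fun z => monomial (gMap c z) 1)

theorem phi_monomial (e : (V ⊕ V) →₀ ℕ) :
    phiMap c K (monomial e 1) = monomial (psiMap c e) 1 := by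
  induction e using Finsupp.induction_linear with
  | zero => simp
  | add e f he hf =>
    have : (monomial (e + f) (1 : K)) = monomial e 1 * monomial f 1 := by simp [monomial_mul]
    rw [this, map_mul, he, hf, monomial_mul, map_add, mul_one]
  | single z n =>
    rw [← X_pow_eq_monomial, map_pow]
    simp [phiMap, psiMap, monomial_pow]

variable {G : SimpleGraph V}

theorem monomial_congr (hc : ∀ i j, c i = c j → i = j ∨ G.Adj i j) :
    ∀ (n : ℕ) (e e' : (V ⊕ V) →₀ ℕ), e.degree = n → psiMap c e = psiMap c e' →
      Ideal.Quotient.mk (binomialEdgeIdeal K G) (monomial e 1) =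
      Ideal.Quotient.mk (binomialEdgeIdeal K G) (monomial e' 1) := by
  have hmul : ∀ e f : (V ⊕ V) →₀ ℕ, Ideal.Quotient.mk (binomialEdgeIdeal K G)
      (monomial (e + f) 1) = Ideal.Quotient.mk (binomialEdgeIdeal K G) (monomial e 1) *
      Ideal.Quotient.mk (binomialEdgeIdeal K G) (monomial f 1) := by
    intro e f; rw [← map_mul, monomial_mul, mul_one]
  have hsw : ∀ i j, c i = c j → Ideal.Quotient.mk (binomialEdgeIdeal K G)
      (monomial (Finsupp.single (Sum.inl i) 1) 1) * Ideal.Quotient.mk (binomialEdgeIdeal K G)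
      (monomial (Finsupp.single (Sum.inr j) 1) 1) = Ideal.Quotient.mk (binomialEdgeIdeal K G)
      (monomial (Finsupp.single (Sum.inl j) 1) 1) * Ideal.Quotient.mk (binomialEdgeIdeal K G)
      (monomial (Finsupp.single (Sum.inr i) 1) 1) := by
    intro i j hij
    rcases hc i j hij with rfl | h
    · rfl
    · rw [← map_mul, ← map_mul, Ideal.Quotient.mk_eq_mk_iff_sub_mem]
      exact edge_mem K h
  intro n
  induction n with
  | zero =>
    intro e e' he hp
    obtain rfl : e = 0 := (Finsupp.degree_eq_zero_iff e).1 he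
    have : e' = 0 := by
      by_contra h
      obtain ⟨z, hz⟩ := Finsupp.ne_iff.1 h
      obtain ⟨e0, rfl⟩ := exists_single_add hz
      rw [map_zero, map_add, psi_single] at hp
      rcases z with i | i
      · have := DFunLike.congr_fun hp (Sum.inl i)
        simp [gMap] at this
        omega
      · have := DFunLike.congr_fun hp (Sum.inl i)
        simp [gMap] at this
        omega
    rw [this]
  | succ n ih =>
    intro e e' he hp
    have : e ≠ 0 := by rintro rfl; simp at he
    obtain ⟨z, hz⟩ := Finsupp.ne_iff.1 this
    obtain ⟨e0, rfl⟩ := exists_single_add hz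
    have he0 : e0.degree = n := by
      rw [map_add, Finsupp.degree_single] at he; omega
    rw [map_add, psi_single] at hp
    have caseEq : ∀ z' : V ⊕ V, z' = z → e' z' ≠ 0 → Ideal.Quotient.mk (binomialEdgeIdeal K G)
        (monomial (Finsupp.single z 1 + e0) 1) =
        Ideal.Quotient.mk (binomialEdgeIdeal K G) (monomial e' 1) := by
      rintro _ rfl h
      obtain ⟨e0', rfl⟩ := exists_single_add h
      rw [map_add, psi_single] at hp
      rw [hmul, hmul, ih e0 e0' he0 (add_left_cancel hp)]
    rcases z with i | i
    · obtain ⟨z', hz', hg'⟩ := psi_exists c (e := e') (t := Sum.inr (Sum.inl (c i)))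
        (by rw [← hp]; simp [gMap])
      obtain ⟨z'', hz'', hg''⟩ := psi_exists c (e := e') (t := Sum.inl i)
        (by rw [← hp]; simp [gMap])
      rcases z' with j | j
      swap
      · simp [gMap] at hg'
      have hj : c j = c i := by
        by_contra h; simp [gMap, h] at hg'
      rcases z'' with k | k
      · have hk : k = i := by by_contra h; simp [gMap, h] at hg''
        exact caseEq (Sum.inl k) (by rw [hk]) hz''
      · have hk : k = i := by by_contra h; simp [gMap, h] at hg''
        subst hk
        obtain ⟨e1, rfl⟩ := exists_single_add hz''
        obtain ⟨e2, rfl⟩ := exists_single_add (e := e1) (z := Sum.inl j) (by simpa using hz')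
        have hp2 : psiMap c e0 = psiMap c (Finsupp.single (Sum.inr j) 1 + e2) := by
          apply add_left_cancel (a := gMap c (Sum.inl k))
          rw [hp, map_add, map_add, map_add, psi_single, psi_single, psi_single]
          simp only [gMap, Sum.elim_inl, Sum.elim_inr, hj]
          abel
        rw [hmul, ih _ _ he0 hp2, hmul, hmul, hmul, ← mul_assoc, ← mul_assoc, hsw _ _ hj.symm]
        ring
    · obtain ⟨z', hz', hg'⟩ := psi_exists c (e := e') (t := Sum.inr (Sum.inr (c i)))
        (by rw [← hp]; simp [gMap])
      obtain ⟨z'', hz'', hg''⟩ := psi_exists c (e := e') (t := Sum.inl i)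
        (by rw [← hp]; simp [gMap])
      rcases z' with j | j
      · simp [gMap] at hg'
      have hj : c j = c i := by
        by_contra h; simp [gMap, h] at hg'
      rcases z'' with k | k
      swap
      · have hk : k = i := by by_contra h; simp [gMap, h] at hg''
        exact caseEq (Sum.inr k) (by rw [hk]) hz''
      · have hk : k = i := by by_contra h; simp [gMap, h] at hg''
        subst hk
        obtain ⟨e1, rfl⟩ := exists_single_add hz''
        obtain ⟨e2, rfl⟩ := exists_single_add (e := e1) (z := Sum.inr j) (by simpa using hz')
        have hp2 : psiMap c e0 = psiMap c (Finsupp.single (Sum.inl j) 1 + e2) := by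
          apply add_left_cancel (a := gMap c (Sum.inr k))
          rw [hp, map_add, map_add, map_add, psi_single, psi_single, psi_single]
          simp only [gMap, Sum.elim_inl, Sum.elim_inr, hj]
          abel
        rw [hmul, ih _ _ he0 hp2, hmul, hmul, hmul, ← mul_assoc, ← mul_assoc, hsw _ _ hj.symm]
        ring

theorem nzd_base_aux (hc : ∀ i j, c i = c j → i = j ∨ G.Adj i j)
    (hc' : ∀ i j, G.Adj i j → c i = c j) (z : V ⊕ V) (f : MvPolynomial (V ⊕ V) K)
    (hf : X z * f ∈ binomialEdgeIdeal K G) : f ∈ binomialEdgeIdeal K G := by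
  classical
  let L : MvPolynomial (V ⊕ (C ⊕ C)) K →ₗ[K] (MvPolynomial (V ⊕ V) K ⧸ binomialEdgeIdeal K G) :=
    (basisMonomials (V ⊕ (C ⊕ C)) K).constr K (fun t => if h : ∃ e, psiMap c e = t then
      Ideal.Quotient.mk (binomialEdgeIdeal K G) (monomial h.choose 1) else 0)
  have hL : (Ideal.Quotient.mkₐ K (binomialEdgeIdeal K G)).toLinearMap =
      L ∘ₗ (phiMap c K).toLinearMap := by
    apply (basisMonomials (V ⊕ V) K).ext
    intro e
    simp only [coe_basisMonomials, LinearMap.comp_apply, AlgHom.toLinearMap_apply, phi_monomial]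
    have h : ∃ e', psiMap c e' = psiMap c e := ⟨e, rfl⟩
    have h1 := (basisMonomials (V ⊕ (C ⊕ C)) K).constr_basis K (fun t => if h : ∃ e, psiMap c e = t
      then Ideal.Quotient.mk (binomialEdgeIdeal K G) (monomial h.choose 1) else 0) (psiMap c e)
    simp only [coe_basisMonomials] at h1
    rw [show L _ = _ from h1, dif_pos h]
    exact monomial_congr c hc _ _ _ rfl h.choose_spec.symm
  have hker : ∀ g ∈ binomialEdgeIdeal K G, phiMap c K g = 0 := by
    intro g hg
    have : binomialEdgeIdeal K G ≤ RingHom.ker (phiMap c K) := by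
      apply Ideal.span_le.2
      rintro g ⟨i, j, hij, rfl⟩
      simp only [SetLike.mem_coe, RingHom.mem_ker, phiMap, map_sub, map_mul, aeval_X, monomial_mul,
        gMap, Sum.elim_inl, Sum.elim_inr, hc' i j hij, mul_one]
      rw [sub_eq_zero]
      congr 2
      abel
    exact this hg
  have h1 := hker _ hf
  rw [map_mul] at h1
  have h2 : phiMap c K f = 0 := by
    refine (mul_eq_zero.1 h1).resolve_left ?_
    simp [phiMap]
  have := congrArg (fun g => g f) hL
  simp only [LinearMap.comp_apply, AlgHom.toLinearMap_apply, h2, map_zero] at this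
  exact Ideal.Quotient.eq_zero_iff_mem.1 this

end base

theorem nzd_base (K : Type) [Field K] {V : Type} {G : SimpleGraph V} (h : ∀ v, SimpV G v)
    (z : V ⊕ V) (f : MvPolynomial (V ⊕ V) K)
    (hf : X z * f ∈ binomialEdgeIdeal K G) : f ∈ binomialEdgeIdeal K G := by
  let s : Setoid V := ⟨fun a b => a = b ∨ G.Adj a b, fun a => Or.inl rfl, by
    rintro a b (rfl | h)
    · exact Or.inl rfl
    · exact Or.inr h.symm, by
    rintro a b d (rfl | h1) (rfl | h2)
    · exact Or.inl rfl
    · exact Or.inr h2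
    · exact Or.inr h1
    · by_cases had : a = d
      · exact Or.inl had
      · exact Or.inr (h b a d h1.symm h2 had)⟩
  exact nzd_base_aux (fun v => (Quotient.mk s v)) (fun i j hij => Quotient.exact hij)
    (fun i j hij => Quotient.sound (Or.inr hij)) z f hf

theorem nzd_free (K : Type) [Field K] {V : Type} [Finite V] (v : V) (z : V ⊕ V)
    (hz : z = Sum.inl v ∨ z = Sum.inr v) :
    ∀ (n : ℕ) (G : SimpleGraph V), Set.ncard {w | ¬ SimpV G w} = n → SimpV G v →
      ∀ f : MvPolynomial (V ⊕ V) K, X z * f ∈ binomialEdgeIdeal K G →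
        f ∈ binomialEdgeIdeal K G := by
  intro n
  induction n using Nat.strong_induction_on with
  | _ n ih =>
  intro G hn hv f hf
  by_cases hall : ∀ w, SimpV G w
  · exact nzd_base K hall z f hf
  push Not at hall
  obtain ⟨u, hu⟩ := hall
  have hlt : ∀ H : SimpleGraph V, (∀ w, SimpV G w ∨ w = u → SimpV H w) →
      Set.ncard {w | ¬ SimpV H w} < n := by
    intro H hH
    rw [← hn]
    apply Set.ncard_lt_ncard _ (Set.toFinite _)
    rw [Set.ssubset_iff_of_subset]
    · exact ⟨u, hu, fun h => h (hH u (Or.inr rfl))⟩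
    · intro w hw hG
      exact hw (hH w (Or.inl hG))
  have h1 := ih _ (hlt (Gc G u) (fun w => simpV_Gc)) (Gc G u) rfl (simpV_Gc (Or.inl hv)) f
    (bei_mono K (G := G) (H := Gc G u) (fun a b h => ⟨h.ne, Or.inl h⟩) hf)
  have hvu : v ≠ u := by rintro rfl; exact hu hv
  have h2 := ih _ (hlt (Gd G u) (fun w => simpV_Gd)) (Gd G u) rfl (simpV_Gd (Or.inl hv))
    (killU K u f) (by
      have := killU_mem K u hf
      rw [map_mul] at this
      rcases hz with rfl | rfl
      · simpa [killU, hvu] using this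
      · simpa [killU, hvu] using this)
  have h3 := ohtani K u h1
  have h4 : killU K u f ∈ binomialEdgeIdeal K G :=
    bei_mono K (G := Gd G u) (H := G) (fun a b h => h.1) h2
  have := Ideal.add_mem _ h3 h4
  simpa using this

section graded
variable {K : Type} [Field K] {σ τ : Type}

def NZ (I : Ideal (MvPolynomial σ K)) (a : MvPolynomial σ K) : Prop := ∀ f, a * f ∈ I → f ∈ I

def WH (w : σ → ℕ) (I : Ideal (MvPolynomial σ K)) : Prop :=
  ∀ f ∈ I, ∀ m, weightedHomogeneousComponent w m f ∈ I

theorem WH_span (w : σ → ℕ) (s : Set (MvPolynomial σ K))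
    (h : ∀ f ∈ s, ∃ m, IsWeightedHomogeneous w f m) : WH w (Ideal.span s) := by
  intro f hf m
  letI := weightedGradedAlgebra K w
  refine weightedHomogeneousComponent_mem_of_mem K w ?_ hf m
  apply Ideal.homogeneous_span
  intro x hx
  exact h x hx

theorem WH_sup {w : σ → ℕ} {I J : Ideal (MvPolynomial σ K)} (hI : WH w I) (hJ : WH w J) :
    WH w (I ⊔ J) := by
  intro f hf m
  obtain ⟨a, ha, b, hb, rfl⟩ := Submodule.mem_sup.1 hf
  rw [map_add]
  exact Submodule.add_mem_sup (hI a ha m) (hJ b hb m)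

theorem comp_mul (w : σ → ℕ) {p : MvPolynomial σ K} {i : ℕ} (hp : IsWeightedHomogeneous w p i)
    (f : MvPolynomial σ K) (j : ℕ) :
    weightedHomogeneousComponent w (i + j) (p * f) = p * weightedHomogeneousComponent w j f := by
  letI := weightedGradedAlgebra K w
  have h := DirectSum.coe_decompose_mul_add_of_left_mem (weightedHomogeneousSubmodule K w)
    (a := p) (b := f) (i := i) (j := j) hp
  have e : ∀ g k, ((DirectSum.decompose (weightedHomogeneousSubmodule K w) g k :
      weightedHomogeneousSubmodule K w k) : MvPolynomial σ K) =
      weightedHomogeneousComponent w k g := fun g k =>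
    weightedDecomposition.decompose'_apply K w g k
  rw [e, e] at h
  exact h

theorem mem_of_comps (w : σ → ℕ) {I : Ideal (MvPolynomial σ K)} {f : MvPolynomial σ K}
    (h : ∀ m, weightedHomogeneousComponent w m f ∈ I) : f ∈ I := by
  rw [← sum_weightedHomogeneousComponent w f,
    finsum_eq_sum _ (weightedHomogeneousComponent_finsupp f)]
  exact Ideal.sum_mem _ (fun m _ => h m)

theorem NZ_sub {w : σ → ℕ} {I : Ideal (MvPolynomial σ K)} (hI : WH w I)
    {a b : MvPolynomial σ K} (ha : IsWeightedHomogeneous w a 1) (hb : IsWeightedHomogeneous w b 0)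
    (h : NZ I a) : NZ I (a - b) := by
  intro f hf
  have key : ∀ k, weightedHomogeneousComponent w (k + 1) f ∈ I →
      weightedHomogeneousComponent w k f ∈ I := by
    intro k hk
    apply h
    have h1 := hI _ hf (1 + k)
    rw [sub_mul, map_sub, comp_mul w ha, ← zero_add (1 + k), comp_mul w hb, add_comm 1 k] at h1
    have := Ideal.add_mem _ h1 (Ideal.mul_mem_left _ b hk)
    simpa using this
  apply mem_of_comps w
  intro m
  have hbig : ∀ n, weightedTotalDegree w f < n → weightedHomogeneousComponent w n f ∈ I := by
    intro n hn
    rw [weightedHomogeneousComponent_eq_zero n f hn]; exact Ideal.zero_mem _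
  have : ∀ t m, weightedTotalDegree w f < m + t → weightedHomogeneousComponent w m f ∈ I := by
    intro t
    induction t with
    | zero => intro m hm; exact hbig m hm
    | succ t ih => intro m hm; exact key m (ih (m + 1) (by omega))
  exact this (weightedTotalDegree w f + 1) m (by omega)

theorem NZ_swap {I : Ideal (MvPolynomial σ K)} {a b : MvPolynomial σ K}
    (ha : NZ I a) (hb : NZ (I ⊔ Ideal.span {a}) b) : NZ (I ⊔ Ideal.span {b}) a := by
  intro f hf
  obtain ⟨i, hi, y, hy, hiy⟩ := Submodule.mem_sup.1 hf
  obtain ⟨n, rfl⟩ := Ideal.mem_span_singleton'.1 hy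
  have h1 : n ∈ I ⊔ Ideal.span {a} := by
    apply hb
    have : b * n = a * f - i := by rw [← hiy]; ring
    rw [this]
    exact Ideal.sub_mem _ (Ideal.mem_sup_right (Ideal.mul_mem_right _ _
      (Ideal.mem_span_singleton_self a))) (Ideal.mem_sup_left hi)
  obtain ⟨j, hj, y', hy', hjy⟩ := Submodule.mem_sup.1 h1
  obtain ⟨n', rfl⟩ := Ideal.mem_span_singleton'.1 hy'
  have h2 : f - b * n' ∈ I := by
    apply ha
    have : a * (f - b * n') = i + j * b := by
      rw [mul_sub, ← hiy, ← hjy]; ring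
    rw [this]
    exact Ideal.add_mem _ hi (Ideal.mul_mem_right _ _ hj)
  have : f = (f - b * n') + b * n' := by ring
  rw [this]
  exact Ideal.add_mem _ (Ideal.mem_sup_left h2) (Ideal.mem_sup_right
    (Ideal.mul_mem_right _ _ (Ideal.mem_span_singleton_self b)))

instance finDimHom [Finite σ] (d : ℕ) : Module.Finite K (homogeneousSubmodule σ K d) := by
  exact Module.Finite.iff_fg.2 (homogeneousSubmodule_fg _ _ d)

theorem finrank_map_eq {M P Q : Type} [AddCommGroup M] [Module K M] [AddCommGroup P] [Module K P]
    [AddCommGroup Q] [Module K Q] (f : M →ₗ[K] P) (g : M →ₗ[K] Q) (N : Submodule K M)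
    (h : LinearMap.ker f = LinearMap.ker g) :
    Module.finrank K (N.map f) = Module.finrank K (N.map g) := by
  have hk : LinearMap.ker (f.domRestrict N) = LinearMap.ker (g.domRestrict N) := by
    ext x
    have := SetLike.ext_iff.1 h (x : M)
    rw [LinearMap.mem_ker, LinearMap.mem_ker] at this
    rw [LinearMap.mem_ker, LinearMap.mem_ker]
    exact this
  have e1 := (f.domRestrict N).quotKerEquivRange
  have e2 := (g.domRestrict N).quotKerEquivRange
  rw [← LinearMap.range_domRestrict, ← LinearMap.range_domRestrict]
  exact (e1.symm.trans ((Submodule.quotEquivOfEq _ _ hk).trans e2)).finrank_eq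

theorem ker_mk (I : Ideal (MvPolynomial σ K)) :
    LinearMap.ker (Ideal.Quotient.mkₐ K I).toLinearMap = I.restrictScalars K := by
  ext x
  simp [Ideal.Quotient.eq_zero_iff_mem]

theorem mk_zero_iff (I : Ideal (MvPolynomial σ K)) (f : MvPolynomial σ K) :
    (Ideal.Quotient.mkₐ K I).toLinearMap f = 0 ↔ f ∈ I := by
  simp [Ideal.Quotient.eq_zero_iff_mem]

theorem hilb_nzd [Finite σ] {I : Ideal (MvPolynomial σ K)} (hI : WH 1 I) {l : MvPolynomial σ K}
    (hl : l.IsHomogeneous 1) (hnz : NZ I l) :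
    quotientHilbertSeries (I ⊔ Ideal.span {l}) = (1 - PowerSeries.X) * quotientHilbertSeries I := by
  set J := I ⊔ Ideal.span {l} with hJ
  let pI := (Ideal.Quotient.mkₐ K I).toLinearMap
  let pJ := (Ideal.Quotient.mkₐ K J).toLinearMap
  have hIJ : I ≤ J := le_sup_left
  -- restrict to degree d
  have hker : ∀ d f, f.IsHomogeneous d → f ∈ J →
      ∃ g, (∀ k, d = k + 1 → g.IsHomogeneous k) ∧ (d = 0 → g = 0) ∧ f - l * g ∈ I := by
    intro d f hf hfJ
    obtain ⟨i, hi, y, hy, hiy⟩ := Submodule.mem_sup.1 hfJ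
    obtain ⟨n, rfl⟩ := Ideal.mem_span_singleton'.1 hy
    have hfc : weightedHomogeneousComponent 1 d f = f :=
      IsWeightedHomogeneous.weightedHomogeneousComponent_same hf
    rcases d with _ | k
    · refine ⟨0, by simp, fun _ => rfl, ?_⟩
      have h0 : weightedHomogeneousComponent (1 : σ → ℕ) 0 (n * l) = 0 := by
        rw [weightedHomogeneousComponent_zero _ (by simp)]
        have : coeff 0 l = 0 := hl.coeff_eq_zero (by simp)
        rw [← constantCoeff_eq, map_mul, constantCoeff_eq, this]; simp
      rw [mul_zero, sub_zero, ← hfc, ← hiy, map_add, h0, add_zero]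
      exact hI i hi 0
    · refine ⟨weightedHomogeneousComponent 1 k n, ?_, by simp, ?_⟩
      · intro k' hk'
        obtain rfl : k = k' := by omega
        exact weightedHomogeneousComponent_isWeightedHomogeneous k n
      · rw [← comp_mul 1 hl, add_comm 1 k, ← hfc, ← hiy, map_add, mul_comm n l]
        simpa using hI i hi (k + 1)
  let q : (MvPolynomial σ K ⧸ I) →ₗ[K] (MvPolynomial σ K ⧸ J) :=
    (Ideal.Quotient.factorₐ K hIJ).toLinearMap
  have hq : ∀ f, q (pI f) = pJ f := fun f => rfl
  have hmap : ∀ d, ((homogeneousSubmodule σ K d).map pI).map q =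
      (homogeneousSubmodule σ K d).map pJ := by
    intro d; rw [← Submodule.map_comp]; rfl
  let mulL : (MvPolynomial σ K ⧸ I) →ₗ[K] (MvPolynomial σ K ⧸ I) :=
    LinearMap.mulLeft K (pI l)
  have hmulL : ∀ f, mulL (pI f) = pI (l * f) := fun f => (map_mul (Ideal.Quotient.mkₐ K I) l f).symm
  have hinj : Function.Injective mulL := by
    rw [← LinearMap.ker_eq_bot, LinearMap.ker_eq_bot']
    intro m hm
    obtain ⟨f, rfl⟩ := Ideal.Quotient.mk_surjective m
    have : pI (l * f) = 0 := by rw [← hmulL]; exact hm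
    exact (mk_zero_iff I f).2 (hnz f ((mk_zero_iff I _).1 this))
  have hrn : ∀ d, Module.finrank K ((homogeneousSubmodule σ K d).map pJ) +
      Module.finrank K (LinearMap.ker (q.domRestrict ((homogeneousSubmodule σ K d).map pI))) =
      Module.finrank K ((homogeneousSubmodule σ K d).map pI) := by
    intro d
    rw [← hmap, ← LinearMap.range_domRestrict]
    exact LinearMap.finrank_range_add_finrank_ker _
  ext d
  rw [sub_mul, one_mul, map_sub]
  rcases d with _ | d
  · have hk0 : LinearMap.ker (q.domRestrict ((homogeneousSubmodule σ K 0).map pI)) = ⊥ := by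
      rw [LinearMap.ker_eq_bot']
      rintro ⟨_, f, hf, rfl⟩ hm
      have h1 : pJ f = 0 := hm
      obtain ⟨g, -, hg, hfg⟩ := hker 0 f hf ((mk_zero_iff J f).1 h1)
      rw [hg rfl, mul_zero, sub_zero] at hfg
      exact Subtype.ext ((mk_zero_iff I f).2 hfg)
    have := hrn 0
    rw [hk0, finrank_bot, add_zero] at this
    simp only [PowerSeries.coeff_zero_X_mul, sub_zero, quotientHilbertSeries, PowerSeries.coeff_mk]
    exact_mod_cast this
  · have hk : (LinearMap.ker (q.domRestrict ((homogeneousSubmodule σ K (d + 1)).map pI))).map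
        ((homogeneousSubmodule σ K (d + 1)).map pI).subtype =
        ((homogeneousSubmodule σ K d).map pI).map mulL := by
      ext m
      constructor
      · rintro ⟨⟨_, f, hf, rfl⟩, hm, rfl⟩
        have h1 : pJ f = 0 := hm
        obtain ⟨g, hg, -, hfg⟩ := hker (d + 1) f hf ((mk_zero_iff J f).1 h1)
        refine ⟨pI g, ⟨g, hg d rfl, rfl⟩, ?_⟩
        rw [hmulL]
        have := (mk_zero_iff I _).2 hfg
        rw [map_sub, sub_eq_zero] at this
        exact this.symm
      · rintro ⟨_, ⟨g, hg, rfl⟩, rfl⟩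
        rw [hmulL]
        refine ⟨⟨pI (l * g), l * g, ?_, rfl⟩, ?_, rfl⟩
        · have := hl.mul (show g.IsHomogeneous d from hg)
          rw [add_comm] at this
          exact this
        · change pJ (l * g) = 0
          exact (mk_zero_iff J _).2 (Ideal.mem_sup_right (Ideal.mul_mem_right _ _
            (Ideal.mem_span_singleton_self l)))
    have e1 : Module.finrank K (LinearMap.ker (q.domRestrict
        ((homogeneousSubmodule σ K (d + 1)).map pI))) =
        Module.finrank K ((homogeneousSubmodule σ K d).map pI) := by
      rw [(Submodule.equivMapOfInjective mulL hinj _).finrank_eq, ← hk]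
      exact (Submodule.equivMapOfInjective _ (Submodule.subtype_injective _) _).finrank_eq
    have := hrn (d + 1)
    rw [e1] at this
    simp only [PowerSeries.coeff_succ_X_mul, quotientHilbertSeries, PowerSeries.coeff_mk]
    rw [eq_sub_iff_add_eq]
    exact_mod_cast this

end graded

section tensor
open TensorProduct
variable {K : Type} [Field K] {σ τ : Type}

def Jsum (I : Ideal (MvPolynomial σ K)) (J : Ideal (MvPolynomial τ K)) :
    Ideal (MvPolynomial (σ ⊕ τ) K) :=
  I.map (rename (R := K) Sum.inl).toRingHom ⊔ J.map (rename (R := K) Sum.inr).toRingHom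

section gen
variable {A B : Type} [CommRing A] [CommRing B] [Algebra K A] [Algebra K B]
  (α : MvPolynomial σ K →ₐ[K] A) (β : MvPolynomial τ K →ₐ[K] B)

def PhiT : MvPolynomial (σ ⊕ τ) K →ₐ[K] A ⊗[K] B :=
  aeval (Sum.elim (fun s => α (X s) ⊗ₜ 1) (fun t => 1 ⊗ₜ β (X t)))

theorem PhiT_inl (f : MvPolynomial σ K) :
    PhiT α β (rename Sum.inl f) = α f ⊗ₜ 1 := by
  have : (PhiT α β).comp (rename Sum.inl) =
    (Algebra.TensorProduct.includeLeft (R := K) (S := K)).comp α := by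
    apply algHom_ext
    intro s
    simp [PhiT]
  exact congrArg (fun g => g f) this

theorem PhiT_inr (f : MvPolynomial τ K) :
    PhiT α β (rename Sum.inr f) = 1 ⊗ₜ β f := by
  have : (PhiT α β).comp (rename Sum.inr) =
    (Algebra.TensorProduct.includeRight (R := K)).comp β := by
    apply algHom_ext
    intro s
    simp [PhiT]
  exact congrArg (fun g => g f) this

variable {α β} {I : Ideal (MvPolynomial σ K)} {J : Ideal (MvPolynomial τ K)}
  (hα : ∀ f, α f = 0 ↔ f ∈ I) (hβ : ∀ f, β f = 0 ↔ f ∈ J)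
  (sα : Function.Surjective α) (sβ : Function.Surjective β)

include hα hβ in
theorem PhiT_zero_of_mem {f : MvPolynomial (σ ⊕ τ) K} (h : f ∈ Jsum I J) : PhiT α β f = 0 := by
  have : Jsum I J ≤ RingHom.ker (PhiT α β) := by
    refine sup_le ?_ ?_
    · rw [Ideal.map_le_iff_le_comap]
      intro g hg
      change PhiT α β (rename Sum.inl g) = 0
      rw [PhiT_inl, (hα g).2 hg, zero_tmul]
    · rw [Ideal.map_le_iff_le_comap]
      intro g hg
      change PhiT α β (rename Sum.inr g) = 0
      rw [PhiT_inr, (hβ g).2 hg, tmul_zero]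
  exact this h

include hα hβ sα sβ in
theorem PhiT_zero_iff (f : MvPolynomial (σ ⊕ τ) K) : PhiT α β f = 0 ↔ f ∈ Jsum I J := by
  refine ⟨fun h => ?_, PhiT_zero_of_mem hα hβ⟩
  let a : A →ₐ[K] (MvPolynomial (σ ⊕ τ) K ⧸ Jsum I J) :=
    AlgHom.liftOfSurjective α sα ((Ideal.Quotient.mkₐ K (Jsum I J)).comp (rename Sum.inl)) (by
      intro g hg
      exact Ideal.Quotient.eq_zero_iff_mem.2 (Ideal.mem_sup_left (Ideal.mem_map_of_mem
        (rename (R := K) Sum.inl).toRingHom ((hα g).1 hg))))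
  let b : B →ₐ[K] (MvPolynomial (σ ⊕ τ) K ⧸ Jsum I J) :=
    AlgHom.liftOfSurjective β sβ ((Ideal.Quotient.mkₐ K (Jsum I J)).comp (rename Sum.inr)) (by
      intro g hg
      exact Ideal.Quotient.eq_zero_iff_mem.2 (Ideal.mem_sup_right (Ideal.mem_map_of_mem
        (rename (R := K) Sum.inr).toRingHom ((hβ g).1 hg))))
  have ha : ∀ g, a (α g) = Ideal.Quotient.mkₐ K (Jsum I J)
    (rename Sum.inl g) := fun g => AlgHom.liftOfSurjective_apply ..
  have hb : ∀ g, b (β g) = Ideal.Quotient.mkₐ K (Jsum I J)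
    (rename Sum.inr g) := fun g => AlgHom.liftOfSurjective_apply ..
  have : (Algebra.TensorProduct.productMap a b).comp (PhiT α β) =
      Ideal.Quotient.mkₐ K (Jsum I J) := by
    apply algHom_ext
    rintro (s | t)
    · simp only [AlgHom.comp_apply, PhiT, aeval_X, Sum.elim_inl,
        Algebra.TensorProduct.productMap_apply_tmul, map_one, mul_one, ha, rename_X]
    · simp only [AlgHom.comp_apply, PhiT, aeval_X, Sum.elim_inr,
        Algebra.TensorProduct.productMap_apply_tmul, map_one, one_mul, hb, rename_X]
  have h2 := congrArg (fun g => g f) this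
  simp only [AlgHom.comp_apply, h, map_zero] at h2
  exact Ideal.Quotient.eq_zero_iff_mem.1 h2.symm

include hα sα in
theorem mulLeft_inj {a : MvPolynomial σ K} (h : NZ I a) :
    Function.Injective (LinearMap.mulLeft K (α a)) := by
  rw [← LinearMap.ker_eq_bot, LinearMap.ker_eq_bot']
  intro m hm
  obtain ⟨f, rfl⟩ := sα m
  refine (hα f).2 (h f ?_)
  rw [← hα, map_mul]
  exact hm

include hα hβ sα sβ in
theorem NZ_inr_aux {a : MvPolynomial τ K} (h : NZ J a) : NZ (Jsum I J) (rename Sum.inr a) := by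
  intro f hf
  rw [← PhiT_zero_iff hα hβ sα sβ] at hf ⊢
  rw [map_mul, PhiT_inr] at hf
  have hinj := Module.Flat.lTensor_preserves_injective_linearMap (M := A)
    _ (mulLeft_inj hβ sβ h)
  apply hinj
  rw [map_zero, ← hf]
  generalize PhiT α β f = x
  induction x using TensorProduct.induction_on with
  | zero => simp
  | tmul x y => simp
  | add x y hx hy => rw [map_add, hx, hy, mul_add]

include hα hβ sα sβ in
theorem NZ_inl_aux {a : MvPolynomial σ K} (h : NZ I a) : NZ (Jsum I J) (rename Sum.inl a) := by
  intro f hf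
  rw [← PhiT_zero_iff hα hβ sα sβ] at hf ⊢
  rw [map_mul, PhiT_inl] at hf
  have hinj := Module.Flat.rTensor_preserves_injective_linearMap (M := B)
    _ (mulLeft_inj hα sα h)
  apply hinj
  rw [map_zero, ← hf]
  generalize PhiT α β f = x
  induction x using TensorProduct.induction_on with
  | zero => simp
  | tmul x y => simp
  | add x y hx hy => rw [map_add, hx, hy, mul_add]

theorem span_tensor {r1 r2 : ℕ → ℕ}
    (b1 : Module.Basis (Σ d : ℕ, Fin (r1 d)) K A)
    (hb1 : ∀ d, Submodule.span K (Set.range (fun i => b1 ⟨d, i⟩)) =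
      (homogeneousSubmodule σ K d).map α.toLinearMap)
    (b2 : Module.Basis (Σ d : ℕ, Fin (r2 d)) K B)
    (hb2 : ∀ d, Submodule.span K (Set.range (fun i => b2 ⟨d, i⟩)) =
      (homogeneousSubmodule τ K d).map β.toLinearMap) (d : ℕ) :
    Module.finrank K ((homogeneousSubmodule (σ ⊕ τ) K d).map (PhiT α β).toLinearMap) =
      ∑ ij ∈ Finset.HasAntidiagonal.antidiagonal d, r1 ij.1 * r2 ij.2 := by
  let ι := Σ ij : Finset.HasAntidiagonal.antidiagonal d, Fin (r1 ij.1.1) × Fin (r2 ij.1.2)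
  let emb : ι → (Σ d : ℕ, Fin (r1 d)) × (Σ d : ℕ, Fin (r2 d)) :=
    fun x => (⟨x.1.1.1, x.2.1⟩, ⟨x.1.1.2, x.2.2⟩)
  have hemb : Function.Injective emb := by
    rintro ⟨⟨⟨i, j⟩, h⟩, a, b⟩ ⟨⟨⟨i', j'⟩, h'⟩, a', b'⟩ hh
    simp only [emb, Prod.mk.injEq, Sigma.mk.injEq] at hh
    obtain ⟨⟨rfl, h1⟩, rfl, h2⟩ := hh
    cases h1; cases h2; rfl
  let B := b1.tensorProduct b2
  have hli : LinearIndependent K (B ∘ emb) := B.linearIndependent.comp emb hemb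
  have hspan : (homogeneousSubmodule (σ ⊕ τ) K d).map (PhiT α β).toLinearMap =
      Submodule.span K (Set.range (B ∘ emb)) := by
    have htm : ∀ i j, i + j = d → ∀ x ∈ (homogeneousSubmodule σ K i).map α.toLinearMap,
        ∀ y ∈ (homogeneousSubmodule τ K j).map β.toLinearMap,
        x ⊗ₜ[K] y ∈ Submodule.span K (Set.range (B ∘ emb)) := by
      intro i j hij x hx y hy
      rw [← hb1] at hx
      rw [← hb2] at hy
      have := Submodule.apply_mem_map₂ (TensorProduct.mk K A _) hx hy
      rw [Submodule.map₂_span_span] at this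
      refine Submodule.span_mono ?_ this
      rintro _ ⟨_, ⟨a, rfl⟩, _, ⟨b, rfl⟩, rfl⟩
      refine ⟨⟨⟨(i, j), Finset.HasAntidiagonal.mem_antidiagonal.2 hij⟩, (a, b)⟩, ?_⟩
      simp [B, emb]
    apply le_antisymm
    · rintro _ ⟨f, hf, rfl⟩
      rw [AlgHom.toLinearMap_apply]
      rw [f.as_sum, map_sum]
      apply Submodule.sum_mem
      intro e he
      have hdeg : e.degree = d := by
        have h0 := hf (mem_support_iff.1 he)
        rw [Finsupp.degree_eq_weight_one]
        exact h0
      have hmon : ∀ e : σ ⊕ τ →₀ ℕ, ∃ (e1 : σ →₀ ℕ) (e2 : τ →₀ ℕ), e1.degree + e2.degree = e.degree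
          ∧ monomial e (1 : K) = rename Sum.inl (monomial e1 1) * rename Sum.inr (monomial e2 1) := by
        intro e
        induction e using Finsupp.induction_linear with
        | zero => exact ⟨0, 0, by simp, by simp⟩
        | add e f he hf =>
          obtain ⟨e1, e2, h1, h2⟩ := he
          obtain ⟨f1, f2, h3, h4⟩ := hf
          refine ⟨e1 + f1, e2 + f2, by simp only [map_add]; omega, ?_⟩
          have : ∀ {ρ : Type} (e f : ρ →₀ ℕ), monomial (e + f) (1 : K) =
            monomial e 1 * monomial f 1 := by intro ρ e f; simp [monomial_mul]
          rw [this, this, this, h2, h4, map_mul, map_mul]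
          ring
        | single z n =>
          rcases z with s | t
          · exact ⟨Finsupp.single s n, 0, by simp, by simp [rename_monomial]⟩
          · exact ⟨0, Finsupp.single t n, by simp, by simp [rename_monomial]⟩
      obtain ⟨e1, e2, h1, h2⟩ := hmon e
      have : monomial e (coeff e f) = coeff e f • monomial e (1 : K) := by simp [smul_monomial]
      rw [this, map_smul, h2, map_mul, PhiT_inl, PhiT_inr, Algebra.TensorProduct.tmul_mul_tmul,
        mul_one, one_mul]
      apply Submodule.smul_mem
      exact htm e1.degree e2.degree (h1.trans hdeg) _ ⟨_, isHomogeneous_monomial _ rfl, rfl⟩ _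
        ⟨_, isHomogeneous_monomial _ rfl, rfl⟩
    · rw [Submodule.span_le]
      rintro _ ⟨⟨⟨⟨i, j⟩, hij⟩, a, b⟩, rfl⟩
      have h1 : b1 ⟨i, a⟩ ∈ (homogeneousSubmodule σ K i).map α.toLinearMap := by
        rw [← hb1]; exact Submodule.subset_span ⟨a, rfl⟩
      have h2 : b2 ⟨j, b⟩ ∈ (homogeneousSubmodule τ K j).map β.toLinearMap := by
        rw [← hb2]; exact Submodule.subset_span ⟨b, rfl⟩
      obtain ⟨f, hf, hf'⟩ := h1
      obtain ⟨g, hg, hg'⟩ := h2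
      refine ⟨rename Sum.inl f * rename Sum.inr g, ?_, ?_⟩
      · have := (IsHomogeneous.rename_isHomogeneous (f := (Sum.inl : σ → σ ⊕ τ)) hf).mul
          (IsHomogeneous.rename_isHomogeneous (f := (Sum.inr : τ → σ ⊕ τ)) hg)
        rw [Finset.HasAntidiagonal.mem_antidiagonal.1 hij] at this
        exact this
      · rw [AlgHom.toLinearMap_apply, map_mul, PhiT_inl, PhiT_inr]
        simp only [B, emb, Function.comp, Module.Basis.tensorProduct_apply, ← hf', ← hg',
          Algebra.TensorProduct.tmul_mul_tmul, mul_one, one_mul]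
        rfl
  rw [hspan, finrank_span_eq_card hli, Fintype.card_sigma]
  simp only [Fintype.card_prod, Fintype.card_fin]
  rw [Finset.sum_coe_sort (Finset.HasAntidiagonal.antidiagonal d) (fun ij => r1 ij.1 * r2 ij.2)]

end gen

variable {I : Ideal (MvPolynomial σ K)} {J : Ideal (MvPolynomial τ K)}

theorem mkA_zero_iff (I : Ideal (MvPolynomial σ K)) (f : MvPolynomial σ K) :
    Ideal.Quotient.mkₐ K I f = 0 ↔ f ∈ I := Ideal.Quotient.eq_zero_iff_mem

theorem NZ_inr {a : MvPolynomial τ K} (h : NZ J a) : NZ (Jsum I J) (rename Sum.inr a) :=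
  NZ_inr_aux (mkA_zero_iff I) (mkA_zero_iff J) (Ideal.Quotient.mkₐ_surjective K I)
    (Ideal.Quotient.mkₐ_surjective K J) h

theorem NZ_inl {a : MvPolynomial σ K} (h : NZ I a) : NZ (Jsum I J) (rename Sum.inl a) :=
  NZ_inl_aux (mkA_zero_iff I) (mkA_zero_iff J) (Ideal.Quotient.mkₐ_surjective K I)
    (Ideal.Quotient.mkₐ_surjective K J) h

/-- degree `d` part of the quotient -/
abbrev Rd (I : Ideal (MvPolynomial σ K)) (d : ℕ) : Submodule K (MvPolynomial σ K ⧸ I) :=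
  (homogeneousSubmodule σ K d).map (Ideal.Quotient.mkₐ K I).toLinearMap

theorem Rd_internal (hI : WH 1 I) : DirectSum.IsInternal (Rd I) := by
  let proj : ∀ d : ℕ, (MvPolynomial σ K ⧸ I) →ₗ[K] (MvPolynomial σ K ⧸ I) := fun d =>
    Submodule.mapQ (I.restrictScalars K) (I.restrictScalars K)
      (weightedHomogeneousComponent (1 : σ → ℕ) d) (fun f hf => hI f hf d)
  have hproj : ∀ d f, proj d (Ideal.Quotient.mkₐ K I f) =
    Ideal.Quotient.mkₐ K I (weightedHomogeneousComponent (1 : σ → ℕ) d f) := fun d f => rfl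
  constructor
  · rw [injective_iff_map_eq_zero]
    intro x hx
    have key : ∀ (x : DirectSum ℕ fun d => Rd I d) d,
        proj d (DirectSum.coeAddMonoidHom (Rd I) x) = (x d : MvPolynomial σ K ⧸ I) := by
      intro x d
      induction x using DirectSum.induction_on with
      | zero => simp
      | of i y =>
        obtain ⟨_, f, hf, rfl⟩ := y
        rw [DirectSum.coeAddMonoidHom_of]
        change proj d (Ideal.Quotient.mkₐ K I f) = _
        rw [hproj]
        by_cases h : d = i
        · subst h
          rw [IsWeightedHomogeneous.weightedHomogeneousComponent_same hf, DirectSum.of_eq_same]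
          rfl
        · rw [IsWeightedHomogeneous.weightedHomogeneousComponent_ne d hf h,
            DirectSum.of_eq_of_ne _ _ _ h]
          simp
      | add x y hx hy => rw [map_add, map_add, hx, hy]; rfl
    ext d
    rw [← key x d, hx, map_zero]; rfl
  · intro m
    obtain ⟨f, rfl⟩ := Ideal.Quotient.mk_surjective m
    change _ ∈ Set.range _
    change _ ∈ AddMonoidHom.mrange (DirectSum.coeAddMonoidHom (Rd I))
    rw [← sum_weightedHomogeneousComponent (1 : σ → ℕ) f,
      finsum_eq_sum _ (weightedHomogeneousComponent_finsupp f), map_sum]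
    apply AddSubmonoid.sum_mem
    intro d _
    refine ⟨DirectSum.of (fun d => Rd I d) d ⟨_, _, weightedHomogeneousComponent_mem 1 f d, rfl⟩, ?_⟩
    rw [DirectSum.coeAddMonoidHom_of]
    rfl

theorem exists_basis [Finite σ] (hI : WH 1 I) :
    ∃ b : Module.Basis (Σ d : ℕ, Fin (Module.finrank K (Rd I d))) K (MvPolynomial σ K ⧸ I),
      ∀ d, Submodule.span K (Set.range (fun i => b ⟨d, i⟩)) = Rd I d := by
  let v : ∀ d, Module.Basis (Fin (Module.finrank K (Rd I d))) K (Rd I d) :=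
    fun d => Module.finBasis K (Rd I d)
  refine ⟨(Rd_internal hI).collectedBasis v, ?_⟩
  intro d
  have h1 : (fun i => ((Rd_internal hI).collectedBasis v) ⟨d, i⟩) =
      (Rd I d).subtype ∘ v d := by
    funext i
    rw [DirectSum.IsInternal.collectedBasis_coe]
    rfl
  rw [h1, Set.range_comp, ← Submodule.map_span, (v d).span_eq, Submodule.map_top,
    Submodule.range_subtype]

theorem hilb_tensor [Finite σ] [Finite τ] (hI : WH 1 I) (hJ : WH 1 J) :
    quotientHilbertSeries (Jsum I J) = quotientHilbertSeries I * quotientHilbertSeries J := by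
  obtain ⟨b1, hb1⟩ := exists_basis hI
  obtain ⟨b2, hb2⟩ := exists_basis hJ
  ext d
  rw [PowerSeries.coeff_mul]
  simp only [quotientHilbertSeries, PowerSeries.coeff_mk]
  rw [finrank_map_eq _ (PhiT (Ideal.Quotient.mkₐ K I) (Ideal.Quotient.mkₐ K J)).toLinearMap _ (by
    ext f
    rw [LinearMap.mem_ker, LinearMap.mem_ker, mk_zero_iff]
    exact (PhiT_zero_iff (mkA_zero_iff I) (mkA_zero_iff J) (Ideal.Quotient.mkₐ_surjective K I)
      (Ideal.Quotient.mkₐ_surjective K J) f).symm)]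
  rw [span_tensor b1 hb1 b2 hb2 d]
  push_cast
  rfl

end tensor

section main
variable {K : Type} [Field K]

theorem wX {σ : Type} (w : σ → ℕ) (i : σ) (m : ℕ) (h : w i = m) :
    IsWeightedHomogeneous w (X i : MvPolynomial σ K) m := h ▸ isWeightedHomogeneous_X K w i

theorem wsub {σ : Type} {w : σ → ℕ} {f g : MvPolynomial σ K} {m : ℕ}
    (hf : IsWeightedHomogeneous w f m) (hg : IsWeightedHomogeneous w g m) :
    IsWeightedHomogeneous w (f - g) m :=
  (weightedHomogeneousSubmodule K w m).sub_mem hf hg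

theorem WH_bei {V : Type} (G : SimpleGraph V) (w : V ⊕ V → ℕ) (a b : ℕ)
    (ha : ∀ i, w (Sum.inl i) = a) (hb : ∀ i, w (Sum.inr i) = b) :
    WH w (binomialEdgeIdeal K G) := by
  apply WH_span
  rintro _ ⟨i, j, -, rfl⟩
  exact ⟨a + b, wsub ((wX w _ a (ha _)).mul (wX w _ b (hb _)))
    ((wX w _ a (ha _)).mul (wX w _ b (hb _)))⟩

theorem WH_bei_map {V ρ : Type} (G : SimpleGraph V) (r : V ⊕ V → ρ) (w : ρ → ℕ) (a b : ℕ)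
    (ha : ∀ i, w (r (Sum.inl i)) = a) (hb : ∀ i, w (r (Sum.inr i)) = b) :
    WH w ((binomialEdgeIdeal K G).map (rename (R := K) r).toRingHom) := by
  rw [binomialEdgeIdeal, Ideal.map_span]
  apply WH_span
  rintro _ ⟨_, ⟨i, j, -, rfl⟩, rfl⟩
  refine ⟨a + b, ?_⟩
  have : (rename (R := K) r).toRingHom
      (X (Sum.inl i) * X (Sum.inr j) - X (Sum.inl j) * X (Sum.inr i)) =
      X (r (Sum.inl i)) * X (r (Sum.inr j)) - X (r (Sum.inl j)) * X (r (Sum.inr i)) := by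
    simp
  rw [this]
  exact wsub ((wX w _ a (ha _)).mul (wX w _ b (hb _)))
    ((wX w _ a (ha _)).mul (wX w _ b (hb _)))

theorem WH_single {ρ : Type} (w : ρ → ℕ) (f : MvPolynomial ρ K) (m : ℕ)
    (h : IsWeightedHomogeneous w f m) : WH w (Ideal.span {f}) := by
  apply WH_span
  rintro _ rfl
  exact ⟨m, h⟩

theorem Jsum_sup {σ τ : Type} (I : Ideal (MvPolynomial σ K)) (J : Ideal (MvPolynomial τ K))
    (s : σ) : Jsum I J ⊔ Ideal.span {X (Sum.inl s)} = Jsum (I ⊔ Ideal.span {X s}) J := by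
  have : (Ideal.span {(X s : MvPolynomial σ K)}).map
      (rename (R := K) (Sum.inl : σ → σ ⊕ τ)).toRingHom = Ideal.span {X (Sum.inl s)} := by
    rw [Ideal.map_span]; simp
  rw [Jsum, Jsum, Ideal.map_sup, this]
  rw [sup_right_comm]

/-- the two-step reduction -/
theorem hilb_glue {A B : Type} [Finite A] [Finite B] (G : SimpleGraph A) (H : SimpleGraph B)
    (a : A) (b : B) (ha : SimpV G a) (hb : SimpV H b) :
    quotientHilbertSeries
      ((Jsum (binomialEdgeIdeal K G) (binomialEdgeIdeal K H)
        ⊔ Ideal.span {X (Sum.inr (Sum.inl b)) - X (Sum.inl (Sum.inl a))})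
        ⊔ Ideal.span {X (Sum.inl (Sum.inr a)) - X (Sum.inr (Sum.inr b))}) =
      (1 - PowerSeries.X) ^ 2 * quotientHilbertSeries (binomialEdgeIdeal K G) *
        quotientHilbertSeries (binomialEdgeIdeal K H) := by
  set I := binomialEdgeIdeal K G with hI
  set J := binomialEdgeIdeal K H with hJ
  have nx' : NZ J (X (Sum.inl b)) := nzd_free K b _ (Or.inl rfl) _ H rfl hb
  have ny : NZ I (X (Sum.inr a)) := nzd_free K a _ (Or.inr rfl) _ G rfl ha
  have ny2 : NZ (Jsum I J) (X (Sum.inl (Sum.inr a))) := by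
    have := NZ_inl (J := J) ny
    rwa [rename_X] at this
  have nx2 : ∀ I0 : Ideal (MvPolynomial (A ⊕ A) K),
      NZ (Jsum I0 J) (X (Sum.inr (Sum.inl b))) := by
    intro I0
    have := NZ_inr (I := I0) nx'
    rwa [rename_X] at this
  have hwJ : ∀ (w : (A ⊕ A) ⊕ (B ⊕ B) → ℕ) (p q r s : ℕ),
      (∀ i, w (Sum.inl (Sum.inl i)) = p) → (∀ i, w (Sum.inl (Sum.inr i)) = q) →
      (∀ i, w (Sum.inr (Sum.inl i)) = r) → (∀ i, w (Sum.inr (Sum.inr i)) = s) →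
      WH w (Jsum I J) := by
    intro w p q r s hp hq hr hs
    exact WH_sup (WH_bei_map G _ w p q hp hq) (WH_bei_map H _ w r s hr hs)
  let wB : (A ⊕ A) ⊕ (B ⊕ B) → ℕ := Sum.elim (fun _ => 0) (fun _ => 1)
  let wy : (A ⊕ A) ⊕ (B ⊕ B) → ℕ := Sum.elim (Sum.elim (fun _ => 0) (fun _ => 1)) (fun _ => 0)
  have s1 : NZ (Jsum I J) (X (Sum.inr (Sum.inl b)) - X (Sum.inl (Sum.inl a))) :=
    NZ_sub (w := wB) (hwJ wB 0 0 1 1 (fun _ => rfl) (fun _ => rfl) (fun _ => rfl) (fun _ => rfl))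
      (wX _ _ _ rfl) (wX _ _ _ rfl) (nx2 I)
  have s2 : NZ (Jsum I J ⊔ Ideal.span {X (Sum.inl (Sum.inr a))})
      (X (Sum.inr (Sum.inl b)) - X (Sum.inl (Sum.inl a))) := by
    refine NZ_sub (w := wB) (WH_sup (hwJ wB 0 0 1 1 (fun _ => rfl) (fun _ => rfl)
      (fun _ => rfl) (fun _ => rfl)) (WH_single _ _ 0 (wX _ _ _ rfl)))
      (wX _ _ _ rfl) (wX _ _ _ rfl) ?_
    rw [Jsum_sup]
    exact nx2 _
  have s3 := NZ_swap ny2 s2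
  have s4 : NZ (Jsum I J ⊔ Ideal.span {X (Sum.inr (Sum.inl b)) - X (Sum.inl (Sum.inl a))})
      (X (Sum.inl (Sum.inr a)) - X (Sum.inr (Sum.inr b))) :=
    NZ_sub (w := wy) (WH_sup (hwJ wy 0 1 0 0 (fun _ => rfl) (fun _ => rfl)
      (fun _ => rfl) (fun _ => rfl))
      (WH_single _ _ 0 (wsub (wX _ _ _ rfl) (wX _ _ _ rfl))))
      (wX _ _ _ rfl) (wX _ _ _ rfl) s3
  have h1 : WH 1 (Jsum I J) := hwJ 1 1 1 1 1 (fun _ => rfl) (fun _ => rfl)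
      (fun _ => rfl) (fun _ => rfl)
  have l1 : ∀ i j : (A ⊕ A) ⊕ (B ⊕ B), (X i - X j : MvPolynomial _ K).IsHomogeneous 1 :=
    fun i j => wsub (wX _ _ _ rfl) (wX _ _ _ rfl)
  rw [hilb_nzd (WH_sup h1 (WH_single _ _ 1 (l1 _ _))) (l1 _ _) s4,
    hilb_nzd h1 (l1 _ _) s1,
    hilb_tensor (WH_bei G 1 1 1 (fun _ => rfl) (fun _ => rfl))
      (WH_bei H 1 1 1 (fun _ => rfl) (fun _ => rfl))]
  ring

/-- Hilbert series comparison along a surjective renaming. -/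
theorem hilb_rename {σ τ : Type} (r : σ → τ) (hr : Function.Surjective r)
    (I : Ideal (MvPolynomial σ K)) (J : Ideal (MvPolynomial τ K))
    (h : ∀ f, rename r f ∈ J ↔ f ∈ I) :
    quotientHilbertSeries J = quotientHilbertSeries I := by
  ext d
  simp only [quotientHilbertSeries, PowerSeries.coeff_mk]
  have hmap : homogeneousSubmodule τ K d =
      (homogeneousSubmodule σ K d).map (rename (R := K) r).toLinearMap := by
    apply le_antisymm
    · intro f hf
      obtain ⟨s, hs⟩ := hr.hasRightInverse
      refine ⟨rename s f, IsHomogeneous.rename_isHomogeneous hf, ?_⟩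
      rw [AlgHom.toLinearMap_apply, rename_rename]
      have : r ∘ s = id := funext hs
      rw [this, rename_id_apply]
    · rintro _ ⟨f, hf, rfl⟩
      exact IsHomogeneous.rename_isHomogeneous hf
  rw [hmap, ← Submodule.map_comp]
  congr 1
  apply finrank_map_eq
  ext f
  rw [LinearMap.mem_ker, LinearMap.mem_ker, mk_zero_iff, ← h f]
  exact Ideal.Quotient.eq_zero_iff_mem

end main

section glue
variable {K : Type} [Field K] {V : Type}

def glueMap (A B : Set V) : (A ⊕ A) ⊕ (B ⊕ B) → V ⊕ V :=
  Sum.elim (Sum.map Subtype.val Subtype.val) (Sum.map Subtype.val Subtype.val)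

theorem glue_iff (G : SimpleGraph V) (A B : Set V) (v : V) (hA : v ∈ A) (hB : v ∈ B)
    (hcover : A ∪ B = Set.univ) (hinter : A ∩ B = {v})
    (hedges : ∀ a b, G.Adj a b → (a ∈ A ∧ b ∈ A) ∨ (a ∈ B ∧ b ∈ B))
    (f : MvPolynomial ((A ⊕ A) ⊕ (B ⊕ B)) K) :
    rename (glueMap A B) f ∈ binomialEdgeIdeal K G ↔
    f ∈ ((Jsum (binomialEdgeIdeal K (G.induce A)) (binomialEdgeIdeal K (G.induce B))
        ⊔ Ideal.span {X (Sum.inr (Sum.inl ⟨v, hB⟩)) - X (Sum.inl (Sum.inl ⟨v, hA⟩))})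
        ⊔ Ideal.span {X (Sum.inl (Sum.inr ⟨v, hA⟩)) - X (Sum.inr (Sum.inr ⟨v, hB⟩))}) := by
  classical
  set J := ((Jsum (binomialEdgeIdeal K (G.induce A)) (binomialEdgeIdeal K (G.induce B))
        ⊔ Ideal.span {X (Sum.inr (Sum.inl ⟨v, hB⟩)) - X (Sum.inl (Sum.inl ⟨v, hA⟩))})
        ⊔ Ideal.span {X (Sum.inl (Sum.inr ⟨v, hA⟩)) - X (Sum.inr (Sum.inr ⟨v, hB⟩))}) with hJ
  constructor
  · intro hf
    have hx : Ideal.Quotient.mkₐ K J (X (Sum.inr (Sum.inl ⟨v, hB⟩))) =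
        Ideal.Quotient.mkₐ K J (X (Sum.inl (Sum.inl ⟨v, hA⟩))) :=
      Ideal.Quotient.eq.2 (Ideal.mem_sup_left (Ideal.mem_sup_right (Ideal.mem_span_singleton_self _)))
    have hy : Ideal.Quotient.mkₐ K J (X (Sum.inl (Sum.inr ⟨v, hA⟩))) =
        Ideal.Quotient.mkₐ K J (X (Sum.inr (Sum.inr ⟨v, hB⟩))) :=
      Ideal.Quotient.eq.2 (Ideal.mem_sup_right (Ideal.mem_span_singleton_self _))
    have hv : ∀ i, i ∈ A → i ∈ B → i = v := by
      intro i h1 h2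
      have : i ∈ A ∩ B := ⟨h1, h2⟩
      rwa [hinter] at this
    have hcov : ∀ i, i ∉ A → i ∈ B := by
      intro i hi
      have : i ∈ A ∪ B := by rw [hcover]; trivial
      exact this.resolve_left hi
    let s : MvPolynomial (V ⊕ V) K →ₐ[K] (MvPolynomial ((A ⊕ A) ⊕ (B ⊕ B)) K ⧸ J) :=
      aeval (Sum.elim
        (fun i => if h : i ∈ A then Ideal.Quotient.mkₐ K J (X (Sum.inl (Sum.inl ⟨i, h⟩)))
          else Ideal.Quotient.mkₐ K J (X (Sum.inr (Sum.inl ⟨i, hcov i h⟩))))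
        (fun i => if h : i ∈ A then Ideal.Quotient.mkₐ K J (X (Sum.inl (Sum.inr ⟨i, h⟩)))
          else Ideal.Quotient.mkₐ K J (X (Sum.inr (Sum.inr ⟨i, hcov i h⟩)))))
    have sxA : ∀ i (h : i ∈ A), s (X (Sum.inl i)) =
        Ideal.Quotient.mkₐ K J (X (Sum.inl (Sum.inl ⟨i, h⟩))) := by
      intro i h
      simp only [s, aeval_X, Sum.elim_inl, dif_pos h]
    have syA : ∀ i (h : i ∈ A), s (X (Sum.inr i)) =
        Ideal.Quotient.mkₐ K J (X (Sum.inl (Sum.inr ⟨i, h⟩))) := by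
      intro i h
      simp only [s, aeval_X, Sum.elim_inr, dif_pos h]
    have sxB : ∀ i (h : i ∈ B), s (X (Sum.inl i)) =
        Ideal.Quotient.mkₐ K J (X (Sum.inr (Sum.inl ⟨i, h⟩))) := by
      intro i h
      by_cases h' : i ∈ A
      · obtain rfl := hv i h' h
        rw [sxA i h', hx]
      · simp only [s, aeval_X, Sum.elim_inl, dif_neg h']
    have syB : ∀ i (h : i ∈ B), s (X (Sum.inr i)) =
        Ideal.Quotient.mkₐ K J (X (Sum.inr (Sum.inr ⟨i, h⟩))) := by
      intro i h
      by_cases h' : i ∈ A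
      · obtain rfl := hv i h' h
        rw [syA i h', hy]
      · simp only [s, aeval_X, Sum.elim_inr, dif_neg h']
    have hker : binomialEdgeIdeal K G ≤ RingHom.ker s := by
      rw [binomialEdgeIdeal, Ideal.span_le]
      rintro _ ⟨i, j, hij, rfl⟩
      change s _ = 0
      rw [map_sub, map_mul, map_mul]
      rcases hedges i j hij with ⟨hi, hj⟩ | ⟨hi, hj⟩
      · rw [sxA i hi, sxA j hj, syA i hi, syA j hj, ← map_mul, ← map_mul, ← map_sub, mkA_zero_iff]
        have h1 := Ideal.mem_map_of_mem (rename (R := K)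
          (Sum.inl : (A ⊕ A) → (A ⊕ A) ⊕ (B ⊕ B))).toRingHom
          (edge_mem K (G := G.induce A) (i := ⟨i, hi⟩) (j := ⟨j, hj⟩) hij)
        simp at h1
        exact Ideal.mem_sup_left (Ideal.mem_sup_left (Ideal.mem_sup_left h1))
      · rw [sxB i hi, sxB j hj, syB i hi, syB j hj, ← map_mul, ← map_mul, ← map_sub, mkA_zero_iff]
        have h1 := Ideal.mem_map_of_mem (rename (R := K)
          (Sum.inr : (B ⊕ B) → (A ⊕ A) ⊕ (B ⊕ B))).toRingHom
          (edge_mem K (G := G.induce B) (i := ⟨i, hi⟩) (j := ⟨j, hj⟩) hij)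
        simp at h1
        exact Ideal.mem_sup_left (Ideal.mem_sup_left (Ideal.mem_sup_right h1))
    have hcomp : s.comp (rename (glueMap A B)) = Ideal.Quotient.mkₐ K J := by
      apply algHom_ext
      rintro ((⟨i, hi⟩ | ⟨i, hi⟩) | (⟨i, hi⟩ | ⟨i, hi⟩))
      · rw [AlgHom.comp_apply, rename_X]; exact sxA i hi
      · rw [AlgHom.comp_apply, rename_X]; exact syA i hi
      · rw [AlgHom.comp_apply, rename_X]; exact sxB i hi
      · rw [AlgHom.comp_apply, rename_X]; exact syB i hi
    rw [← mkA_zero_iff, ← hcomp, AlgHom.comp_apply]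
    exact hker hf
  · intro hf
    have : J ≤ (binomialEdgeIdeal K G).comap (rename (R := K) (glueMap A B)).toRingHom := by
      refine sup_le (sup_le (sup_le ?_ ?_) ?_) ?_
      · rw [binomialEdgeIdeal, Ideal.map_span, Ideal.span_le]
        rintro _ ⟨_, ⟨i, j, hij, rfl⟩, rfl⟩
        rw [SetLike.mem_coe, Ideal.mem_comap]
        have := edge_mem K (G := G) (i := i) (j := j) hij
        simpa [glueMap] using this
      · rw [binomialEdgeIdeal, Ideal.map_span, Ideal.span_le]
        rintro _ ⟨_, ⟨i, j, hij, rfl⟩, rfl⟩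
        rw [SetLike.mem_coe, Ideal.mem_comap]
        have := edge_mem K (G := G) (i := i) (j := j) hij
        simpa [glueMap] using this
      · rw [Ideal.span_le]
        rintro _ rfl
        rw [SetLike.mem_coe, Ideal.mem_comap]
        simp [glueMap]
      · rw [Ideal.span_le]
        rintro _ rfl
        rw [SetLike.mem_coe, Ideal.mem_comap]
        simp [glueMap]
    exact this hf

theorem glueMap_surj (A B : Set V) (hcover : A ∪ B = Set.univ) :
    Function.Surjective (glueMap A B) := by
  have hc : ∀ i, i ∈ A ∨ i ∈ B := by
    intro i
    have : i ∈ A ∪ B := by rw [hcover]; trivial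
    exact this
  rintro (i | i)
  · rcases hc i with h | h
    · exact ⟨Sum.inl (Sum.inl ⟨i, h⟩), rfl⟩
    · exact ⟨Sum.inr (Sum.inl ⟨i, h⟩), rfl⟩
  · rcases hc i with h | h
    · exact ⟨Sum.inl (Sum.inr ⟨i, h⟩), rfl⟩
    · exact ⟨Sum.inr (Sum.inr ⟨i, h⟩), rfl⟩

end glue

/-- **Hilbert series of the binomial edge ideal of a decomposable graph.**
Suppose `G = G₁ ∪ G₂` is decomposable: `G₁ = G|_A`, `G₂ = G|_B` are induced
subgraphs covering all edges of `G`, `A ∪ B` is the whole vertex set,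
`A ∩ B = {v}`, and `v` is a free vertex of both `G₁` and `G₂`.  Then
`Hilb_{S/J_G}(t) = (1-t)² · Hilb_{S₁/J_{G₁}}(t) · Hilb_{S₂/J_{G₂}}(t)`. -/
theorem hilbertSeries_binomialEdgeIdeal_decomposable
    (K : Type) [Field K] (n : ℕ) (G : SimpleGraph (Fin n))
    (A B : Set (Fin n)) (v : Fin n)
    (hcover : A ∪ B = Set.univ) (hinter : A ∩ B = {v})
    (hedges : ∀ a b, G.Adj a b → (a ∈ A ∧ b ∈ A) ∨ (a ∈ B ∧ b ∈ B))
    (hfreeA : IsFreeVertex (G.induce A)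
      ⟨v, by
        have h : v ∈ A ∩ B := by rw [hinter]; exact Set.mem_singleton v
        exact h.1⟩)
    (hfreeB : IsFreeVertex (G.induce B)
      ⟨v, by
        have h : v ∈ A ∩ B := by rw [hinter]; exact Set.mem_singleton v
        exact h.2⟩) :
    quotientHilbertSeries (binomialEdgeIdeal K G) =
      (1 - PowerSeries.X) ^ 2 *
        quotientHilbertSeries (binomialEdgeIdeal K (G.induce A)) *
        quotientHilbertSeries (binomialEdgeIdeal K (G.induce B)) := by
  have h : v ∈ A ∩ B := by rw [hinter]; exact Set.mem_singleton v
  rw [hilb_rename (glueMap A B) (glueMap_surj A B hcover) _ _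
    (glue_iff G A B v h.1 h.2 hcover hinter hedges)]
  exact hilb_glue (G.induce A) (G.induce B) _ _ (simpV_of_free hfreeA) (simpV_of_free hfreeB)

end
end

section
/- Let K be a field and G a connected finite simple graph on [n]. Fix a term order < on S and suppose that the initial ideal in_<(J_G) is normally torsion-free, i.e., Ass(S/in_<(J_G)^k) ⊆ Ass(S/in_<(J_G)) for all k ≥ 1. Then the symbolic and ordinary powers of the binomial edge ideal coincide: J_G^{(k)} = J_G^k for all k ≥ 1. -/
open MvPolynomial

noncomputable section

/-- The initial ideal `in_<(I)` of an ideal `I ⊆ MvPolynomial σ K` with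
respect to a monomial (term) order: the ideal generated by the leading terms
of the nonzero elements of `I`. -/
def initialIdeal {σ K : Type} [Field K] (m : MonomialOrder σ)
    (I : Ideal (MvPolynomial σ K)) : Ideal (MvPolynomial σ K) :=
  Ideal.span {g | ∃ f ∈ I, f ≠ 0 ∧ ∃ a ∈ f.support,
    (∀ b ∈ f.support, m.toSyn b ≤ m.toSyn a) ∧
    g = monomial a (MvPolynomial.coeff a f)}

/-- The `k`-th symbolic power of an ideal `I` in a commutative ring:
`I^{(k)} = ⋂_{p ∈ Min(I)} (I^k R_p ∩ R)`, where the contraction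
`I^k R_p ∩ R = { x | ∃ s ∉ p, s·x ∈ I^k }` is expressed as the (directed)
supremum of the colon ideals `(I^k : s)` over `s ∉ p`. -/
def symbolicPower {R : Type} [CommRing R] (I : Ideal R) (k : ℕ) : Ideal R :=
  ⨅ p ∈ I.minimalPrimes,
    sSup {J : Ideal R | ∃ s ∉ p, J = Submodule.colon (I ^ k) (Ideal.span {s})}

namespace BEI

section taylor
variable {σ K : Type} [Field K]

/-- Taylor expansion. -/
def taylor (σ K : Type) [Field K] :
    MvPolynomial σ K →ₐ[K] MvPolynomial σ (MvPolynomial σ K) :=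
  aeval (fun z => C (X z) + X z)

theorem coeff_taylor_monomial [Fintype σ] (a b : σ →₀ ℕ) (c : K) :
    coeff a (taylor σ K (monomial b c)) =
      if a ≤ b then monomial (b - a) (c * ∏ z, ((b z).choose (a z) : K)) else 0 := by
  classical
  have h1 : taylor σ K (monomial b c) =
      C (C c) * ∏ z, (C (X z) + X z : MvPolynomial σ (MvPolynomial σ K)) ^ (b z) := by
    rw [taylor, aeval_monomial, Finsupp.prod_fintype _ _ (by simp)]
    rfl
  have h2 : (∏ z, (C (X z) + X z : MvPolynomial σ (MvPolynomial σ K)) ^ (b z)) =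
      ∑ j ∈ Fintype.piFinset (fun z => Finset.range (b z + 1)),
        monomial (Finsupp.equivFunOnFinite.symm j)
          (monomial (b - Finsupp.equivFunOnFinite.symm j) (∏ z, ((b z).choose (j z) : K))) := by
    have : ∀ z, (C (X z) + X z : MvPolynomial σ (MvPolynomial σ K)) ^ (b z) =
      ∑ j ∈ Finset.range (b z + 1),
        (X z) ^ j * C ((X z) ^ (b z - j) * C ((b z).choose j : K)) := by
      intro z
      rw [add_comm, add_pow]
      refine Finset.sum_congr rfl fun j hj => ?_
      simp [mul_assoc]
    simp_rw [this]
    rw [Finset.prod_univ_sum]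
    refine Finset.sum_congr rfl fun j hj => ?_
    rw [Finset.prod_mul_distrib, ← map_prod C, Finset.prod_mul_distrib, ← map_prod C]
    have e1 : (∏ z, X z ^ (j z) : MvPolynomial σ (MvPolynomial σ K)) =
        monomial (Finsupp.equivFunOnFinite.symm j) 1 := by
      rw [monomial_eq, Finsupp.prod_fintype _ _ (by simp)]; simp
    have e2 : (∏ z, X z ^ (b z - j z) : MvPolynomial σ K) =
        monomial (b - Finsupp.equivFunOnFinite.symm j) 1 := by
      rw [monomial_eq, Finsupp.prod_fintype _ _ (by simp)]; simp
    rw [e1, e2, mul_comm, C_mul_monomial, mul_comm (monomial _ _), C_mul_monomial]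
    simp
  rw [h1, h2, coeff_C_mul, coeff_sum]
  simp_rw [coeff_monomial]
  split_ifs with hab
  · rw [Finset.sum_eq_single (fun z => a z)]
    · have : Finsupp.equivFunOnFinite.symm (fun z => a z) = a := by ext; simp
      rw [if_pos this, this, C_mul_monomial]
    · intro j _ hj
      rw [if_neg]
      rintro rfl
      exact hj (by ext; simp)
    · intro h
      exfalso; apply h
      simp only [Fintype.mem_piFinset, Finset.mem_range]
      intro z
      exact Nat.lt_succ_of_le (hab z)
  · rw [Finset.sum_eq_zero, mul_zero]
    intro j hj
    rw [if_neg]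
    rintro rfl
    apply hab
    intro z
    simp only [Fintype.mem_piFinset, Finset.mem_range] at hj
    have := hj z
    simp; omega

/-- Polynomials whose coefficients in degree `< k` are in `p`. -/
def ordIdeal {R : Type} [CommRing R] (p : Ideal R) (k : ℕ) : Ideal (MvPolynomial σ R) where
  carrier := {F | ∀ a : σ →₀ ℕ, a.degree < k → coeff a F ∈ p}
  add_mem' := fun hF hG a ha => by
    rw [coeff_add]; exact p.add_mem (hF a ha) (hG a ha)
  zero_mem' := fun a _ => by simp
  smul_mem' := fun c F hF a ha => by
    classical
    rw [smul_eq_mul, coeff_mul]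
    refine p.sum_mem fun x hx => p.mul_mem_left _ (hF _ ?_)
    rw [Finset.HasAntidiagonal.mem_antidiagonal] at hx
    have := congrArg Finsupp.degree hx
    rw [map_add] at this
    omega

theorem mem_ordIdeal {R : Type} [CommRing R] {p : Ideal R} {k : ℕ} {F : MvPolynomial σ R} :
    F ∈ ordIdeal p k ↔ ∀ a : σ →₀ ℕ, a.degree < k → coeff a F ∈ p := Iff.rfl

theorem ordIdeal_one_pow {R : Type} [CommRing R] (p : Ideal R) (k : ℕ) :
    (ordIdeal p 1 : Ideal (MvPolynomial σ R)) ^ k ≤ ordIdeal p k := by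
  classical
  induction k with
  | zero => intro F _ a ha; omega
  | succ k ih =>
    rw [pow_succ]
    refine (Ideal.mul_mono_left ih).trans (Ideal.mul_le.2 fun F hF H hH a ha => ?_)
    rw [coeff_mul]
    refine p.sum_mem fun x hx => ?_
    rw [Finset.HasAntidiagonal.mem_antidiagonal] at hx
    have := congrArg Finsupp.degree hx
    rw [map_add] at this
    by_cases h : x.1.degree < k
    · exact p.mul_mem_right _ (hF _ h)
    · exact p.mul_mem_left _ (hH _ (by omega))

theorem ordIdeal_of_mul {R : Type} [CommRing R] (p : Ideal R) [hp : p.IsPrime] (k : ℕ)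
    (F H : MvPolynomial σ R) (hF : coeff 0 F ∉ p) (h : F * H ∈ ordIdeal p k) :
    H ∈ ordIdeal p k := by
  classical
  suffices ∀ d, ∀ a : σ →₀ ℕ, a.degree = d → d < k → coeff a H ∈ p from
    fun a ha => this _ a rfl ha
  intro d
  induction d using Nat.strong_induction_on with
  | _ d ih =>
    intro a had hd
    have h1 := h a (by omega)
    rw [coeff_mul, ← Finset.add_sum_erase _ _ (a := ((0 : σ →₀ ℕ), a)) (by simp)] at h1
    have h2 : ∑ x ∈ (Finset.HasAntidiagonal.antidiagonal a).erase (0, a), coeff x.1 F * coeff x.2 H ∈ p := by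
      refine p.sum_mem fun x hx => p.mul_mem_left _ ?_
      rw [Finset.mem_erase, Finset.HasAntidiagonal.mem_antidiagonal] at hx
      have h3 := congrArg Finsupp.degree hx.2
      rw [map_add] at h3
      have h4 : x.1.degree ≠ 0 := by
        intro h0
        rw [Finsupp.degree_eq_zero_iff] at h0
        apply hx.1
        have := hx.2
        rw [h0, zero_add] at this
        exact Prod.ext h0 this
      exact ih _ (by omega) _ rfl (by omega)
    have h3 := (p.add_mem_iff_left h2).1 h1
    exact (hp.mem_or_mem h3).resolve_left hF

theorem coeff_zero_taylor [Fintype σ] (f : MvPolynomial σ K) : coeff 0 (taylor σ K f) = f := by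
  induction f using MvPolynomial.induction_on' with
  | monomial b c => rw [coeff_taylor_monomial]; simp
  | add p q hp hq => rw [map_add, coeff_add, hp, hq]

theorem symbolicPower_le_comap [Fintype σ] (J p : Ideal (MvPolynomial σ K)) (k : ℕ)
    (hp : p ∈ J.minimalPrimes) :
    symbolicPower J k ≤ (ordIdeal p k).comap (taylor σ K) := by
  have : p.IsPrime := hp.1.1
  refine (iInf₂_le p hp).trans (sSup_le ?_)
  rintro _ ⟨s, hs, rfl⟩ x hx
  rw [Ideal.mem_colon_span_singleton] at hx
  rw [Ideal.mem_comap]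
  apply ordIdeal_of_mul p k (taylor σ K s) _ (by rwa [coeff_zero_taylor])
  rw [← map_mul, mul_comm]
  apply ordIdeal_one_pow
  have h1 : J.map (taylor σ K) ≤ ordIdeal p 1 := by
    rw [Ideal.map_le_iff_le_comap]
    intro g hg a ha
    have : a = 0 := by rw [← Finsupp.degree_eq_zero_iff]; omega
    rw [this, coeff_zero_taylor]
    exact hp.1.2 hg
  apply Ideal.pow_right_mono h1
  rw [← Ideal.map_pow]
  exact Ideal.mem_map_of_mem _ hx

theorem coeff_taylor_mem_radical [Fintype σ] (J : Ideal (MvPolynomial σ K)) (k : ℕ)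
    (f : MvPolynomial σ K) (hf : f ∈ symbolicPower J k) (a : σ →₀ ℕ) (ha : a.degree < k) :
    coeff a (taylor σ K f) ∈ J.radical := by
  rw [← Ideal.sInf_minimalPrimes, Ideal.mem_sInf]
  intro p hp
  exact symbolicPower_le_comap J p k hp hf a ha

theorem pow_le_symbolicPower {R : Type} [CommRing R] (J : Ideal R) (k : ℕ) :
    J ^ k ≤ symbolicPower J k := by
  refine le_iInf₂ fun p hp => ?_
  have : p.IsPrime := hp.1.1
  refine le_sSup_of_le ⟨1, fun h => this.ne_top ((Ideal.eq_top_iff_one _).2 h), rfl⟩ ?_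
  exact Ideal.le_colon

theorem coeff_taylor [Fintype σ] (a c : σ →₀ ℕ) (f : MvPolynomial σ K) :
    coeff c (coeff a (taylor σ K f)) =
      coeff (c + a) f * ∏ z, (((c + a) z).choose (a z) : K) := by
  classical
  induction f using MvPolynomial.induction_on' with
  | monomial b r =>
    rw [coeff_taylor_monomial]
    split_ifs with h
    · rw [coeff_monomial, coeff_monomial]
      by_cases h2 : b = c + a
      · subst h2; simp
      · rw [if_neg h2, if_neg, zero_mul]
        rintro rfl
        exact h2 (by rw [tsub_add_cancel_of_le h])
    · rw [coeff_monomial, if_neg, zero_mul]; simp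
      rintro rfl
      exact h (by simp)
  | add p q hp hq => rw [map_add, coeff_add, coeff_add, hp, hq, coeff_add, add_mul]

/-- leading exponent of Hasse derivative -/
theorem degree_coeff_taylor [Fintype σ] (m : MonomialOrder σ) (f : MvPolynomial σ K)
    (a c : σ →₀ ℕ) (hf : f ≠ 0)
    (hc : c + a = m.degree f) (hdisj : ∀ z, a z = 0 ∨ c z = 0) :
    coeff a (taylor σ K f) ≠ 0 ∧ m.degree (coeff a (taylor σ K f)) = c := by
  have h1 : coeff c (coeff a (taylor σ K f)) ≠ 0 := by
    rw [coeff_taylor, hc]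
    refine mul_ne_zero (m.coeff_degree_ne_zero_iff.2 hf) ?_
    rw [← hc, Finset.prod_ne_zero_iff]
    intro z _
    rcases hdisj z with h | h <;> simp [h]
  have h0 : coeff a (taylor σ K f) ≠ 0 := fun h => h1 (by rw [h, coeff_zero])
  refine ⟨h0, m.toSyn.injective (le_antisymm ?_ (m.le_degree (mem_support_iff.2 h1)))⟩
  rw [m.degree_le_iff]
  intro b hb
  rw [mem_support_iff, coeff_taylor] at hb
  have := m.le_degree (mem_support_iff.2 (left_ne_zero_of_mul hb))
  rw [← hc, map_add, map_add] at this
  exact le_of_add_le_add_right this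

end taylor

section graph
variable {V K : Type} [Field K]

/-- support vertices of an exponent -/
def sv (u : V ⊕ V →₀ ℕ) : Set V := {v | u (Sum.inl v) ≠ 0 ∨ u (Sum.inr v) ≠ 0}

/-- the graph with edges inside the support -/
def sg (G : SimpleGraph V) (W : Set V) : SimpleGraph V where
  Adj i j := G.Adj i j ∧ i ∈ W ∧ j ∈ W
  symm := ⟨fun _ _ h => ⟨h.1.symm, h.2.2, h.2.1⟩⟩
  loopless := ⟨fun _ h => h.1.ne rfl⟩

/-- the vertex order -/
def vlt (m : MonomialOrder (V ⊕ V)) (i j : V) : Prop :=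
  m.toSyn (Finsupp.single (Sum.inl j) 1 + Finsupp.single (Sum.inr i) 1) <
    m.toSyn (Finsupp.single (Sum.inl i) 1 + Finsupp.single (Sum.inr j) 1)

/-- the exponents in the initial ideal -/
def T (G : SimpleGraph V) (m : MonomialOrder (V ⊕ V)) (u : V ⊕ V →₀ ℕ) : Prop :=
  ∃ i j, vlt m i j ∧ u (Sum.inl i) ≠ 0 ∧ u (Sum.inr j) ≠ 0 ∧ (sg G (sv u)).Reachable i j

theorem T_mono {G : SimpleGraph V} {m : MonomialOrder (V ⊕ V)} {u u' : V ⊕ V →₀ ℕ}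
    (h : ∀ z, u z ≠ 0 → u' z ≠ 0) (hT : T G m u) : T G m u' := by
  obtain ⟨i, j, h1, h2, h3, h4⟩ := hT
  refine ⟨i, j, h1, h _ h2, h _ h3, h4.mono ?_⟩
  intro a b hab
  have : sv u ⊆ sv u' := fun v hv => hv.imp (h _) (h _)
  exact ⟨hab.1, this hab.2.1, this hab.2.2⟩

theorem vlt_ne {m : MonomialOrder (V ⊕ V)} {i j : V} (h : vlt m i j) : i ≠ j := by
  rintro rfl
  exact lt_irrefl _ h

theorem vlt_total (m : MonomialOrder (V ⊕ V)) {i j : V} (h : i ≠ j) : vlt m i j ∨ vlt m j i := by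
  classical
  unfold vlt
  refine lt_or_gt_of_ne fun h1 => ?_
  have h2 := DFunLike.congr_fun (m.toSyn.injective h1) (Sum.inl i)
  simp [h, Ne.symm h, Finsupp.single_apply] at h2

/-- the binomials -/
def bin (K : Type) [Field K] {V : Type} (i j : V) : MvPolynomial (V ⊕ V) K :=
  X (Sum.inl i) * X (Sum.inr j) - X (Sum.inl j) * X (Sum.inr i)

theorem bin_mem {G : SimpleGraph V} {i j : V} (h : G.Adj i j) :
    bin K i j ∈ binomialEdgeIdeal K G :=
  Ideal.subset_span ⟨i, j, h, rfl⟩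

theorem walk_support {G : SimpleGraph V} {W : Set V} {i j : V} (p : (sg G W).Walk i j)
    (hi : i ∈ W) : ∀ v ∈ p.support, v ∈ W := by
  induction p with
  | nil => intro v hv; simp at hv; exact hv ▸ hi
  | cons h p ih =>
    intro v hv
    rw [SimpleGraph.Walk.support_cons, List.mem_cons] at hv
    rcases hv with rfl | hv
    · exact hi
    · exact ih h.2.2 v hv

theorem path_mem [DecidableEq V] {G : SimpleGraph V} {W : Set V} (z : V → V ⊕ V)
    (hz : ∀ v, z v = Sum.inl v ∨ z v = Sum.inr v) {i j : V} (p : (sg G W).Walk i j)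
    (hp : p.IsPath) (F : Finset V) (hF : ∀ v ∈ p.support, v ∈ F) :
    (∏ v ∈ (F.erase i).erase j, X (z v)) * bin K i j ∈ binomialEdgeIdeal K G := by
  induction p generalizing F with
  | nil => simp [bin]
  | @cons i v j h p ih =>
    rw [SimpleGraph.Walk.cons_isPath_iff] at hp
    by_cases hvj : v = j
    · subst hvj
      exact Ideal.mul_mem_left _ _ (bin_mem h.1)
    · have hiv : i ≠ v := h.1.ne
      have h1 := ih hp.1 (F.erase i) (by
        intro w hw
        rw [Finset.mem_erase]
        refine ⟨?_, hF w (by simp [hw])⟩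
        rintro rfl
        exact hp.2 hw)
      have hv : v ∈ (F.erase i).erase j := by
        simp only [Finset.mem_erase]
        exact ⟨hvj, hiv.symm, hF v (by simp)⟩
      rw [← Finset.mul_prod_erase _ _ hv, Finset.erase_right_comm]
      set Q : MvPolynomial (V ⊕ V) K := ∏ x ∈ ((F.erase i).erase v).erase j, X (z x) with hQ
      have h2 : bin K i v ∈ binomialEdgeIdeal K G := bin_mem h.1
      rcases hz v with e | e <;> rw [e]
      · have : X (Sum.inl v) * Q * bin K i j =
          X (Sum.inl i) * (Q * bin K v j) + Q * X (Sum.inl j) * bin K i v := by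
          unfold bin; ring
        rw [this]
        exact Ideal.add_mem _ (Ideal.mul_mem_left _ _ h1) (Ideal.mul_mem_left _ _ h2)
      · have : X (Sum.inr v) * Q * bin K i j =
          X (Sum.inr i) * (Q * bin K v j) + Q * X (Sum.inr j) * bin K i v := by
          unfold bin; ring
        rw [this]
        exact Ideal.add_mem _ (Ideal.mul_mem_left _ _ h1) (Ideal.mul_mem_left _ _ h2)

theorem bin_degree {m : MonomialOrder (V ⊕ V)} {i j : V} (h : vlt m i j) :
    bin K i j ≠ 0 ∧
      m.degree (bin K i j) = Finsupp.single (Sum.inl i) 1 + Finsupp.single (Sum.inr j) 1 := by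
  classical
  have e : ∀ a b : V ⊕ V, (X a * X b : MvPolynomial (V ⊕ V) K) =
      monomial (Finsupp.single a 1 + Finsupp.single b 1) 1 := by
    intro a b; simp [X, monomial_mul]
  have hd : m.degree (bin K i j) = Finsupp.single (Sum.inl i) 1 + Finsupp.single (Sum.inr j) 1 := by
    unfold bin
    rw [m.degree_sub_of_lt, e, m.degree_monomial, if_neg one_ne_zero]
    rw [e, e, m.degree_monomial, m.degree_monomial, if_neg one_ne_zero, if_neg one_ne_zero]
    exact h
  refine ⟨m.ne_zero_of_degree_ne_zero ?_, hd⟩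
  rw [hd]
  intro h0
  have := DFunLike.congr_fun h0 (Sum.inl i)
  simp at this

theorem T_lead [Fintype V] {G : SimpleGraph V} {m : MonomialOrder (V ⊕ V)} {u : V ⊕ V →₀ ℕ}
    (hT : T G m u) : ∃ g ∈ binomialEdgeIdeal K G, g ≠ 0 ∧ m.degree g = u := by
  classical
  obtain ⟨i, j, hij, hi, hj, hr⟩ := hT
  obtain ⟨p, hp⟩ := hr.exists_isPath
  let z : V → V ⊕ V := fun v => if u (Sum.inl v) ≠ 0 then Sum.inl v else Sum.inr v
  have hz : ∀ v, z v = Sum.inl v ∨ z v = Sum.inr v := by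
    intro v; simp only [z]; split_ifs <;> simp
  have hzi : Function.Injective z := by
    intro a b hab
    rcases hz a with h | h <;> rcases hz b with h' | h' <;> rw [h, h'] at hab <;> simpa using hab
  let F : Finset V := Finset.univ.filter (· ∈ sv u)
  have hmem := path_mem (K := K) z hz p hp F (by
    intro v hv
    simp only [F, Finset.mem_filter, Finset.mem_univ, true_and]
    exact walk_support p (Or.inl hi) v hv)
  have hne := vlt_ne hij
  let e : V ⊕ V →₀ ℕ := ∑ v ∈ (F.erase i).erase j, Finsupp.single (z v) 1
  have he : (∏ v ∈ (F.erase i).erase j, X (z v) : MvPolynomial (V ⊕ V) K) = monomial e 1 := by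
    simp only [e, monomial_sum_one]; rfl
  have hle : e + (Finsupp.single (Sum.inl i) 1 + Finsupp.single (Sum.inr j) 1) ≤ u := by
    intro w
    have hew : e w = if ∃ v ∈ (F.erase i).erase j, z v = w then 1 else 0 := by
      simp only [e, Finsupp.finset_sum_apply, Finsupp.single_apply]
      split_ifs with hx
      · obtain ⟨v, hv, rfl⟩ := hx
        rw [Finset.sum_eq_single v]
        · simp
        · intro b _ hb; rw [if_neg (fun h => hb (hzi h))]
        · intro h; exact absurd hv h
      · refine Finset.sum_eq_zero fun v hv => ?_
        rw [if_neg]; intro h; exact hx ⟨v, hv, h⟩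
    simp only [Finsupp.add_apply, hew, Finsupp.single_apply]
    have key : ∀ v ∈ (F.erase i).erase j, z v = w → u w ≠ 0 ∧ w ≠ Sum.inl i ∧ w ≠ Sum.inr j := by
      rintro v hv rfl
      simp only [F, Finset.mem_erase, Finset.mem_filter, Finset.mem_univ, true_and] at hv
      obtain ⟨h1, h2, h3⟩ := hv
      refine ⟨?_, ?_, ?_⟩
      · simp only [z]; split_ifs with h
        · exact h
        · exact h3.resolve_left h
      · rcases hz v with h | h <;> rw [h] <;> simp [h2]
      · rcases hz v with h | h <;> rw [h] <;> simp [h1]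
    by_cases hx : ∃ v ∈ (F.erase i).erase j, z v = w
    · obtain ⟨v, hv, hvw⟩ := hx
      obtain ⟨k1, k2, k3⟩ := key v hv hvw
      rw [if_pos ⟨v, hv, hvw⟩, if_neg (Ne.symm k2), if_neg (Ne.symm k3)]
      omega
    · rw [if_neg hx]
      by_cases hw : Sum.inl i = w
      · subst hw; simp; omega
      · rw [if_neg hw]
        split_ifs with hw2
        · subst hw2; omega
        · omega
  have hb := bin_degree (K := K) hij
  obtain ⟨c, hc⟩ := exists_add_of_le hle
  refine ⟨monomial c 1 * (monomial e 1 * bin K i j), Ideal.mul_mem_left _ _ (he ▸ hmem), ?_, ?_⟩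
  · simp [hb.1]
  · rw [m.degree_mul (by simp) (by simp [hb.1]), m.degree_mul (by simp) hb.1, hb.2,
      m.degree_monomial, m.degree_monomial, if_neg one_ne_zero, if_neg one_ne_zero, hc, add_comm]

end graph

section fiber
variable {V K Q : Type} [Field K] [Fintype V]

/-- exponents of the images of the variables -/
def Ex (cc : V → Q) : V ⊕ V → (V ⊕ Q →₀ ℕ)
  | Sum.inl v => Finsupp.single (Sum.inl v) 1 + Finsupp.single (Sum.inr (cc v)) 1
  | Sum.inr v => Finsupp.single (Sum.inl v) 1

/-- exponent map -/
def Ph (cc : V → Q) (b : V ⊕ V →₀ ℕ) : V ⊕ Q →₀ ℕ := ∑ z, b z • Ex cc z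

theorem Ph_add (cc : V → Q) (a b : V ⊕ V →₀ ℕ) : Ph cc (a + b) = Ph cc a + Ph cc b := by
  simp [Ph, add_smul, Finset.sum_add_distrib]

theorem Ph_single (cc : V → Q) (z : V ⊕ V) : Ph cc (Finsupp.single z 1) = Ex cc z := by
  classical
  unfold Ph
  rw [Finset.sum_eq_single z]
  · simp
  · intro b _ hb; simp [Finsupp.single_apply, hb.symm]
  · simp

theorem Ph_inl (cc : V → Q) (b : V ⊕ V →₀ ℕ) (v : V) :
    Ph cc b (Sum.inl v) = b (Sum.inl v) + b (Sum.inr v) := by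
  classical
  simp [Ph, Ex, Finsupp.finsetSum_apply, Finsupp.single_apply]

theorem Ph_inr [DecidableEq Q] (cc : V → Q) (b : V ⊕ V →₀ ℕ) (c : Q) :
    Ph cc b (Sum.inr c) = ∑ v with cc v = c, b (Sum.inl v) := by
  classical
  simp [Ph, Ex, Finsupp.finsetSum_apply, Finsupp.single_apply, Finset.sum_filter]

theorem comb (m : MonomialOrder (V ⊕ V)) (cc : V → Q) (u : V ⊕ V →₀ ℕ)
    (hu : ∀ i j, vlt m i j → u (Sum.inl i) ≠ 0 → u (Sum.inr j) ≠ 0 → cc i ≠ cc j) :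
    ∀ b : V ⊕ V →₀ ℕ, Ph cc b = Ph cc u → b ≠ u → m.toSyn u < m.toSyn b := by
  classical
  intro b
  induction hs : m.toSyn b using WellFoundedLT.induction generalizing b with
  | _ s ih =>
  subst hs
  intro hP hne
  have hsum : ∀ v, b (Sum.inl v) + b (Sum.inr v) = u (Sum.inl v) + u (Sum.inr v) := by
    intro v; rw [← Ph_inl cc, ← Ph_inl cc, hP]
  have hcc : ∀ c, ∑ v with cc v = c, b (Sum.inl v) = ∑ v with cc v = c, u (Sum.inl v) := by
    intro c; rw [← Ph_inr cc, ← Ph_inr cc, hP]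
  have h1 : ∃ v, b (Sum.inl v) ≠ u (Sum.inl v) := by
    by_contra! h
    apply hne
    ext z
    rcases z with v | v
    · exact h v
    · have := hsum v; have := h v; omega
  obtain ⟨v, hv⟩ := h1
  have hi : ∃ i, cc i = cc v ∧ u (Sum.inl i) < b (Sum.inl i) := by
    by_contra! h
    refine absurd (hcc (cc v)) (ne_of_lt (Finset.sum_lt_sum (fun i hi => ?_) ⟨v, by simp, ?_⟩))
    · simp at hi; exact h i hi
    · exact lt_of_le_of_ne (h v rfl) hv
  have hj : ∃ j, cc j = cc v ∧ b (Sum.inl j) < u (Sum.inl j) := by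
    by_contra! h
    refine absurd (hcc (cc v)).symm (ne_of_lt (Finset.sum_lt_sum (fun i hi => ?_) ⟨v, by simp, ?_⟩))
    · simp at hi; exact h i hi
    · exact lt_of_le_of_ne (h v rfl) hv.symm
  obtain ⟨i, hci, hi⟩ := hi
  obtain ⟨j, hcj, hj⟩ := hj
  have hij : i ≠ j := by rintro rfl; omega
  have hsi := hsum i
  have hsj := hsum j
  have hlt : vlt m i j := by
    refine (vlt_total m hij).resolve_right fun h => ?_
    exact hu j i h (by omega) (by omega) (hcj.trans hci.symm)
  have hle : Finsupp.single (Sum.inl i) 1 + Finsupp.single (Sum.inr j) 1 ≤ b := by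
    intro w
    simp only [Finsupp.add_apply, Finsupp.single_apply]
    by_cases hw : Sum.inl i = w
    · subst hw; simp; omega
    · rw [if_neg hw]
      split_ifs with hw2
      · subst hw2; omega
      · omega
  obtain ⟨d, hd⟩ := exists_add_of_le hle
  set b' := (Finsupp.single (Sum.inl j) 1 + Finsupp.single (Sum.inr i) 1) + d with hb'
  have hlt' : m.toSyn b' < m.toSyn b := by
    rw [hd, hb', map_add m.toSyn _ d, map_add m.toSyn _ d]
    exact add_lt_add_left hlt _
  have hP' : Ph cc b' = Ph cc u := by
    rw [← hP, hd, hb']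
    simp only [Ph_add, Ph_single, Ex, hci, hcj]
    abel
  by_cases hbu : b' = u
  · rw [← hbu]; exact hlt'
  · exact (ih _ hlt' b' rfl hP' hbu).trans hlt'

open Classical in
/-- test homomorphism -/
def tst (K : Type) [Field K] (W : Set V) (cc : V → Q) :
    MvPolynomial (V ⊕ V) K →ₐ[K] MvPolynomial (V ⊕ Q) K :=
  aeval (fun z => if Sum.elim id id z ∈ W then monomial (Ex cc z) 1 else 0)

theorem tst_monomial (W : Set V) (cc : V → Q) (b : V ⊕ V →₀ ℕ) (r : K)
    (hb : ∀ z, b z ≠ 0 → Sum.elim id id z ∈ W) :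
    tst K W cc (monomial b r) = monomial (Ph cc b) r := by
  classical
  rw [tst, aeval_monomial, Finsupp.prod_fintype _ _ (by simp)]
  have : ∀ z, (if Sum.elim id id z ∈ W then monomial (Ex cc z) 1 else 0 :
      MvPolynomial (V ⊕ Q) K) ^ b z = monomial (b z • Ex cc z) 1 := by
    intro z
    by_cases h : b z = 0
    · simp [h]
    · rw [if_pos (hb z h), monomial_pow, one_pow]
  rw [Finset.prod_congr rfl fun z _ => this z, ← monomial_sum_one, algebraMap_eq, C_mul_monomial,
    mul_one]
  rfl

theorem tst_monomial_zero (W : Set V) (cc : V → Q) (b : V ⊕ V →₀ ℕ) (r : K)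
    (hb : ¬ ∀ z, b z ≠ 0 → Sum.elim id id z ∈ W) :
    tst K W cc (monomial b r) = 0 := by
  classical
  push Not at hb
  obtain ⟨z, hz, hW⟩ := hb
  rw [tst, aeval_monomial, Finsupp.prod_fintype _ _ (by simp),
    Finset.prod_eq_zero (Finset.mem_univ z), mul_zero]
  rw [if_neg hW, zero_pow hz]

theorem tst_bin (G : SimpleGraph V) (W : Set V) (f : MvPolynomial (V ⊕ V) K)
    (hf : f ∈ (binomialEdgeIdeal K G).radical) :
    tst K W (sg G W).connectedComponentMk f = 0 := by
  classical
  set ψ := tst K W (sg G W).connectedComponentMk with hψ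
  have h1 : binomialEdgeIdeal K G ≤ RingHom.ker ψ := by
    rw [binomialEdgeIdeal, Ideal.span_le]
    rintro _ ⟨i, j, hij, rfl⟩
    rw [SetLike.mem_coe, RingHom.mem_ker, map_sub, map_mul, map_mul]
    simp only [hψ, tst, aeval_X, Sum.elim_inl, Sum.elim_inr, id]
    by_cases hi : i ∈ W
    · by_cases hj : j ∈ W
      · have : (sg G W).connectedComponentMk i = (sg G W).connectedComponentMk j :=
          SimpleGraph.ConnectedComponent.sound (SimpleGraph.Adj.reachable ⟨hij, hi, hj⟩)
        simp only [hi, hj, if_true, monomial_mul, Ex, this]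
        rw [sub_eq_zero]; congr 1; abel
      · simp [hj]
    · simp [hi]
  obtain ⟨n, hn⟩ := hf
  have h2 := h1 hn
  rw [RingHom.mem_ker, map_pow] at h2
  exact (pow_eq_zero_iff (by rintro rfl; simp at h2)).1 h2

theorem T_of_radical (G : SimpleGraph V) (m : MonomialOrder (V ⊕ V)) (f : MvPolynomial (V ⊕ V) K)
    (hf : f ∈ (binomialEdgeIdeal K G).radical) (h0 : f ≠ 0) : T G m (m.degree f) := by
  classical
  by_contra hT
  set u := m.degree f with hu
  set W := sv u with hW
  have h1 := tst_bin G W f hf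
  have huW : ∀ z, u z ≠ 0 → Sum.elim id id z ∈ W := by
    rintro (v | v) hz
    · exact Or.inl hz
    · exact Or.inr hz
  have hc := comb m (sg G W).connectedComponentMk u (by
    intro i j hij hi hj hcc
    exact hT ⟨i, j, hij, hi, hj, SimpleGraph.ConnectedComponent.exact hcc⟩)
  set cc := (sg G W).connectedComponentMk
  have h2 : coeff (Ph cc u) (tst K W cc f) = coeff u f := by
    conv_lhs => rw [f.as_sum, map_sum, coeff_sum]
    rw [Finset.sum_eq_single u]
    · rw [tst_monomial _ _ _ _ huW, coeff_monomial, if_pos rfl]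
    · intro b hb hbu
      by_cases hbW : ∀ z, b z ≠ 0 → Sum.elim id id z ∈ W
      · rw [tst_monomial _ _ _ _ hbW, coeff_monomial, if_neg]
        intro hP
        exact absurd (m.le_degree hb) (not_le.2 (hc b hP hbu))
      · rw [tst_monomial_zero _ _ _ _ hbW, coeff_zero]
    · intro h; exact absurd (m.degree_mem_support h0) h
  rw [h1, coeff_zero] at h2
  exact m.coeff_degree_ne_zero_iff.2 h0 h2.symm

end fiber

section final
variable {V K : Type} [Field K] [Fintype V]

theorem mem_initialIdeal (G : SimpleGraph V) (m : MonomialOrder (V ⊕ V))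
    (h : MvPolynomial (V ⊕ V) K) :
    h ∈ initialIdeal m (binomialEdgeIdeal K G) ↔ ∀ u ∈ h.support, T G m u := by
  have e : initialIdeal m (binomialEdgeIdeal K G) =
      Ideal.span ((fun s => monomial s (1 : K)) '' {u | T G m u}) := by
    apply le_antisymm
    · rw [initialIdeal, Ideal.span_le]
      rintro _ ⟨f, hf, hf0, a, ha, hmax, rfl⟩
      have had : a = m.degree f :=
        m.toSyn.injective (le_antisymm (m.le_degree ha) (hmax _ (m.degree_mem_support hf0)))
      have : monomial a (coeff a f) = C (coeff a f) * monomial a (1 : K) := by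
        rw [C_mul_monomial, mul_one]
      rw [this]
      refine Ideal.mul_mem_left _ _ (Ideal.subset_span ⟨a, ?_, rfl⟩)
      rw [had]
      exact T_of_radical G m f (Ideal.le_radical hf) hf0
    · rw [Ideal.span_le]
      rintro _ ⟨u, hu, rfl⟩
      obtain ⟨g, hg, hg0, rfl⟩ := T_lead (K := K) hu
      have hc : coeff (m.degree g) g ≠ 0 := m.coeff_degree_ne_zero_iff.2 hg0
      have : monomial (m.degree g) (1 : K) =
          C (coeff (m.degree g) g)⁻¹ * monomial (m.degree g) (coeff (m.degree g) g) := by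
        rw [C_mul_monomial, inv_mul_cancel₀ hc]
      simp only [this]
      exact Ideal.mul_mem_left _ _ (Ideal.subset_span ⟨g, hg, hg0, _, m.degree_mem_support hg0,
        fun b hb => m.le_degree hb, rfl⟩)
  rw [e, mem_ideal_span_monomial_image]
  refine forall₂_congr fun u _ => ⟨?_, fun hu => ⟨u, hu, le_rfl⟩⟩
  rintro ⟨s, hs, hle⟩
  refine T_mono (fun z hz => ?_) hs
  have := hle z
  omega

theorem initialIdeal_sq (G : SimpleGraph V) (m : MonomialOrder (V ⊕ V))
    (g : MvPolynomial (V ⊕ V) K) (h : g * g ∈ initialIdeal m (binomialEdgeIdeal K G)) :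
    g ∈ initialIdeal m (binomialEdgeIdeal K G) := by
  classical
  rw [mem_initialIdeal] at h ⊢
  by_contra! hne
  obtain ⟨u0, hu0, hT0⟩ := hne
  obtain ⟨u, hu, hmax⟩ := Finset.exists_max_image (g.support.filter fun u => ¬ T G m u) m.toSyn
    ⟨u0, by simpa using ⟨by simpa using hu0, hT0⟩⟩
  rw [Finset.mem_filter] at hu
  have hT2 : ¬ T G m (u + u) := fun h => hu.2 (T_mono (fun z hz => by
    simp at hz; exact hz) h)
  apply hT2
  apply h
  rw [mem_support_iff, coeff_mul, Finset.sum_eq_single (u, u)]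
  · have := mem_support_iff.1 hu.1
    exact mul_ne_zero this this
  · rintro ⟨b, c⟩ hbc hne
    rw [Finset.HasAntidiagonal.mem_antidiagonal] at hbc
    simp only at hbc ⊢
    by_contra hz
    have hb := left_ne_zero_of_mul hz
    have hc := right_ne_zero_of_mul hz
    have hTb : ¬ T G m b := fun h => hT2 (T_mono (fun z hz => by
      rw [← hbc, Finsupp.add_apply]; omega) h)
    have hTc : ¬ T G m c := fun h => hT2 (T_mono (fun z hz => by
      rw [← hbc, Finsupp.add_apply]; omega) h)
    have h1 := hmax b (by rw [Finset.mem_filter, mem_support_iff]; exact ⟨hb, hTb⟩)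
    have h2 := hmax c (by rw [Finset.mem_filter, mem_support_iff]; exact ⟨hc, hTc⟩)
    have h3 := congrArg m.toSyn hbc
    rw [map_add, map_add] at h3
    have h4 : m.toSyn b = m.toSyn u := by
      refine le_antisymm h1 (not_lt.1 fun hlt => ?_)
      exact absurd h3 (ne_of_lt (add_lt_add_of_lt_of_le hlt h2))
    have h5 := m.toSyn.injective h4
    subst h5
    exact hne (by rw [add_left_cancel hbc])
  · intro h; simp at h

theorem initialIdeal_pow (G : SimpleGraph V) (m : MonomialOrder (V ⊕ V)) (k : ℕ)
    (u : V ⊕ V →₀ ℕ)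
    (h : monomial u (1 : K) ∈ initialIdeal m (binomialEdgeIdeal K G) ^ k) :
    ∃ g ∈ binomialEdgeIdeal K G ^ k, g ≠ 0 ∧ m.degree g = u := by
  classical
  let L : ℕ → Set (V ⊕ V →₀ ℕ) :=
    fun k => {u | ∃ g ∈ binomialEdgeIdeal K G ^ k, g ≠ 0 ∧ m.degree g = u}
  have hL : ∀ k, initialIdeal m (binomialEdgeIdeal K G) ^ k ≤
      Ideal.span ((fun s => monomial s (1 : K)) '' L k) := by
    intro k
    induction k with
    | zero =>
      have : (1 : MvPolynomial (V ⊕ V) K) ∈ Ideal.span ((fun s => monomial s (1 : K)) '' L 0) :=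
        Ideal.subset_span ⟨0, ⟨1, by simp, one_ne_zero, by simp⟩, rfl⟩
      rw [(Ideal.eq_top_iff_one _).2 this]
      exact le_top
    | succ k ih =>
      have h1 : initialIdeal m (binomialEdgeIdeal K G) ≤
          Ideal.span ((fun s => monomial s (1 : K)) '' L 1) := by
        intro x hx
        rw [mem_initialIdeal] at hx
        rw [mem_ideal_span_monomial_image]
        intro u hu
        obtain ⟨g, hg, h⟩ := T_lead (K := K) (hx u hu)
        exact ⟨u, ⟨g, by simpa using hg, h⟩, le_rfl⟩
      rw [pow_succ]
      refine (Ideal.mul_mono ih h1).trans ?_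
      rw [Ideal.span_mul_span', Ideal.span_le]
      rintro _ ⟨_, ⟨a, ⟨g, hg, hg0, rfl⟩, rfl⟩, _, ⟨b, ⟨g', hg', hg0', rfl⟩, rfl⟩, rfl⟩
      refine Ideal.subset_span ⟨m.degree g + m.degree g', ⟨g * g', ?_, mul_ne_zero hg0 hg0',
        m.degree_mul hg0 hg0'⟩, by simp [monomial_mul]⟩
      rw [pow_succ]
      exact Ideal.mul_mem_mul hg (by simpa using hg')
  have h1 := hL k h
  rw [mem_ideal_span_monomial_image] at h1
  obtain ⟨s, ⟨g, hg, hg0, rfl⟩, hle⟩ := h1 u (by simp)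
  obtain ⟨d, rfl⟩ := exists_add_of_le hle
  refine ⟨monomial d 1 * g, Ideal.mul_mem_left _ _ hg, by simp [hg0], ?_⟩
  rw [m.degree_mul (by simp) hg0, m.degree_monomial, if_neg one_ne_zero, add_comm]

theorem lead_mem (G : SimpleGraph V) (m : MonomialOrder (V ⊕ V)) (k : ℕ)
    (hntf : associatedPrimes (MvPolynomial (V ⊕ V) K)
          (MvPolynomial (V ⊕ V) K ⧸ (initialIdeal m (binomialEdgeIdeal K G)) ^ k) ⊆
        associatedPrimes (MvPolynomial (V ⊕ V) K)
          (MvPolynomial (V ⊕ V) K ⧸ initialIdeal m (binomialEdgeIdeal K G)))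
    (f : MvPolynomial (V ⊕ V) K) (h0 : f ≠ 0)
    (hf : f ∈ symbolicPower (binomialEdgeIdeal K G) k) :
    monomial (m.degree f) (1 : K) ∈ initialIdeal m (binomialEdgeIdeal K G) ^ k := by
  classical
  set N := initialIdeal m (binomialEdgeIdeal K G) with hN
  set u := m.degree f with hu
  by_contra hmem
  have hx : (Ideal.Quotient.mk (N ^ k) (monomial u 1)) ≠ 0 := by
    rwa [Ne, Ideal.Quotient.eq_zero_iff_mem]
  obtain ⟨P, hP, hle⟩ := exists_le_isAssociatedPrime_of_isNoetherianRing
    (MvPolynomial (V ⊕ V) K) _ hx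
  have hP' := hntf hP
  rw [AssociatedPrimes.mem_iff, isAssociatedPrime_iff] at hP'
  obtain ⟨hprime, y, hy⟩ := hP'
  obtain ⟨g, rfl⟩ := Ideal.Quotient.mk_surjective y
  have hPg : ∀ r, r ∈ P ↔ r * g ∈ N := by
    intro r
    rw [hy, Submodule.mem_colon_singleton, Submodule.mem_bot]
    exact Ideal.Quotient.eq_zero_iff_mem (I := N) (a := r * g)
  have hNP : N ≤ P := fun r hr => (hPg r).2 (N.mul_mem_right _ hr)
  have hgP : g ∉ P := by
    intro h
    have h1 := initialIdeal_sq G m g ((hPg g).1 h)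
    apply hprime.ne_top
    rw [Ideal.eq_top_iff_one, hPg, one_mul]
    exact h1
  -- split the exponent
  set a : V ⊕ V →₀ ℕ := u.filter (fun z => (X z : MvPolynomial (V ⊕ V) K) ∈ P) with ha
  set c : V ⊕ V →₀ ℕ := u.filter (fun z => ¬ (X z : MvPolynomial (V ⊕ V) K) ∈ P) with hc
  have hca : c + a = u := by rw [add_comm]; exact Finsupp.filter_pos_add_filter_neg _ _
  have hdeg : k ≤ a.degree := by
    by_contra! hlt
    have h1 := degree_coeff_taylor m f a c h0 hca (by
      intro z
      by_cases hz : (X z : MvPolynomial (V ⊕ V) K) ∈ P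
      · right; simp [hc, hz]
      · left; simp [ha, hz])
    have h2 := T_of_radical G m _ (coeff_taylor_mem_radical _ k f hf a hlt) h1.1
    rw [h1.2] at h2
    have h3 : monomial c (1 : K) ∈ P := hNP ((mem_initialIdeal G m _).2 (by
      intro b hb
      have : b = c := by simpa using support_monomial_subset hb
      rwa [this]))
    rw [monomial_eq, C_1, one_mul, Finsupp.prod, hprime.prod_mem_iff] at h3
    obtain ⟨z, hz, h4⟩ := h3
    have h5 := hprime.mem_of_pow_mem _ h4
    simp [hc, h5] at hz
  have hak : monomial a (1 : K) ∈ P ^ k := by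
    refine Ideal.pow_le_pow_right hdeg ?_
    rw [monomial_eq, C_1, one_mul, Finsupp.prod, Finsupp.degree_apply,
      ← Finset.prod_pow_eq_pow_sum]
    refine Ideal.prod_mem_prod fun z hz => Ideal.pow_mem_pow ?_ _
    by_contra hz'
    simp [ha, hz'] at hz
  have huk : monomial u (1 : K) ∈ P ^ k := by
    rw [← hca, ← one_mul (1 : K), ← monomial_mul]
    exact Ideal.mul_mem_left _ _ hak
  have hgk : g ^ k * monomial u (1 : K) ∈ N ^ k := by
    have : Ideal.span {g} * P ≤ N := by
      rw [Ideal.mul_le]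
      intro r hr s hs
      obtain ⟨t, rfl⟩ := Ideal.mem_span_singleton'.1 hr
      have : t * g * s = t * (s * g) := by ring
      rw [this]
      exact N.mul_mem_left _ ((hPg s).1 hs)
    apply Ideal.pow_right_mono this k
    rw [mul_pow]
    exact Ideal.mul_mem_mul (Ideal.pow_mem_pow (Ideal.mem_span_singleton_self g) k) huk
  apply hgP
  apply hprime.mem_of_pow_mem k
  apply hle
  rw [Submodule.mem_colon_singleton, Submodule.mem_bot]
  exact Ideal.Quotient.eq_zero_iff_mem.2 hgk

theorem main (G : SimpleGraph V) (m : MonomialOrder (V ⊕ V)) (k : ℕ)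
    (hntf : associatedPrimes (MvPolynomial (V ⊕ V) K)
          (MvPolynomial (V ⊕ V) K ⧸ (initialIdeal m (binomialEdgeIdeal K G)) ^ k) ⊆
        associatedPrimes (MvPolynomial (V ⊕ V) K)
          (MvPolynomial (V ⊕ V) K ⧸ initialIdeal m (binomialEdgeIdeal K G))) :
    symbolicPower (binomialEdgeIdeal K G) k = binomialEdgeIdeal K G ^ k := by
  classical
  refine le_antisymm ?_ (pow_le_symbolicPower _ _)
  intro f
  induction hs : m.toSyn (m.degree f) using WellFoundedLT.induction generalizing f with
  | _ s ih =>
  subst hs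
  intro hf
  by_cases h0 : f = 0
  · rw [h0]; exact Ideal.zero_mem _
  obtain ⟨g, hg, hg0, hd⟩ := initialIdeal_pow G m k _ (lead_mem G m k hntf f h0 hf)
  have hgc : coeff (m.degree f) g ≠ 0 := hd ▸ m.coeff_degree_ne_zero_iff.2 hg0
  set q := C (coeff (m.degree f) f / coeff (m.degree f) g) * g with hq
  have hqm : q ∈ binomialEdgeIdeal K G ^ k := Ideal.mul_mem_left _ _ hg
  suffices f - q ∈ binomialEdgeIdeal K G ^ k by
    have := Ideal.add_mem _ this hqm
    rwa [sub_add_cancel] at this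
  by_cases h1 : f - q = 0
  · rw [h1]; exact Ideal.zero_mem _
  refine ih _ ?_ rfl (Ideal.sub_mem _ hf (pow_le_symbolicPower _ _ hqm))
  have hle : m.toSyn (m.degree (f - q)) ≤ m.toSyn (m.degree f) := by
    rw [m.degree_le_iff]
    intro b hb
    rw [mem_support_iff, coeff_sub, hq, coeff_C_mul] at hb
    by_cases hbf : coeff b f = 0
    · rw [← hd]
      apply m.le_degree
      rw [mem_support_iff]
      intro h; apply hb; rw [hbf, h]; simp
    · exact m.le_degree (mem_support_iff.2 hbf)
  refine lt_of_le_of_ne hle fun he => ?_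
  have he' := m.toSyn.injective he
  have h2 := m.coeff_degree_ne_zero_iff.2 h1
  rw [he', coeff_sub, hq, coeff_C_mul, div_mul_cancel₀ _ hgc, sub_self] at h2
  exact h2 rfl

end final

end BEI

/-- **Symbolic powers of binomial edge ideals.**
Let `G` be a connected graph on `[n]` and `<` a term order on `S`.  If the
initial ideal `in_<(J_G)` is normally torsion-free (i.e.
`Ass(S/in_<(J_G)^k) ⊆ Ass(S/in_<(J_G))` for all `k ≥ 1`), then
`J_G^{(k)} = J_G^k` for all `k ≥ 1`. -/
theorem symbolicPower_binomialEdgeIdeal_eq_pow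
    (K : Type) [Field K] (n : ℕ) (G : SimpleGraph (Fin n))
    (hconn : G.Connected) (m : MonomialOrder (Fin n ⊕ Fin n))
    (hntf : ∀ k : ℕ, 1 ≤ k →
      associatedPrimes (MvPolynomial (Fin n ⊕ Fin n) K)
          (MvPolynomial (Fin n ⊕ Fin n) K ⧸
            (initialIdeal m (binomialEdgeIdeal K G)) ^ k) ⊆
        associatedPrimes (MvPolynomial (Fin n ⊕ Fin n) K)
          (MvPolynomial (Fin n ⊕ Fin n) K ⧸
            initialIdeal m (binomialEdgeIdeal K G))) :
    ∀ k : ℕ, 1 ≤ k →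
      symbolicPower (binomialEdgeIdeal K G) k = (binomialEdgeIdeal K G) ^ k := by
  intro k hk
  exact BEI.main G m k (hntf k hk)

end
end

section
/- Let K be a field with char(K) ≠ 2 and G a finite simple graph on [n]. Then the parity binomial edge ideal 𝓘_G = (x_i x_j − y_i y_j : {i,j} ∈ E(G)) ⊆ S = K[x_1,…,x_n,y_1,…,y_n] is a radical ideal. -/
open MvPolynomial

noncomputable section

/-- The parity binomial edge ideal of a simple graph `G` on vertex set `V`:
`𝓘_G = (x_i x_j - y_i y_j : {i,j} ∈ E(G))` inside
`K[x_v, y_v : v ∈ V] = MvPolynomial (V ⊕ V) K`. -/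
def parityBinomialEdgeIdeal (K : Type) [Field K] {V : Type} (G : SimpleGraph V) :
    Ideal (MvPolynomial (V ⊕ V) K) :=
  Ideal.span {f | ∃ i j, G.Adj i j ∧
    f = X (Sum.inl i) * X (Sum.inl j) - X (Sum.inr i) * X (Sum.inr j)}

open Finsupp

theorem odd_path {V : Type} (H : SimpleGraph V) 
    (hbad : ∀ i j (_ : H.Adj i j) (p : H.Walk j i), p.IsPath → ¬ Even p.length) {i j : V}
    (p : H.Walk i j) : ∃ q : H.Walk i j, q.IsPath ∧ (Even q.length ↔ Even p.length) := by
  classical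
  induction p with
  | nil => exact ⟨.nil, by simp, by simp⟩
  | @cons i h j a p ih =>
    obtain ⟨q, hq, hpar⟩ := ih
    by_cases hi : i ∈ q.support
    · refine ⟨q.dropUntil i hi, hq.dropUntil hi, ?_⟩
      have h1 := hbad i h a (q.takeUntil i hi) (hq.takeUntil hi)
      have h2 := congrArg SimpleGraph.Walk.length (q.take_spec hi)
      rw [SimpleGraph.Walk.length_append] at h2
      rw [SimpleGraph.Walk.length_cons, Nat.even_add_one, ← hpar, ← h2, Nat.even_add]
      tauto
    · refine ⟨.cons a q, hq.cons hi, ?_⟩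
      simp [Nat.even_add_one, hpar]

abbrev E (V : Type) := V ⊕ V →₀ ℕ
abbrev eu {V : Type} (i : V) : E V := single (Sum.inl i) 1
abbrev ev {V : Type} (i : V) : E V := single (Sum.inr i) 1

/-- total degree at a vertex -/
def dg {V : Type} (m : E V) (i : V) : ℕ := m (Sum.inl i) + m (Sum.inr i)

theorem dg_add {V : Type} (m n : E V) (i : V) : dg (m + n) i = dg m i + dg n i := by
  simp [dg]; ring

theorem dg_u {V : Type} [DecidableEq V] (i j : V) : dg (eu i) j = if i = j then 1 else 0 := by
  simp [dg, single_apply]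

theorem dg_v {V : Type} [DecidableEq V] (i j : V) : dg (ev i) j = if i = j then 1 else 0 := by
  simp [dg, single_apply]

theorem dg_move {V : Type} (N : E V) (i j : V) :
   dg (N + ev i + eu j) = dg (N + eu i + ev j) := by
  classical
  funext x
  simp only [dg_add, dg_u, dg_v]

theorem exists_sub {V : Type} (m : E V) (x : V ⊕ V) (h : 0 < m x) : ∃ N : E V, m = N + single x 1 := by
  refine ⟨m - single x 1, ?_⟩
  rw [tsub_add_cancel_of_le]
  simpa [Nat.one_le_iff_ne_zero, Nat.pos_iff_ne_zero] using h

theorem exists_sub2 {V : Type} (m : E V) (i j : V) (h : 0 < m (.inl i)) (h' : 0 < m (.inr j)) : 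
    ∃ N : E V, m = N + eu i + ev j := by
  obtain ⟨N, hN⟩ := exists_sub m _ h'
  obtain ⟨N', hN'⟩ := exists_sub N (.inl i) (by subst hN; simpa [single_apply] using h)
  exact ⟨N', by rw [hN, hN']⟩

theorem path_lemma {V A : Type} [AddCommGroup A] (H : SimpleGraph V) (d : V → ℕ)
    (F : E V → A) (hF : ∀ i j N, H.Adj i j → F (N + eu i + ev j) = - F (N + ev i + eu j))
    (hd : ∀ i j, H.Adj i j → 0 < d j) {i j : V} (p : H.Walk i j) (hp : p.IsPath) :
    ∀ N : E V, dg (N + eu i + ev j) = d → 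
      F (N + eu i + ev j) = (-1 : ℤˣ) ^ p.length • F (N + ev i + eu j) := by
  classical
  induction p with
  | nil => intro N _; simp [add_right_comm]
  | @cons i h j a p ih =>
    intro N hN
    have hp' := hp.of_cons
    specialize ih hp'
    by_cases hj : h = j
    · subst hj
      have : p = .nil := by simpa using hp'
      subst this
      simp [hF _ _ _ a]
    have hi : i ≠ h := a.ne
    have h1 := hd i h a
    rw [← hN] at h1
    simp only [dg_add, dg_u, dg_v, hi, Ne.symm hj, if_false, add_zero] at h1
    simp only [SimpleGraph.Walk.length_cons, pow_succ, mul_neg, mul_one, Units.neg_smul]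
    rcases Nat.eq_zero_or_pos (N (.inr h)) with h0 | h0
    · obtain ⟨N', rfl⟩ := exists_sub N (.inl h) (by simp only [dg] at h1; omega)
      have e1 : N' + single (.inl h) 1 + eu i + ev j = (N' + eu i) + eu h + ev j := by abel
      have e2 : (N' + eu i) + ev h + eu j = (N' + eu j) + eu i + ev h := by abel
      have e3 : (N' + eu j) + ev i + eu h = N' + single (.inl h) 1 + ev i + eu j := by abel
      rw [e1] at hN ⊢
      rw [ih _ hN, e2, hF _ _ _ a, e3, smul_neg]
    · obtain ⟨N', rfl⟩ := exists_sub N (.inr h) h0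
      have e1 : N' + single (.inr h) 1 + eu i + ev j = (N' + ev j) + eu i + ev h := by abel
      have e2 : (N' + ev j) + ev i + eu h = (N' + ev i) + eu h + ev j := by abel
      have e3 : (N' + ev i) + ev h + eu j = N' + single (.inr h) 1 + ev i + eu j := by abel
      rw [e1] at hN ⊢
      rw [hF _ _ _ a, e2, ih _ (by rw [← e2, dg_move, hN]), e3]

/-- class sums -/
def ku {V : Type} [Fintype V] (H : SimpleGraph V) (m : E V) (i : V) : ℕ := 
  open Classical in ∑ j, if H.Reachable j i then m (.inl j) else 0
def kv {V : Type} [Fintype V] (H : SimpleGraph V) (m : E V) (i : V) : ℕ := 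
  open Classical in ∑ j, if H.Reachable j i then m (.inr j) else 0

theorem ku_add_kv {V : Type} [Fintype V] (H : SimpleGraph V) (m : E V) (i : V) : ku H m i + kv H m i = 
  open Classical in ∑ j, if H.Reachable j i then dg m j else 0 := by
  classical
  simp only [ku, kv, ← Finset.sum_add_distrib, dg]
  refine Finset.sum_congr rfl fun j _ => ?_
  split_ifs <;> simp

theorem ku_add {V : Type} [Fintype V] (H : SimpleGraph V) (m n : E V) (i : V) : 
    ku H (m + n) i = ku H m i + ku H n i := by
  classical
  simp only [ku, ← Finset.sum_add_distrib]
  refine Finset.sum_congr rfl fun j _ => ?_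
  split_ifs <;> simp

open Classical in
theorem ku_u {V : Type} [Fintype V] (H : SimpleGraph V) (i j : V) : 
    ku H (eu i) j = if H.Reachable i j then 1 else 0 := by
  simp only [ku]
  rw [Finset.sum_eq_single i]
  · simp
  · intro b _ hb
    simp [single_apply, hb.symm]
  · simp

theorem ku_v {V : Type} [Fintype V] (H : SimpleGraph V) (i j : V) : 
    ku H (ev i) j = 0 := by
  simp [ku]

theorem ku_move {V : Type} [Fintype V] (H : SimpleGraph V) (N : E V) (i j : V) (h : H.Reachable i j) : 
    ku H (N + ev i + eu j) = ku H (N + eu i + ev j) := by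
  funext x
  have : H.Reachable i x ↔ H.Reachable j x := ⟨fun t => h.symm.trans t, fun t => h.trans t⟩
  by_cases hx : H.Reachable j x
  · simp [ku_add, ku_u, ku_v, this.2 hx, hx]
  · simp [ku_add, ku_u, ku_v, mt this.1 hx, hx]

theorem conn_lemma {V A : Type} [Fintype V] [AddCommGroup A] (H : SimpleGraph V) (d : V → ℕ)
    (F : E V → A) (hF : ∀ i j N, H.Adj i j → F (N + eu i + ev j) = - F (N + ev i + eu j))
    (hd : ∀ i j, H.Adj i j → 0 < d j) (m' : E V) (hm' : dg m' = d) :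
    ∀ (k : ℕ) (m : E V), ∑ x, (m (.inl x) - m' (.inl x)) = k → dg m = d → ku H m = ku H m' → 
      ∃ s : ℤˣ, F m = s • F m' := by
  classical
  intro k
  induction k with
  | zero =>
    intro m hk hm hku
    have hle : ∀ x, m (.inl x) ≤ m' (.inl x) := by
      intro x
      have := (Finset.sum_eq_zero_iff.1 hk) x (Finset.mem_univ _)
      omega
    have heq : ∀ x, m (.inl x) = m' (.inl x) := by
      intro x
      have h1 := congrFun hku x
      unfold ku at h1
      rw [Finset.sum_eq_sum_iff_of_le] at h1
      · simpa using h1 x (Finset.mem_univ _)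
      · intro y _
        split_ifs
        · exact hle y
        · exact le_rfl
    have : m = m' := by
      ext x
      rcases x with x | x
      · exact heq x
      · have h1 := congrFun (hm.trans hm'.symm) x
        simp only [dg, heq x] at h1
        omega
    exact ⟨1, by simp [this]⟩
  | succ k ih =>
    intro m hk hm hku
    obtain ⟨i, -, hi⟩ : ∃ i ∈ Finset.univ, m (.inl i) - m' (.inl i) ≠ 0 := by
      apply Finset.exists_ne_zero_of_sum_ne_zero
      omega
    obtain ⟨j, hij, hj⟩ : ∃ j, H.Reachable j i ∧ m (.inl j) < m' (.inl j) := by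
      by_contra! hcon
      have h1 := congrFun hku i
      unfold ku at h1
      revert h1
      apply ne_of_gt
      apply Finset.sum_lt_sum
      · intro y _
        split_ifs with hy
        · exact hcon y hy
        · exact le_rfl
      · exact ⟨i, Finset.mem_univ _, by simp; omega⟩
    have hne : i ≠ j := by rintro rfl; omega
    have h2 := congrFun (hm.trans hm'.symm) j
    simp only [dg] at h2
    obtain ⟨N, rfl⟩ := exists_sub2 m i j (by omega) (by omega)
    obtain ⟨p, hp⟩ := hij.symm.exists_isPath
    have h3 := path_lemma H d F hF hd p hp N hm
    obtain ⟨s, hs⟩ := ih (N + ev i + eu j) (by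
      have : ∑ x, ((N + eu i + ev j) (.inl x) - m' (.inl x)) = 
        ∑ x, (((N + ev i + eu j) (.inl x) - m' (.inl x)) + if x = i then 1 else 0) := by
        refine Finset.sum_congr rfl fun x _ => ?_
        by_cases hx : x = i
        · subst hx
          simp [single_apply, hne.symm] at hi ⊢
          omega
        · by_cases hx' : x = j
          · subst hx'
            simp [hne, hx] at hj ⊢
            omega
          · simp [single_apply, hx, Ne.symm hx, Ne.symm hx']
      rw [this, Finset.sum_add_distrib] at hk
      simpa using hk) (by rw [dg_move, hm]) (by rw [ku_move _ _ _ _ hij.symm, hku])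
    exact ⟨(-1) ^ p.length * s, by rw [h3, hs, mul_smul]⟩

theorem conn_lemma2 {V A B : Type} [Fintype V] [AddCommGroup A] [AddCommGroup B]
    (H : SimpleGraph V) (d : V → ℕ)
    (F : E V → A) (hF : ∀ i j N, H.Adj i j → F (N + eu i + ev j) = - F (N + ev i + eu j))
    (w : E V → B) (hw : ∀ i j N, H.Adj i j → w (N + eu i + ev j) = - w (N + ev i + eu j))
    (hd : ∀ i j, H.Adj i j → 0 < d j) (m' : E V) (hm' : dg m' = d) (m : E V) (hm : dg m = d)
    (hk : ku H m = ku H m') : 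
    (F m = F m' ∧ w m = w m') ∨ (F m = - F m' ∧ w m = - w m') := by
  obtain ⟨s, hs⟩ := conn_lemma H d (fun m => (F m, w m))
    (fun i j N h => Prod.ext (hF i j N h) (hw i j N h)) hd m' hm' _ m rfl hm hk
  rcases Int.units_eq_one_or s with rfl | rfl
  · left
    simpa using hs
  · right
    simpa using hs

theorem odd_core {V A : Type} [AddCommGroup A] (H : SimpleGraph V) (d : V → ℕ)
    (F : E V → A) (hF : ∀ i j N, H.Adj i j → F (N + eu i + ev j) = - F (N + ev i + eu j))
    (hd : ∀ i j, H.Adj i j → 0 < d j) {i j : V} (hij : H.Adj i j) (p : H.Walk i j) (hp : p.IsPath)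
    (hpe : Even p.length) (m : E V) (hm : dg m = d) (h1 : 0 < m (.inl i)) (h2 : 0 < m (.inr j)) :
    F m = - F m := by
  obtain ⟨N, rfl⟩ := exists_sub2 m i j h1 h2
  have h3 := path_lemma H d F hF hd p hp N hm
  rw [hpe.neg_one_pow, one_smul] at h3
  have h4 := hF i j N hij
  rw [← h3] at h4
  exact h4

theorem odd_lemma {V A : Type} [Fintype V] [AddCommGroup A] (H : SimpleGraph V) (d : V → ℕ)
    (F : E V → A) (hF : ∀ i j N, H.Adj i j → F (N + eu i + ev j) = - F (N + ev i + eu j))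
    (hd : ∀ i j, H.Adj i j → 0 < d j) {i j : V} (hij : H.Adj i j) (p : H.Walk i j) (hp : p.IsPath)
    (hpe : Even p.length) (m : E V) (hm : dg m = d) (h1 : 0 < ku H m i) (h2 : 0 < kv H m i) :
    F m = - F m := by
  classical
  obtain ⟨a, ha, ha'⟩ : ∃ a, H.Reachable a i ∧ 0 < m (.inl a) := by
    by_contra! hcon
    apply h1.ne'
    apply Finset.sum_eq_zero
    intro x _
    split_ifs with hx
    · simpa using hcon x hx
    · rfl
  obtain ⟨b, hb, hb'⟩ : ∃ a, H.Reachable a i ∧ 0 < m (.inr a) := by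
    by_contra! hcon
    apply h2.ne'
    apply Finset.sum_eq_zero
    intro x _
    split_ifs with hx
    · simpa using hcon x hx
    · rfl
  have di := hd _ _ hij.symm
  have dj := hd _ _ hij
  have hm0 := hm
  rw [← hm] at di dj
  simp only [dg] at di dj
  have tr : ∀ m' : E V, F m' = - F m' → (∃ s : ℤˣ, F m = s • F m') → F m = - F m := by
    rintro m' h ⟨s, hs⟩
    rw [hs, ← smul_neg, ← h]
  by_cases c1 : 0 < m (.inl i) ∧ 0 < m (.inr j)
  · exact odd_core H d F hF hd hij p hp hpe m hm c1.1 c1.2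
  by_cases c2 : 0 < m (.inr i) ∧ 0 < m (.inl j)
  · exact odd_core H d F hF hd hij.symm p.reverse hp.reverse (by simpa using hpe) m hm c2.2 c2.1
  have hne := hij.ne
  by_cases c3 : m (.inl i) = 0
  · obtain ⟨N, hN⟩ := exists_sub2 m a i ha' (by omega)
    obtain ⟨q, hq⟩ := ha.exists_isPath
    have h3 := path_lemma H d F hF hd q hq N (hN ▸ hm)
    rw [← hN] at h3
    refine tr _ ?_ ⟨_, h3⟩
    refine odd_core H d F hF hd hij p hp hpe _ (by rw [dg_move, ← hN, hm]) (by simp) ?_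
    have : 0 < m (.inr j) := by omega
    rw [hN] at this
    simp [single_apply, hne] at this ⊢
    omega
  · obtain ⟨N, hN⟩ := exists_sub2 m j b (by omega) hb'
    obtain ⟨q, hq⟩ := (hij.reachable.symm.trans hb.symm).exists_isPath
    have h3 := path_lemma H d F hF hd q hq N (hN ▸ hm)
    rw [← hN] at h3
    refine tr _ ?_ ⟨_, h3⟩
    refine odd_core H d F hF hd hij p hp hpe _ (by rw [dg_move, ← hN, hm]) ?_ (by simp)
    have : 0 < m (.inl i) := by omega
    rw [hN] at this
    simp [single_apply, hne.symm] at this ⊢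
    omega

/-- restrict to the support of the degree -/
def Hd {V : Type} (G : SimpleGraph V) (d : V → ℕ) : SimpleGraph V where
  Adj i j := G.Adj i j ∧ 0 < d i ∧ 0 < d j
  symm := ⟨fun _ _ h => ⟨h.1.symm, h.2.2, h.2.1⟩⟩
  loopless := ⟨fun _ h => h.1.ne rfl⟩

def JG (K : Type) [Field K] {V : Type} (G : SimpleGraph V) :
    Ideal (MvPolynomial (V ⊕ V) K) :=
  Ideal.span {f | ∃ i j, G.Adj i j ∧
    f = X (Sum.inl i) * X (Sum.inr j) + X (Sum.inr i) * X (Sum.inl j)}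

def wt {K : Type} [Field K] {V : Type} [Fintype V] (α β : V → K) (m : E V) : K :=
  ∏ i, (α i ^ m (.inl i) * β i ^ m (.inr i))

theorem wt_add {K : Type} [Field K] {V : Type} [Fintype V] (α β : V → K) (m n : E V) :
    wt α β (m + n) = wt α β m * wt α β n := by
  simp only [wt, ← Finset.prod_mul_distrib]
  refine Finset.prod_congr rfl fun i _ => ?_
  simp only [Finsupp.add_apply, pow_add]; ring

theorem wt_u {K : Type} [Field K] {V : Type} [Fintype V] (α β : V → K) (i : V) :
    wt α β (eu i) = α i := by
  classical
  simp only [wt]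
  rw [Finset.prod_eq_single i]
  · simp
  · intro b _ hb
    simp [hb.symm]
  · simp

theorem wt_v {K : Type} [Field K] {V : Type} [Fintype V] (α β : V → K) (i : V) :
    wt α β (ev i) = β i := by
  classical
  simp only [wt]
  rw [Finset.prod_eq_single i]
  · simp
  · intro b _ hb
    simp [hb.symm]
  · simp

def ee {V : Type} [Fintype V] (H : SimpleGraph V) (m : E V) : E V :=
  Finsupp.equivFunOnFinite.symm (Sum.elim (dg m) (ku H m))

theorem ee_add {V : Type} [Fintype V] (H : SimpleGraph V) (m n : E V) :
    ee H (m + n) = ee H m + ee H n := by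
  ext x
  rcases x with x | x
  · simp [ee, dg_add]
  · simp [ee, ku_add]

theorem ee_zero {V : Type} [Fintype V] (H : SimpleGraph V) :
    ee H (0 : E V) = 0 := by
  ext x
  rcases x with x | x
  · simp [ee, dg]
  · simp [ee, ku]

theorem ee_eq {V : Type} [Fintype V] (H : SimpleGraph V) (m n : E V) :
    ee H m = ee H n ↔ dg m = dg n ∧ ku H m = ku H n := by
  constructor
  · intro h
    have h' := Finsupp.equivFunOnFinite.symm.injective h
    exact ⟨funext fun i => congrFun h' (.inl i), funext fun i => congrFun h' (.inr i)⟩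
  · rintro ⟨h1, h2⟩
    simp [ee, h1, h2]

def phi {K : Type} [Field K] {V : Type} [Fintype V] (H : SimpleGraph V) (α β : V → K) :
    MvPolynomial (V ⊕ V) K →ₐ[K] MvPolynomial (V ⊕ V) K :=
  aeval (Sum.elim (fun i => monomial (ee H (eu i)) (α i)) (fun i => monomial (ee H (ev i)) (β i)))

theorem phi_monomial_s14 {K : Type} [Field K] {V : Type} [Fintype V] (H : SimpleGraph V) (α β : V → K)
    (m : E V) : phi H α β (monomial m 1) = monomial (ee H m) (wt α β m) := by
  induction m using Finsupp.induction_linear with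
  | zero =>
    rw [ee_zero]
    have : wt α β (0 : E V) = 1 := by simp [wt]
    rw [this]
    exact map_one _
  | add f g hf hg =>
    have : (monomial (f + g) (1 : K)) = monomial f 1 * monomial g 1 := by
      rw [monomial_mul, one_mul]
    rw [this, map_mul, hf, hg, monomial_mul, ee_add, wt_add]
  | single x k =>
    induction k with
    | zero =>
      rw [Finsupp.single_zero, ee_zero]
      have : wt α β (0 : E V) = 1 := by simp [wt]
      rw [this]
      exact map_one _
    | succ k ih =>
      have : (monomial (Finsupp.single x (k + 1)) (1 : K)) 
          = monomial (Finsupp.single x k) 1 * X x := by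
        rw [X, monomial_mul, one_mul, Finsupp.single_add]
      rw [this, map_mul, ih, Finsupp.single_add, ee_add, wt_add]
      have : phi H α β (X x) = monomial (ee H (Finsupp.single x 1)) (wt α β (Finsupp.single x 1)) := by
        rcases x with x | x
        · rw [show Finsupp.single (Sum.inl x) 1 = eu x from rfl, wt_u]
          simp [phi]
        · rw [show Finsupp.single (Sum.inr x) 1 = ev x from rfl, wt_v]
          simp [phi]
      rw [this, monomial_mul]

theorem phi_X_inl {K : Type} [Field K] {V : Type} [Fintype V] (H : SimpleGraph V) (α β : V → K)
    (i : V) : phi H α β (X (.inl i)) = monomial (ee H (eu i)) (α i) := by simp [phi]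

theorem phi_X_inr {K : Type} [Field K] {V : Type} [Fintype V] (H : SimpleGraph V) (α β : V → K)
    (i : V) : phi H α β (X (.inr i)) = monomial (ee H (ev i)) (β i) := by simp [phi]

open Classical in
theorem coeff_phi {K : Type} [Field K] {V : Type} [Fintype V] (H : SimpleGraph V) (α β : V → K)
    (f : MvPolynomial (V ⊕ V) K) (e : E V) : 
    coeff e (phi H α β f) = ∑ m ∈ f.support with ee H m = e, coeff m f * wt α β m := by
  conv_lhs => rw [f.as_sum]
  rw [map_sum, coeff_sum, Finset.sum_filter]
  refine Finset.sum_congr rfl fun m _ => ?_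
  have : monomial m (coeff m f) = C (coeff m f) * monomial m 1 := by rw [C_mul_monomial, mul_one]
  rw [this, map_mul, phi_monomial_s14, algHom_C, algebraMap_eq, C_mul_monomial, coeff_monomial]

/-- The homs kill the ideal. -/
theorem phi_kills {K : Type} [Field K] {V : Type} [Fintype V] (G : SimpleGraph V) (d : V → ℕ)
    (α β : V → K) (h0 : ∀ i, d i = 0 → α i = 0 ∧ β i = 0) 
    (h1 : ∀ i j, (Hd G d).Adj i j → α i * β j = - (β i * α j)) (f : MvPolynomial (V ⊕ V) K)
    (hf : f ∈ JG K G) : phi (Hd G d) α β f = 0 := by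
  have : JG K G ≤ RingHom.ker (phi (Hd G d) α β) := by
    rw [JG, Ideal.span_le]
    rintro _ ⟨i, j, hij, rfl⟩
    simp only [SetLike.mem_coe, RingHom.mem_ker, map_add, map_mul, phi_X_inl, phi_X_inr, monomial_mul]
    by_cases hi : d i = 0
    · simp [h0 i hi]
    by_cases hj : d j = 0
    · simp [h0 j hj]
    have hH : (Hd G d).Adj i j := ⟨hij, Nat.pos_of_ne_zero hi, Nat.pos_of_ne_zero hj⟩
    have e : ee (Hd G d) (eu i) + ee (Hd G d) (ev j) = ee (Hd G d) (ev i) + ee (Hd G d) (eu j) := by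
      rw [← ee_add, ← ee_add, ee_eq]
      have a1 := dg_move 0 i j
      have a2 := ku_move (Hd G d) 0 i j hH.reachable
      simp only [zero_add] at a1 a2
      exact ⟨a1.symm, a2.symm⟩
    rw [e, h1 i j hH, ← map_add]
    simp
  exact this hf

theorem mk_rel {K : Type} [Field K] {V : Type} (G : SimpleGraph V) {i j : V} (h : G.Adj i j)
    (N : E V) : Ideal.Quotient.mk (JG K G) (monomial (N + eu i + ev j) 1) = 
      - Ideal.Quotient.mk (JG K G) (monomial (N + ev i + eu j) 1) := by
  rw [eq_neg_iff_add_eq_zero, ← map_add, Ideal.Quotient.eq_zero_iff_mem]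
  have : (monomial (N + eu i + ev j) (1 : K)) + monomial (N + ev i + eu j) 1 = 
    monomial N 1 * (X (Sum.inl i) * X (Sum.inr j) + X (Sum.inr i) * X (Sum.inl j)) := by
    simp only [X, monomial_mul, mul_add, one_mul, add_assoc]
  rw [this]
  exact Ideal.mul_mem_left _ _ (Ideal.subset_span ⟨i, j, h, rfl⟩)

theorem ku_congr {V : Type} [Fintype V] (H : SimpleGraph V) (m : E V) {i j : V} 
    (h : H.Reachable i j) : ku H m i = ku H m j ∧ kv H m i = kv H m j := by
  have : ∀ x, H.Reachable x i ↔ H.Reachable x j := fun x => 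
    ⟨fun t => t.trans h, fun t => t.trans h.symm⟩
  classical
  constructor
  · exact Finset.sum_congr rfl fun x _ => if_congr (this x) rfl rfl
  · exact Finset.sum_congr rfl fun x _ => if_congr (this x) rfl rfl

theorem le_ku {V : Type} [Fintype V] (H : SimpleGraph V) (m : E V) (i : V) : 
    m (.inl i) ≤ ku H m i := by
  classical
  have := Finset.single_le_sum (f := fun j => if H.Reachable j i then m (.inl j) else 0) 
    (fun _ _ => Nat.zero_le _) (Finset.mem_univ i)
  simpa [ku] using this

theorem le_kv {V : Type} [Fintype V] (H : SimpleGraph V) (m : E V) (i : V) : 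
    m (.inr i) ≤ kv H m i := by
  classical
  have := Finset.single_le_sum (f := fun j => if H.Reachable j i then m (.inr j) else 0) 
    (fun _ _ => Nat.zero_le _) (Finset.mem_univ i)
  simpa [kv] using this

theorem isolated {V : Type} [Fintype V] (G : SimpleGraph V) (m : E V) (i : V) (h : dg m i = 0) :
    ku (Hd G (dg m)) m i = 0 ∧ kv (Hd G (dg m)) m i = 0 := by
  classical
  have h1 := ku_add_kv (Hd G (dg m)) m i
  rw [Finset.sum_eq_zero] at h1
  · omega
  · intro x _
    split_ifs with hx
    · obtain ⟨p⟩ := hx.symm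
      cases p with
      | nil => exact h
      | cons a _ => exact absurd a.2.1 (by omega)
    · rfl

open Classical in
theorem class_sum_mem {K : Type} [Field K] (hchar : ringChar K ≠ 2) {V : Type} [Fintype V]
    (G : SimpleGraph V) (f : MvPolynomial (V ⊕ V) K) (n : ℕ) (hf : f ^ n ∈ JG K G) (m₀ : E V) :
    ∑ m ∈ f.support with ee (Hd G (dg m₀)) m = ee (Hd G (dg m₀)) m₀, monomial m (coeff m f) 
      ∈ JG K G := by
  have two : (2 : K) ≠ 0 := Ring.two_ne_zero hchar
  set H := Hd G (dg m₀) with hH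
  have hd : ∀ i j, H.Adj i j → 0 < dg m₀ j := fun i j h => h.2.2
  have hmon : ∀ (m : E V) (c : K), monomial m c = C c * monomial m 1 := fun m c => by
    rw [C_mul_monomial, mul_one]
  let H' : SimpleGraph V := 
    { Adj := fun i j => H.Adj i j ∧ 0 < ku H m₀ i ∧ 0 < kv H m₀ i
      symm := ⟨fun i j h => ⟨h.1.symm, by
        rw [← (ku_congr H m₀ h.1.reachable).1, ← (ku_congr H m₀ h.1.reachable).2]; exact h.2⟩⟩
      loopless := ⟨fun _ h => h.1.ne rfl⟩ }
  have hle : H' ≤ H := fun i j h => h.1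
  by_cases hcol : ∀ i j (_ : H'.Adj i j) (p : H'.Walk j i), p.IsPath → ¬ Even p.length
  · -- colorable case
    have hc2 : H'.Colorable 2 := by
      rw [SimpleGraph.two_colorable_iff_forall_loop_even]
      intro u w
      obtain ⟨q, hq, he⟩ := odd_path H' hcol w
      have : q = .nil := by simpa using hq
      subst this
      simpa using he
    obtain ⟨c⟩ := hc2
    let ε : V → K := fun i => if c i = 0 then 1 else -1
    have hε0 : ∀ i, ε i ≠ 0 := by
      intro i
      simp only [ε]
      split_ifs <;> simp
    have hε : ∀ i j, H'.Adj i j → ε i = - ε j := by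
      intro i j h
      have := c.valid h
      simp only [ε]
      generalize c i = a at *
      generalize c j = b at *
      fin_cases a <;> fin_cases b <;> simp at *
    let α : V → K := fun i => if ku H m₀ i = 0 then 0 else ε i
    let β : V → K := fun i => if kv H m₀ i = 0 then 0 else 1
    have h0 : ∀ i, dg m₀ i = 0 → α i = 0 ∧ β i = 0 := by
      intro i hi
      simp [α, β, hH, isolated G m₀ i hi]
    have h1 : ∀ i j, H.Adj i j → α i * β j = - (β i * α j) := by
      intro i j h
      simp only [α, β, ← (ku_congr H m₀ h.reachable).1, ← (ku_congr H m₀ h.reachable).2]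
      by_cases a1 : ku H m₀ i = 0
      · simp [a1]
      by_cases a2 : kv H m₀ i = 0
      · simp [a2]
      simp [a1, a2, hε i j ⟨h, Nat.pos_of_ne_zero a1, Nat.pos_of_ne_zero a2⟩]
    have hw : wt α β m₀ ≠ 0 := by
      rw [wt, Finset.prod_ne_zero_iff]
      intro i _
      apply mul_ne_zero
      · by_cases hi : m₀ (.inl i) = 0
        · simp [hi]
        · have := le_ku H m₀ i
          apply pow_ne_zero
          simp only [α]
          rw [if_neg (by omega)]
          exact hε0 i
      · by_cases hi : m₀ (.inr i) = 0
        · simp [hi]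
        · have := le_kv H m₀ i
          apply pow_ne_zero
          simp only [β]
          rw [if_neg (by omega)]
          exact one_ne_zero
    have hphi : phi H α β f = 0 := by
      have := phi_kills G (dg m₀) α β h0 h1 _ hf
      rw [map_pow] at this
      exact eq_zero_of_pow_eq_zero this
    have hsum := coeff_phi H α β f (ee H m₀)
    rw [hphi, coeff_zero] at hsum
    have hwt : ∀ i j N, H.Adj i j → wt α β (N + eu i + ev j) = - wt α β (N + ev i + eu j) := by
      intro i j N h
      simp only [wt_add, wt_u, wt_v]
      rw [mul_assoc, h1 i j h]; ring
    rw [← Ideal.Quotient.eq_zero_iff_mem]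
    have key : ∀ m ∈ f.support.filter (fun m => ee H m = ee H m₀), 
        Ideal.Quotient.mk (JG K G) (monomial m (coeff m f)) = 
        Ideal.Quotient.mk (JG K G) (C (coeff m f * wt α β m) * (C (wt α β m₀)⁻¹ * monomial m₀ 1)) := by
      intro m hm
      have hm := (Finset.mem_filter.1 hm).2
      rw [ee_eq] at hm
      rw [hmon]
      rcases conn_lemma2 H (dg m₀) (fun m => Ideal.Quotient.mk (JG K G) (monomial m 1))
        (fun i j N h => mk_rel G h.1 N) (wt α β) hwt hd m₀ rfl m hm.1 hm.2 with ⟨hs1, hs2⟩ | ⟨hs1, hs2⟩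
      · rw [map_mul, hs1, hs2, ← map_mul, ← mul_assoc, ← C_mul, mul_assoc, mul_inv_cancel₀ hw, mul_one]
      · rw [map_mul, hs1, hs2, ← map_neg, ← map_mul, ← mul_assoc, ← C_mul, mul_neg,
          mul_neg (coeff m f), neg_mul, mul_assoc, mul_inv_cancel₀ hw, mul_one, C_neg, neg_mul]
    rw [map_sum, Finset.sum_congr rfl key, ← map_sum, ← Finset.sum_mul, ← map_sum, ← hsum]
    simp
  · push Not at hcol
    obtain ⟨i, j, hij, p, hp, hpe⟩ := hcol
    refine Ideal.sum_mem _ fun m hm => ?_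
    have hm := (Finset.mem_filter.1 hm).2
    rw [ee_eq] at hm
    have hkv : kv H m i = kv H m₀ i := by
      have a1 := ku_add_kv H m i
      have a2 := ku_add_kv H m₀ i
      rw [hm.1, ← a2, hm.2] at a1
      omega
    have := odd_lemma H (dg m₀) (fun m => Ideal.Quotient.mk (JG K G) (monomial m 1))
      (fun i j N h => mk_rel G h.1 N) hd hij.1 (p.mapLe hle).reverse (hp.mapLe hle).reverse
      (by simpa using hpe) m hm.1 (by rw [hm.2]; exact hij.2.1) (by rw [hkv]; exact hij.2.2)
    rw [eq_neg_iff_add_eq_zero, ← map_add, Ideal.Quotient.eq_zero_iff_mem] at this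
    have h2 := Ideal.mul_mem_left _ (C (coeff m f * 2⁻¹)) this
    convert h2 using 1
    rw [hmon, C_mul, mul_assoc, ← two_mul, ← mul_assoc (C 2⁻¹), 
      show (2 : MvPolynomial (V ⊕ V) K) = C 2 from (map_ofNat C 2).symm, ← C_mul, inv_mul_cancel₀ two]
    simp

theorem JG_radical {K : Type} [Field K] (hchar : ringChar K ≠ 2) {V : Type} [Fintype V]
    (G : SimpleGraph V) : (JG K G).IsRadical := by
  classical
  rintro f ⟨n, hf⟩
  let κ : E V → E V := fun m => ee (Hd G (dg m)) m
  have hκ : ∀ m m₀, κ m = κ m₀ ↔ ee (Hd G (dg m₀)) m = ee (Hd G (dg m₀)) m₀ := by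
    intro m m₀
    have hdg : ∀ (H H' : SimpleGraph V) , ee H m = ee H' m₀ → dg m = dg m₀ := by
      intro H H' h
      have h' := Finsupp.equivFunOnFinite.symm.injective h
      exact funext fun i => congrFun h' (.inl i)
    constructor
    · intro h
      have := hdg _ _ h
      simpa only [κ, this] using h
    · intro h
      have := hdg _ _ h
      simpa only [κ, this] using h
  rw [f.as_sum, ← Finset.sum_fiberwise_of_maps_to (t := f.support.image κ) 
    (fun m hm => Finset.mem_image_of_mem κ hm)]
  refine Ideal.sum_mem _ fun e he => ?_
  obtain ⟨m₀, -, rfl⟩ := Finset.mem_image.1 he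
  simp only [hκ]
  convert class_sum_mem hchar G f n hf m₀

theorem mem_JG (K : Type) [Field K] {V : Type} (G : SimpleGraph V) {i j : V} (h : G.Adj i j) :
    (X (Sum.inl i) * X (Sum.inr j) + X (Sum.inr i) * X (Sum.inl j) : MvPolynomial (V ⊕ V) K)
      ∈ JG K G := 
  Ideal.subset_span ⟨i, j, h, rfl⟩

theorem mem_PG (K : Type) [Field K] {V : Type} (G : SimpleGraph V) {i j : V} (h : G.Adj i j) :
    (X (Sum.inl i) * X (Sum.inl j) - X (Sum.inr i) * X (Sum.inr j) : MvPolynomial (V ⊕ V) K)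
      ∈ parityBinomialEdgeIdeal K G := 
  Ideal.subset_span ⟨i, j, h, rfl⟩

theorem transfer {R S : Type} [CommRing R] [CommRing S] (I : Ideal R) (J : Ideal S)
    (hJ : J.IsRadical) (θ : R →+* S) (θ' : S →+* R) (hid : ∀ f, θ' (θ f) = f)
    (h1 : I ≤ J.comap θ) (h2 : J ≤ I.comap θ') : I.IsRadical := by
  rintro f ⟨k, hf⟩
  have h3 : θ f ∈ J := hJ ⟨k, by rw [← map_pow]; exact h1 hf⟩
  have h4 : θ' (θ f) ∈ I := h2 h3
  rwa [hid] at h4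

/-- **Radicality of parity binomial edge ideals.**  If `char K ≠ 2`, then the
parity binomial edge ideal `𝓘_G` of any graph `G` on `[n]` is a radical
ideal. -/
theorem parityBinomialEdgeIdeal_isRadical
    (K : Type) [Field K] (hchar : ringChar K ≠ 2)
    (n : ℕ) (G : SimpleGraph (Fin n)) :
    (parityBinomialEdgeIdeal K G).IsRadical := by
  have two : (2 : K) ≠ 0 := Ring.two_ne_zero hchar
  have hC : (C 2⁻¹ : MvPolynomial (Fin n ⊕ Fin n) K) * 2 = 1 := by
    rw [show (2 : MvPolynomial (Fin n ⊕ Fin n) K) = C 2 from (map_ofNat C 2).symm, ← C_mul,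
      inv_mul_cancel₀ two, C_1]
  let θ : MvPolynomial (Fin n ⊕ Fin n) K →ₐ[K] MvPolynomial (Fin n ⊕ Fin n) K :=
    aeval (Sum.elim (fun i => X (.inl i) + X (.inr i)) (fun i => X (.inl i) - X (.inr i)))
  let θ' : MvPolynomial (Fin n ⊕ Fin n) K →ₐ[K] MvPolynomial (Fin n ⊕ Fin n) K :=
    aeval (Sum.elim (fun i => C 2⁻¹ * (X (.inl i) + X (.inr i)))
      (fun i => C 2⁻¹ * (X (.inl i) - X (.inr i))))
  have hid : ∀ f, θ' (θ f) = f := by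
    intro f
    have : θ'.comp θ = AlgHom.id K _ := by
      ext1 x
      rcases x with x | x
      · simp only [AlgHom.comp_apply, θ, θ', aeval_X, Sum.elim_inl, Sum.elim_inr, map_add,
          AlgHom.id_apply]
        linear_combination (X (.inl x)) * hC
      · simp only [AlgHom.comp_apply, θ, θ', aeval_X, Sum.elim_inl, Sum.elim_inr, map_sub,
          AlgHom.id_apply]
        linear_combination (X (.inr x)) * hC
    exact congrArg (fun g => g f) this
  have h1 : parityBinomialEdgeIdeal K G ≤ (JG K G).comap θ := by
    rw [parityBinomialEdgeIdeal, Ideal.span_le]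
    rintro _ ⟨i, j, hij, rfl⟩
    have := Ideal.mul_mem_left (JG K G) 2 (mem_JG K G hij)
    simp only [SetLike.mem_coe, Ideal.mem_comap, θ, map_sub, map_mul, aeval_X, Sum.elim_inl,
      Sum.elim_inr]
    convert this using 1
    ring
  have h2 : JG K G ≤ (parityBinomialEdgeIdeal K G).comap θ' := by
    rw [JG, Ideal.span_le]
    rintro _ ⟨i, j, hij, rfl⟩
    have := Ideal.mul_mem_left (parityBinomialEdgeIdeal K G) (C 2⁻¹ * C 2⁻¹ * 2)
      (mem_PG K G hij)
    simp only [SetLike.mem_coe, Ideal.mem_comap, θ', map_add, map_mul, aeval_X, Sum.elim_inl,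
      Sum.elim_inr]
    convert this using 1
    ring
  exact transfer _ _ (JG_radical hchar G) θ.toRingHom θ'.toRingHom hid h1 h2

end
end

section
/- Let K be a field and G a bipartite finite simple graph on [n]. Then the following are equivalent: (1) the Lovász–Saks–Schrijver ideal L_G = (x_i x_j + y_i y_j : {i,j} ∈ E(G)) is a complete intersection; (2) the parity binomial edge ideal 𝓘_G = (x_i x_j − y_i y_j : {i,j} ∈ E(G)) is a complete intersection; (3) G is a disjoint union of path graphs. -/
open MvPolynomial

noncomputable section

/-- The Lovász–Saks–Schrijver ideal of a simple graph `G` on vertex set `V`: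
`L_G = (x_i x_j + y_i y_j : {i,j} ∈ E(G))` in
`K[x_v, y_v : v ∈ V] = MvPolynomial (V ⊕ V) K`. -/
def lssIdeal (K : Type) [Field K] {V : Type} (G : SimpleGraph V) :
    Ideal (MvPolynomial (V ⊕ V) K) :=
  Ideal.span {f | ∃ i j, G.Adj i j ∧
    f = X (Sum.inl i) * X (Sum.inl j) + X (Sum.inr i) * X (Sum.inr j)}

/-- A homogeneous ideal of a polynomial ring is a complete intersection if it
is generated by a regular sequence of homogeneous polynomials. -/
def IsCompleteIntersectionIdeal {σ K : Type} [Field K]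
    (I : Ideal (MvPolynomial σ K)) : Prop :=
  ∃ rs : List (MvPolynomial σ K),
    (∀ f ∈ rs, ∃ d, f.IsHomogeneous d) ∧
    RingTheory.Sequence.IsRegular (MvPolynomial σ K) rs ∧
    I = Ideal.span {f | f ∈ rs}

/-- `G` is bipartite: its vertex set can be split into two parts such that
every edge joins the two parts. -/
def IsBipartiteGraph {V : Type} (G : SimpleGraph V) : Prop :=
  ∃ A : Set V, ∀ u v, G.Adj u v → (u ∈ A ↔ v ∉ A)

/-- `G` is a disjoint union of paths: every connected component of `G`
induces a path graph. -/
def IsDisjointUnionOfPaths {V : Type} (G : SimpleGraph V) : Prop :=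
  ∀ c : G.ConnectedComponent, ∃ m : ℕ,
    Nonempty (G.induce c.supp ≃g SimpleGraph.pathGraph m)

namespace LSSAux

theorem mem_take_succ {α : Type*} (rs : List α) (i : ℕ) (h : i < rs.length) (x : α) :
    x ∈ rs.take (i + 1) ↔ x ∈ rs.take i ∨ x = rs[i] := by
  rw [List.take_add_one, List.mem_append, List.getElem?_eq_getElem h]
  simp

theorem wr_iff {R : Type*} [CommRing R] (rs : List R) :
    RingTheory.Sequence.IsWeaklyRegular R rs ↔ ∀ (i : ℕ) (h : i < rs.length) (g : R),
      rs[i] * g ∈ Ideal.span {f | f ∈ rs.take i} → g ∈ Ideal.span {f | f ∈ rs.take i} := by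
  rw [RingTheory.Sequence.isWeaklyRegular_iff]
  refine forall_congr' fun i => forall_congr' fun h => ?_
  rw [isSMulRegular_quotient_iff_mem_of_smul_mem]
  have : (Ideal.ofList (rs.take i) • ⊤ : Submodule R R) = Ideal.span {f | f ∈ rs.take i} := by
    rw [Ideal.smul_eq_mul, Ideal.mul_top]
  rw [this]
  simp only [smul_eq_mul]

theorem height_ge {R : Type*} [CommRing R] (rs : List R)
    (hrs : RingTheory.Sequence.IsWeaklyRegular R rs) (k : ℕ) (hk : k ≤ rs.length) :
    ∀ P : Ideal R, P.IsPrime → Ideal.span {f | f ∈ rs.take k} ≤ P → (k : ℕ∞) ≤ P.height := by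
  rw [wr_iff] at hrs
  induction k with
  | zero => intro P _ _; simp
  | succ k ih =>
    intro P hP hle
    have hklt : k < rs.length := hk
    have hle' : Ideal.span {f | f ∈ rs.take k} ≤ P := by
      refine le_trans (Ideal.span_mono ?_) hle
      intro f hf
      simp only [Set.mem_ofPred_eq] at hf ⊢
      rw [List.take_add_one]
      exact List.mem_append_left _ hf
    obtain ⟨Q, hQ, hQP⟩ := Ideal.exists_minimalPrimes_le hle'
    have hQprime : Q.IsPrime := hQ.isPrime
    have h1 := ih hklt.le Q hQprime hQ.1.2
    have hfP : rs[k] ∈ P := by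
      apply hle
      apply Ideal.subset_span
      simp only [Set.mem_ofPred_eq]
      rw [mem_take_succ rs k hklt]
      exact Or.inr rfl
    have hfQ : rs[k] ∉ Q := by
      intro hx
      obtain ⟨y, hy, hxy⟩ := Ideal.exists_mul_mem_of_mem_minimalPrimes hQ hx
      exact hy (hrs k hklt y hxy)
    have hlt : Q < P := lt_of_le_of_ne hQP (fun h => hfQ (h ▸ hfP))
    have h2 := Ideal.height_add_one_le_of_lt_of_isPrime hlt
    push_cast
    exact le_trans (by gcongr) h2

section GB
variable {σ K : Type*} [Field K] (m : MonomialOrder σ)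

def IsGB (B : Set (MvPolynomial σ K)) : Prop :=
  ∀ h ∈ Ideal.span B, h ≠ 0 → ∃ b ∈ B, m.degree b ≤ m.degree h

theorem le_of_disj {a b c : σ →₀ ℕ} (hd : Disjoint a b) (h : a ≤ b + c) : a ≤ c := by
  intro i
  have h1 := h i
  have h2 : a i ⊓ b i = 0 := by
    exact DFunLike.congr_fun hd.eq_bot i
  simp only [Finsupp.add_apply] at h1
  have : a i = 0 ∨ b i = 0 := by
    rcases le_total (a i) (b i) with h | h
    · left; rwa [inf_eq_left.2 h] at h2
    · right; rwa [inf_eq_right.2 h] at h2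
  omega

variable {m}

theorem normal_form {B : Set (MvPolynomial σ K)} (h0 : ∀ b ∈ B, b ≠ 0) (g : MvPolynomial σ K) :
    ∃ r, g - r ∈ Ideal.span B ∧ ∀ c ∈ r.support, ∀ b ∈ B, ¬ (m.degree b ≤ c) := by
  obtain ⟨q, r, h1, -, h3⟩ := m.div_set (B := B)
    (fun b hb => by simpa [isUnit_iff_ne_zero] using h0 b hb) g
  refine ⟨r, ?_, h3⟩
  rw [h1, add_sub_cancel_right]
  rw [Finsupp.linearCombination_apply]
  exact Ideal.sum_mem _ fun b _ => Ideal.mul_mem_left _ _ (Ideal.subset_span b.2)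

theorem gb_regular {B : Set (MvPolynomial σ K)} (h0 : ∀ b ∈ B, b ≠ 0) (hB : IsGB m B)
    {f : MvPolynomial σ K} (hf : f ≠ 0) (hd : ∀ b ∈ B, Disjoint (m.degree b) (m.degree f))
    (g : MvPolynomial σ K) (hg : f * g ∈ Ideal.span B) : g ∈ Ideal.span B := by
  obtain ⟨r, h1, h2⟩ := normal_form (m := m) h0 g
  by_cases hr : r = 0
  · simpa [hr] using h1
  exfalso
  have h3 : f * r ∈ Ideal.span B := by
    have := Ideal.sub_mem _ hg (Ideal.mul_mem_left _ f h1)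
    convert this using 1; ring
  obtain ⟨b, hb, hle⟩ := hB _ h3 (mul_ne_zero hf hr)
  rw [m.degree_mul hf hr] at hle
  exact h2 _ (m.degree_mem_support hr) b hb (le_of_disj (hd b hb) hle)

theorem gb_insert {B : Set (MvPolynomial σ K)} (h0 : ∀ b ∈ B, b ≠ 0) (hB : IsGB m B)
    {f : MvPolynomial σ K} (hf : f ≠ 0) (hd : ∀ b ∈ B, Disjoint (m.degree b) (m.degree f)) :
    IsGB m (insert f B) := by
  intro h hh hne
  obtain ⟨g, i, hi, rfl⟩ := Ideal.mem_span_insert.1 hh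
  obtain ⟨r, h1, h2⟩ := normal_form (m := m) h0 g
  have e : g * f + i = f * r + (i + f * (g - r)) := by ring
  have hi' : i + f * (g - r) ∈ Ideal.span B := Ideal.add_mem _ hi (Ideal.mul_mem_left _ _ h1)
  rw [e] at hne ⊢
  generalize i + f * (g - r) = j at *
  by_cases hr : r = 0
  · subst hr
    simp only [mul_zero, zero_add] at hne ⊢
    obtain ⟨b, hb, hle⟩ := hB j hi' hne
    exact ⟨b, Or.inr hb, hle⟩
  by_cases hj : j = 0
  · subst hj
    refine ⟨f, Or.inl rfl, ?_⟩
    rw [add_zero, m.degree_mul hf hr]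
    exact le_self_add
  obtain ⟨b, hb, hle⟩ := hB j hi' hj
  have hnd : m.degree (f * r) ≠ m.degree j := by
    intro hE
    rw [← hE, m.degree_mul hf hr] at hle
    exact h2 _ (m.degree_mem_support hr) b hb (le_of_disj (hd b hb) hle)
  rcases lt_or_gt_of_ne (fun h => hnd (m.toSyn.injective h)) with hlt | hlt
  · refine ⟨b, Or.inr hb, ?_⟩
    rwa [m.degree_add_eq_right_of_lt hlt]
  · refine ⟨f, Or.inl rfl, ?_⟩
    rw [m.degree_add_of_lt hlt, m.degree_mul hf hr]
    exact le_self_add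

theorem gb_list (rs : List (MvPolynomial σ K)) (h0 : ∀ b ∈ rs, b ≠ 0)
    (hp : rs.Pairwise fun a b => Disjoint (m.degree a) (m.degree b)) :
    RingTheory.Sequence.IsWeaklyRegular (MvPolynomial σ K) rs := by
  rw [wr_iff]
  have hd : ∀ (i : ℕ) (h : i < rs.length), ∀ b ∈ {f | f ∈ rs.take i},
      Disjoint (m.degree b) (m.degree rs[i]) := by
    intro i hi b hb
    obtain ⟨j, hj, rfl⟩ := List.mem_iff_getElem.1 hb
    rw [List.getElem_take]
    rw [List.length_take] at hj
    exact List.pairwise_iff_getElem.1 hp j i (by omega) hi (by omega)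
  have h0' : ∀ i, ∀ b ∈ {f | f ∈ rs.take i}, b ≠ 0 := fun i b hb => h0 b (List.mem_of_mem_take hb)
  have key : ∀ i, i ≤ rs.length → IsGB m {f | f ∈ rs.take i} := by
    intro i
    induction i with
    | zero =>
      intro _ h hh hne
      simp at hh
      exact absurd hh hne
    | succ i ih =>
      intro hi
      have hi' : i < rs.length := hi
      have := gb_insert (h0' i) (ih hi'.le) (h0 rs[i] (List.getElem_mem _)) (hd i hi')
      convert this using 1
      ext x
      simp only [Set.mem_ofPred_eq, Set.mem_insert_iff]
      rw [mem_take_succ rs i hi', or_comm]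
  intro i hi g hg
  exact gb_regular (h0' i) (key i hi.le) (h0 rs[i] (List.getElem_mem _)) (hd i hi) g hg

end GB

section Order

theorem exists_order {σ K : Type} [Field K] [Finite σ] (q : σ → ℕ) :
    ∃ m : MonomialOrder.{0, 0} σ, ∀ a b c d : σ, q a < q c → q a < q d → ∀ s t : K, s ≠ 0 →
      m.degree (monomial (Finsupp.single a 1 + Finsupp.single b 1) s +
        monomial (Finsupp.single c 1 + Finsupp.single d 1) t) =
        Finsupp.single a 1 + Finsupp.single b 1 := by
  classical
  obtain ⟨N, ⟨e⟩⟩ := Finite.exists_equiv_fin σ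
  let key : σ → ℕ ×ₗ Fin N := fun s => toLex (q s, e s)
  have hkey : Function.Injective key := by
    intro s t h
    have := congrArg (fun z => (ofLex z).2) h
    exact e.injective this
  let _ : LinearOrder σ := LinearOrder.lift' key hkey
  have hlt : ∀ a c : σ, q a < q c → a < c := by
    intro a c h
    change key a < key c
    exact Prod.Lex.toLex_lt_toLex.2 (Or.inl h)
  have : WellFoundedGT σ := Finite.to_wellFoundedGT
  refine ⟨MonomialOrder.lex, ?_⟩
  intro a b c d hac had s t hs
  have h1 : MonomialOrder.lex.degree
      (monomial (Finsupp.single a 1 + Finsupp.single b 1) s) =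
        Finsupp.single a 1 + Finsupp.single b 1 := by
    rw [MonomialOrder.degree_monomial, if_neg hs]
  have h2 := MonomialOrder.degree_monomial_le (m := MonomialOrder.lex)
    (d := Finsupp.single c 1 + Finsupp.single d 1) t
  rw [MonomialOrder.degree_add_of_lt, h1]
  rw [h1]
  refine lt_of_le_of_lt h2 ?_
  rw [MonomialOrder.lex_lt_iff, Finsupp.Lex.lt_iff]
  have hac' := hlt _ _ hac
  have had' := hlt _ _ had
  have key1 : ∀ i, i ≤ a → (Finsupp.single c 1 + Finsupp.single d 1 : σ →₀ ℕ) i = 0 := by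
    intro i hi
    simp [Finsupp.single_apply, (lt_of_le_of_lt hi hac').ne', (lt_of_le_of_lt hi had').ne']
  rcases le_total a b with hab | hab
  · refine ⟨a, ?_, ?_⟩
    · intro i hi
      simp only [ofLex_toLex]
      rw [key1 i hi.le]
      simp [Finsupp.single_apply, hi.ne', (lt_of_lt_of_le hi hab).ne']
    · simp only [ofLex_toLex]
      rw [key1 a le_rfl]
      simp
  · refine ⟨b, ?_, ?_⟩
    · intro i hi
      simp only [ofLex_toLex]
      rw [key1 i (hi.le.trans hab)]
      simp [Finsupp.single_apply, hi.ne', (lt_of_lt_of_le hi hab).ne']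
    · simp only [ofLex_toLex]
      rw [key1 b hab]
      simp

end Order

theorem disj_single {σ : Type*} {a b c d : σ} (h1 : a ≠ c) (h2 : a ≠ d) (h3 : b ≠ c)
    (h4 : b ≠ d) : Disjoint (Finsupp.single a 1 + Finsupp.single b 1 : σ →₀ ℕ)
      (Finsupp.single c 1 + Finsupp.single d 1) := by
  classical
  rw [disjoint_iff]
  ext i
  change min _ _ = 0
  simp only [Finsupp.add_apply, Finsupp.single_apply]
  by_cases ha : a = i
  · subst ha; simp [h1.symm, h2.symm]
  · by_cases hb : b = i
    · subst hb; simp [h3.symm, h4.symm]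
    · simp [ha, hb]

section Edge
variable {K V : Type} [Field K]

/-- edge polynomial -/
noncomputable def eP (ε : K) : Sym2 V → MvPolynomial (V ⊕ V) K :=
  Sym2.lift ⟨fun i j => X (Sum.inl i) * X (Sum.inl j) - C ε * (X (Sum.inr i) * X (Sum.inr j)),
    fun i j => by ring⟩

theorem eP_mk (ε : K) (i j : V) : eP ε s(i, j) =
    X (Sum.inl i) * X (Sum.inl j) - C ε * (X (Sum.inr i) * X (Sum.inr j)) := rfl

noncomputable def eIdeal (ε : K) (G : SimpleGraph V) : Ideal (MvPolynomial (V ⊕ V) K) :=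
  Ideal.span (eP ε '' G.edgeSet)

theorem eP_mono (ε : K) (i j : V) : eP ε s(i, j) =
    monomial (Finsupp.single (Sum.inl i) 1 + Finsupp.single (Sum.inl j) 1) 1 +
    monomial (Finsupp.single (Sum.inr i) 1 + Finsupp.single (Sum.inr j) 1) (-ε) := by
  rw [eP_mk, sub_eq_add_neg]
  congr 1
  · simp [X, monomial_mul]
  · simp [X, monomial_mul, C_mul_monomial]

theorem eP_homog (ε : K) (e : Sym2 V) : (eP ε e).IsHomogeneous 2 := by
  induction e with
  | _ i j =>
    rw [eP_mono]
    refine IsHomogeneous.add ?_ ?_ <;> apply isHomogeneous_monomial <;>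
      simp [Finsupp.degree_single]

theorem eIdeal_le (ε : K) (G : SimpleGraph V) (I : Ideal (MvPolynomial (V ⊕ V) K))
    (h : ∀ i j, G.Adj i j → eP ε s(i, j) ∈ I) : eIdeal ε G ≤ I := by
  rw [eIdeal, Ideal.span_le]
  rintro _ ⟨e, he, rfl⟩
  induction e with
  | _ i j => exact h i j he

theorem mem_eIdeal (ε : K) (G : SimpleGraph V) {i j : V} (h : G.Adj i j) :
    eP ε s(i, j) ∈ eIdeal ε G := Ideal.subset_span ⟨s(i, j), h, rfl⟩

theorem ker0_eq (ε : K) (e : Sym2 V) :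
    eP ε e ∈ RingHom.ker (MvPolynomial.eval (0 : V ⊕ V → K)) := by
  induction e with
  | _ i j => simp [RingHom.mem_ker, eP_mk]

theorem ci_of_pos [Fintype V] (ε : K) (hε : ε ≠ 0) (G : SimpleGraph V)
    (hbip : IsBipartiteGraph G) (p : V → ℕ)
    (h1 : ∀ u v, G.Adj u v → p u + 1 = p v ∨ p v + 1 = p u)
    (h2 : ∀ u v w, G.Adj u v → G.Adj u w → p v = p w → v = w) :
    IsCompleteIntersectionIdeal (eIdeal ε G) := by
  classical
  obtain ⟨A, hA⟩ := hbip
  let rs := G.edgeFinset.toList.map (eP ε)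
  have hspan : {f | f ∈ rs} = eP ε '' G.edgeSet := by
    ext f; simp [rs]
  refine ⟨rs, ?_, ⟨?_, ?_⟩, ?_⟩
  · intro f hf
    obtain ⟨e, -, rfl⟩ := List.mem_map.1 hf
    exact ⟨2, eP_homog ε e⟩
  · let q : V ⊕ V → ℕ := Sum.elim (fun v => if v ∈ A then p v else p v + 1)
      (fun v => if v ∈ A then p v + 1 else p v)
    let gd : V → V ⊕ V := fun v => if v ∈ A then Sum.inl v else Sum.inr v
    let bd : V → V ⊕ V := fun v => if v ∈ A then Sum.inr v else Sum.inl v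
    obtain ⟨m, hm⟩ := exists_order (K := K) q
    have hdeg : ∀ u v, G.Adj u v → p u + 1 = p v → m.degree (eP ε s(u, v)) =
        Finsupp.single (gd u) 1 + Finsupp.single (bd v) 1 := by
      intro u v huv hp
      have := hA u v huv
      by_cases hu : u ∈ A
      · have hv : v ∉ A := this.1 hu
        rw [eP_mono, hm _ _ _ _ _ _ _ _ one_ne_zero]
        · simp [gd, bd, hu, hv]
        · simp [q, hu]
        · simp [q, hu, hv]; omega
      · have hv : v ∈ A := by by_contra h; exact hu (this.2 h)
        rw [eP_mono, add_comm, hm _ _ _ _ _ _ _ _ (neg_ne_zero.2 hε)]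
        · simp [gd, bd, hu, hv]
        · simp [q, hu]
        · simp [q, hu, hv]; omega
    have hex : ∀ e ∈ G.edgeSet, ∃ u v, G.Adj u v ∧ p u + 1 = p v ∧ e = s(u, v) := by
      intro e he
      induction e with
      | _ i j =>
        rcases h1 i j he with h | h
        · exact ⟨i, j, he, h, rfl⟩
        · exact ⟨j, i, he.symm, h, Sym2.eq_swap⟩
    apply gb_list (m := m)
    · intro b hb
      obtain ⟨e, he, rfl⟩ := List.mem_map.1 hb
      obtain ⟨u, v, huv, hp, rfl⟩ := hex e (by simpa using he)
      apply m.ne_zero_of_degree_ne_zero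
      rw [hdeg u v huv hp]
      intro h
      have := DFunLike.congr_fun h (gd u)
      simp at this
    · rw [List.pairwise_map]
      refine List.Nodup.pairwise_of_forall_ne (Finset.nodup_toList _) ?_
      intro e he e' he' hne
      obtain ⟨u, v, huv, hp, rfl⟩ := hex e (by simpa using he)
      obtain ⟨u', v', huv', hp', rfl⟩ := hex e' (by simpa using he')
      rw [hdeg u v huv hp, hdeg u' v' huv' hp']
      have hgg : gd u ≠ gd u' := by
        intro h
        have : u = u' := by
          simp only [gd] at h
          split_ifs at h <;> simpa using h
        subst this
        exact hne (by rw [h2 u v v' huv huv' (by omega)])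
      have hbb : bd v ≠ bd v' := by
        intro h
        have : v = v' := by
          simp only [bd] at h
          split_ifs at h <;> simpa using h
        subst this
        exact hne (by rw [h2 v u u' huv.symm huv'.symm (by omega)])
      have hgb : ∀ x y, gd x ≠ bd y := by
        intro x y h
        simp only [gd, bd] at h
        split_ifs at h <;> simp at h <;> simp_all
      exact disj_single hgg (hgb _ _) (hgb _ _).symm hbb
  · intro h
    have hle : (Ideal.ofList rs • ⊤ : Ideal (MvPolynomial (V ⊕ V) K)) ≤
        RingHom.ker (MvPolynomial.eval (0 : V ⊕ V → K)) := by
      rw [Ideal.smul_eq_mul, Ideal.mul_top, Ideal.ofList, Ideal.span_le]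
      intro f hf
      obtain ⟨e, -, rfl⟩ := List.mem_map.1 hf
      exact ker0_eq ε e
    rw [← h] at hle
    have : (1 : MvPolynomial (V ⊕ V) K) ∈ RingHom.ker (MvPolynomial.eval (0 : V ⊕ V → K)) :=
      hle trivial
    simp [RingHom.mem_ker] at this
  · rw [hspan]; rfl

theorem pos_of_paths (G : SimpleGraph V) (h : IsDisjointUnionOfPaths G) :
    ∃ p : V → ℕ, (∀ u v, G.Adj u v → p u + 1 = p v ∨ p v + 1 = p u) ∧
      (∀ u v w, G.Adj u v → G.Adj u w → p v = p w → v = w) := by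
  choose m φ using h
  let φ' := fun c => (φ c).some
  let p : V → ℕ := fun v => (φ' (G.connectedComponentMk v) ⟨v, rfl⟩).val
  have hp : ∀ c v (hv : v ∈ c.supp), p v = (φ' c ⟨v, hv⟩).val := by
    intro c v hv
    have hv' : G.connectedComponentMk v = c := hv
    subst hv'
    rfl
  have hadj : ∀ {u v}, G.Adj u v → v ∈ (G.connectedComponentMk u).supp := by
    intro u v huv
    exact (SimpleGraph.ConnectedComponent.sound huv.symm.reachable)
  refine ⟨p, ?_, ?_⟩
  · intro u v huv
    rw [hp _ u rfl, hp _ v (hadj huv)]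
    rw [← SimpleGraph.pathGraph_adj, (φ' _).map_adj_iff]
    simpa using huv
  · intro u v w huv huw hvw
    rw [hp _ v (hadj huv), hp _ w (hadj huw)] at hvw
    simpa using (φ' _).injective (Fin.ext hvw)

end Edge

section Nec
variable {K V : Type} [Field K]

/-- exponent of an edge -/
noncomputable def exS : Sym2 V → (V ⊕ V →₀ ℕ) :=
  Sym2.lift ⟨fun i j => Finsupp.single (Sum.inl i) 1 + Finsupp.single (Sum.inl j) 1,
    fun i j => add_comm _ _⟩

theorem exS_mk (i j : V) :
    exS s(i, j) = Finsupp.single (Sum.inl i) 1 + Finsupp.single (Sum.inl j) 1 := rfl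

theorem exS_degree (e : Sym2 V) : (exS e).degree = 2 := by
  induction e with
  | _ i j => simp [exS_mk, Finsupp.degree_single]

theorem exS_inj (e e' : Sym2 V) (h : exS e = exS e') : e = e' := by
  classical
  induction e with
  | _ i j =>
  induction e' with
  | _ k l =>
    rw [exS_mk, exS_mk] at h
    have hi := DFunLike.congr_fun h (Sum.inl i)
    have hj := DFunLike.congr_fun h (Sum.inl j)
    have hk := DFunLike.congr_fun h (Sum.inl k)
    have hl := DFunLike.congr_fun h (Sum.inl l)
    simp only [Finsupp.add_apply, Finsupp.single_apply, Sum.inl.injEq] at hi hj hk hl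
    rw [Sym2.eq_iff]
    grind

theorem coeff_eP (ε : K) (e e' : Sym2 V) :
    coeff (exS e) (eP ε e') = coeff (exS e) (monomial (exS e') (1 : K)) := by
  classical
  induction e' with
  | _ i j =>
    rw [eP_mono, ← exS_mk, coeff_add]
    have h2 : ¬ (Finsupp.single (Sum.inr i : V ⊕ V) 1 + Finsupp.single (Sum.inr j) 1 = exS e) := by
      intro h
      induction e with
      | _ k l =>
        have := DFunLike.congr_fun h (Sum.inl k)
        simp [exS_mk] at this
        omega
    have h3 : coeff (exS e) (monomial
        (Finsupp.single (Sum.inr i : V ⊕ V) 1 + Finsupp.single (Sum.inr j) 1) (-ε)) = 0 := by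
      rw [coeff_monomial, if_neg h2]
    rw [h3, add_zero]

theorem low_coeff (ε : K) (G : SimpleGraph V) (r : MvPolynomial (V ⊕ V) K)
    (hr : r ∈ eIdeal ε G) (d : V ⊕ V →₀ ℕ) (hd : d.degree < 2) : coeff d r = 0 := by
  classical
  induction hr using Submodule.span_induction generalizing d with
  | mem x hx =>
    obtain ⟨e, -, rfl⟩ := hx
    exact (eP_homog ε e).coeff_eq_zero (by omega)
  | zero => simp
  | add x y _ _ h1 h2 => rw [coeff_add, h1 d hd, h2 d hd, add_zero]
  | smul a x _ h =>
    rw [smul_eq_mul, coeff_mul]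
    refine Finset.sum_eq_zero fun z hz => ?_
    rw [Finset.HasAntidiagonal.mem_antidiagonal] at hz
    rw [h z.2, mul_zero]
    rw [← hz, map_add] at hd
    omega

theorem coeff_mul_low (ε : K) (G : SimpleGraph V) (r : MvPolynomial (V ⊕ V) K)
    (hr : r ∈ eIdeal ε G) (g : MvPolynomial (V ⊕ V) K) (d : V ⊕ V →₀ ℕ) (hd : d.degree = 2) :
    coeff d (g * r) = coeff 0 g * coeff d r := by
  classical
  rw [coeff_mul, Finset.sum_eq_single (0, d)]
  · rintro ⟨a, b⟩ hz hne
    rw [Finset.HasAntidiagonal.mem_antidiagonal] at hz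
    simp only at hz
    rw [low_coeff ε G r hr b, mul_zero]
    have ha : a.degree ≠ 0 := by
      intro ha
      rw [Finsupp.degree_eq_zero_iff] at ha
      subst ha
      rw [zero_add] at hz
      exact hne (by rw [hz])
    rw [← hz, map_add] at hd
    omega
  · intro h
    simp at h

theorem card_le_length [Fintype V] (ε : K) (G : SimpleGraph V) [Fintype G.edgeSet]
    (rs : List (MvPolynomial (V ⊕ V) K)) (h : eIdeal ε G = Ideal.span {f | f ∈ rs}) :
    G.edgeFinset.card ≤ rs.length := by
  classical
  let Φ : MvPolynomial (V ⊕ V) K →ₗ[K] (G.edgeFinset → K) :=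
    LinearMap.pi fun e => MvPolynomial.lcoeff K (exS e.1)
  have hΦ : ∀ p e, Φ p e = coeff (exS e.1) p := fun p e => rfl
  have hmul : ∀ g r, r ∈ eIdeal ε G → Φ (g * r) = coeff 0 g • Φ r := by
    intro g r hr
    ext e
    rw [hΦ, coeff_mul_low ε G r hr g _ (exS_degree _)]
    rfl
  have hmem : ∀ f ∈ Ideal.span {f | f ∈ rs},
      Φ f ∈ Submodule.span K (((rs.map Φ).toFinset : Finset _) : Set (G.edgeFinset → K)) := by
    intro f hf
    induction hf using Submodule.span_induction with
    | mem x hx =>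
      apply Submodule.subset_span
      simp only [List.coe_toFinset, List.mem_map, Set.mem_ofPred_eq]
      exact ⟨x, hx, rfl⟩
    | zero => rw [map_zero]; exact Submodule.zero_mem _
    | add x y _ _ h1 h2 => rw [map_add]; exact Submodule.add_mem _ h1 h2
    | smul a x hx h1 =>
      rw [smul_eq_mul, hmul a x (by rw [h]; exact hx)]
      exact Submodule.smul_mem _ _ h1
  have htop : Submodule.span K (((rs.map Φ).toFinset : Finset _) : Set (G.edgeFinset → K)) = ⊤ := by
    rw [eq_top_iff, ← (Pi.basisFun K G.edgeFinset).span_eq, Submodule.span_le]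
    rintro _ ⟨e, rfl⟩
    have : Pi.basisFun K G.edgeFinset e = Φ (eP ε e.1) := by
      ext e'
      rw [hΦ, coeff_eP, Pi.basisFun_apply, Pi.single_apply, coeff_monomial]
      by_cases h : e' = e
      · rw [if_pos h, h, if_pos rfl]
      · rw [if_neg h, if_neg]
        intro h'
        exact h (Subtype.ext (exS_inj _ _ h').symm)
    rw [this]
    apply hmem
    rw [← h]
    exact Ideal.subset_span ⟨e.1, SimpleGraph.mem_edgeFinset.1 e.2, rfl⟩
  have h1 := finrank_span_finset_le_card (R := K) (rs.map Φ).toFinset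
  rw [Set.finrank, htop, finrank_top, Module.finrank_pi] at h1
  have h2 := List.toFinset_card_le (rs.map Φ)
  rw [List.length_map] at h2
  simp only [Fintype.card_coe] at h1
  omega

theorem card_le_of_prime [Fintype V] (ε : K) (G : SimpleGraph V) [Fintype G.edgeSet]
    (hci : IsCompleteIntersectionIdeal (eIdeal ε G)) (T : Finset (MvPolynomial (V ⊕ V) K))
    (Q : Ideal (MvPolynomial (V ⊕ V) K)) (hQ : Q ∈ (Ideal.span (T : Set _)).minimalPrimes)
    (hle : eIdeal ε G ≤ Q) : G.edgeFinset.card ≤ T.card := by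
  obtain ⟨rs, -, hreg, hspan⟩ := hci
  have h1 := card_le_length ε G rs hspan
  have h2 := height_ge rs hreg.1 rs.length le_rfl Q hQ.isPrime
    (by rw [List.take_length, ← hspan]; exact hle)
  have h3 := Ideal.height_le_card_of_mem_minimalPrimes_span_finset hQ
  have h4 := h2.trans h3
  have : rs.length ≤ T.card := by exact_mod_cast h4
  omega

theorem ker_prime (x : V ⊕ V → K) :
    (RingHom.ker (MvPolynomial.eval x)).IsPrime := RingHom.ker_isPrime _

theorem degree_le_two [Fintype V] [DecidableEq V] (ε : K) (G : SimpleGraph V) [DecidableRel G.Adj]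
    (hci : IsCompleteIntersectionIdeal (eIdeal ε G)) (v : V) : G.degree v ≤ 2 := by
  classical
  let T : Finset (MvPolynomial (V ⊕ V) K) :=
    {X (Sum.inl v), X (Sum.inr v)} ∪ (G.edgeFinset \ G.incidenceFinset v).image (eP ε)
  have hTker : Ideal.span (T : Set _) ≤ RingHom.ker (MvPolynomial.eval (0 : V ⊕ V → K)) := by
    rw [Ideal.span_le]
    intro f hf
    simp only [T, Finset.coe_union, Finset.coe_image, Finset.coe_insert, Finset.coe_singleton,
      Set.mem_union, Set.mem_insert_iff, Set.mem_singleton_iff, Set.mem_image] at hf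
    rcases hf with (rfl | rfl) | ⟨e, -, rfl⟩
    · simp [RingHom.mem_ker]
    · simp [RingHom.mem_ker]
    · exact ker0_eq ε e
  have := ker_prime (K := K) (V := V) 0
  obtain ⟨Q, hQ, -⟩ := Ideal.exists_minimalPrimes_le hTker
  have hTQ : ∀ f ∈ T, f ∈ Q := fun f hf => hQ.1.2 (Ideal.subset_span hf)
  have hx : X (Sum.inl v) ∈ Q := hTQ _ (by simp [T])
  have hy : X (Sum.inr v) ∈ Q := hTQ _ (by simp [T])
  have hv : ∀ w, eP ε s(v, w) ∈ Q := by
    intro w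
    rw [eP_mk]
    exact Ideal.sub_mem _ (Ideal.mul_mem_right _ _ hx)
      (Ideal.mul_mem_left _ _ (Ideal.mul_mem_right _ _ hy))
  have hle : eIdeal ε G ≤ Q := by
    apply eIdeal_le
    intro i j hij
    by_cases hi : i = v
    · subst hi; exact hv j
    by_cases hj : j = v
    · subst hj; rw [Sym2.eq_swap]; exact hv i
    apply hTQ
    apply Finset.mem_union_right
    apply Finset.mem_image_of_mem
    rw [Finset.mem_sdiff]
    refine ⟨by simpa using hij, ?_⟩
    rw [SimpleGraph.mem_incidenceFinset]
    intro h
    have := h.2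
    rw [Sym2.mem_iff] at this
    rcases this with h | h
    · exact hi h.symm
    · exact hj h.symm
  have h1 := card_le_of_prime ε G hci T Q hQ hle
  have h2 : T.card ≤ 2 + (G.edgeFinset \ G.incidenceFinset v).card :=
    (Finset.card_union_le _ _).trans (add_le_add Finset.card_le_two Finset.card_image_le)
  rw [Finset.card_sdiff_of_subset (G.incidenceFinset_subset v),
    SimpleGraph.card_incidenceFinset_eq_degree] at h2
  have h3 := Finset.card_le_card (G.incidenceFinset_subset v)
  rw [SimpleGraph.card_incidenceFinset_eq_degree] at h3
  omega

theorem acyclic [Fintype V] (ε : K) (hε : ε ≠ 0) (G : SimpleGraph V) (hbip : IsBipartiteGraph G)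
    (hci : IsCompleteIntersectionIdeal (eIdeal ε G)) : G.IsAcyclic := by
  classical
  rw [SimpleGraph.isAcyclic_iff_forall_adj_isBridge]
  intro a b hab
  rw [SimpleGraph.isBridge_iff]
  rintro ⟨W⟩
  obtain ⟨A, hA⟩ := hbip
  let T : Finset (MvPolynomial (V ⊕ V) K) := (G.edgeFinset.erase s(a, b)).image (eP ε)
  let pt : V ⊕ V → K := Sum.elim (fun _ => 1) (fun v => if v ∈ A then 1 else ε⁻¹)
  have hTker : Ideal.span (T : Set _) ≤ RingHom.ker (MvPolynomial.eval pt) := by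
    rw [Ideal.span_le]
    intro f hf
    simp only [T, Finset.coe_image, Set.mem_image] at hf
    obtain ⟨e, he, rfl⟩ := hf
    induction e with
    | _ i j =>
      have hij : G.Adj i j := by simpa using (Finset.mem_erase.1 he).2
      have := hA i j hij
      by_cases hi : i ∈ A
      · have hj := this.1 hi
        simp [RingHom.mem_ker, eP_mk, pt, hi, hj, hε]
      · have hj : j ∈ A := by by_contra h; exact hi (this.2 h)
        simp [RingHom.mem_ker, eP_mk, pt, hi, hj, hε]
  have := ker_prime (K := K) pt
  obtain ⟨Q, hQ, hQP⟩ := Ideal.exists_minimalPrimes_le hTker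
  have hQp : Q.IsPrime := hQ.isPrime
  have hTQ : ∀ f ∈ T, f ∈ Q := fun f hf => hQ.1.2 (Ideal.subset_span hf)
  have hX : ∀ s, X s ∉ Q := by
    intro s hs
    have := hQP hs
    rw [RingHom.mem_ker, eval_X] at this
    rcases s with s | s
    · simp [pt] at this
    · simp only [pt, Sum.elim_inr] at this
      split_ifs at this <;> simp_all
  have hedge : ∀ u w, (G.deleteEdges {s(a, b)}).Adj u w → eP ε s(u, w) ∈ Q := by
    intro u w huw
    rw [SimpleGraph.deleteEdges_adj] at huw
    apply hTQ
    apply Finset.mem_image_of_mem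
    rw [Finset.mem_erase]
    exact ⟨huw.2, by simpa using huw.1⟩
  have hwalk : ∀ u v (_ : (G.deleteEdges {s(a, b)}).Walk u v),
      ((u ∈ A ↔ v ∈ A) → X (Sum.inl u) * X (Sum.inr v) - X (Sum.inl v) * X (Sum.inr u) ∈ Q) ∧
      (¬ (u ∈ A ↔ v ∈ A) → eP ε s(u, v) ∈ Q) := by
    intro u v W
    induction W with
    | nil => simp
    | @cons u w v huw W ih =>
      have he := hedge _ _ huw
      have hA' := hA u w ((SimpleGraph.deleteEdges_adj.1 huw).1)
      refine ⟨fun h => ?_, fun h => ?_⟩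
      · have h' : ¬ (w ∈ A ↔ v ∈ A) := by tauto
        have h1 := ih.2 h'
        rw [eP_mk] at h1 he
        have : X (Sum.inl w) *
            (X (Sum.inl u) * X (Sum.inr v) - X (Sum.inl v) * X (Sum.inr u)) ∈ Q := by
          have := Ideal.sub_mem _ (Ideal.mul_mem_left _ (X (Sum.inr v)) he)
            (Ideal.mul_mem_left _ (X (Sum.inr u)) h1)
          convert this using 1
          ring
        exact (hQp.mem_or_mem this).resolve_left (hX _)
      · have h' : (w ∈ A ↔ v ∈ A) := by tauto
        have h1 := ih.1 h'
        rw [eP_mk] at he ⊢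
        have : X (Sum.inr w) *
            (X (Sum.inl u) * X (Sum.inl v) - C ε * (X (Sum.inr u) * X (Sum.inr v))) ∈ Q := by
          have := Ideal.sub_mem _ (Ideal.mul_mem_left _ (X (Sum.inr v)) he)
            (Ideal.mul_mem_left _ (X (Sum.inl u)) h1)
          convert this using 1
          ring
        exact (hQp.mem_or_mem this).resolve_left (hX _)
  have hle : eIdeal ε G ≤ Q := by
    apply eIdeal_le
    intro i j hij
    by_cases h : s(i, j) = s(a, b)
    · rw [h]
      have := hA a b hab
      exact (hwalk a b W).2 (by tauto)
    · exact hedge i j (SimpleGraph.deleteEdges_adj.2 ⟨hij, h⟩)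
  have h1 := card_le_of_prime ε G hci T Q hQ hle
  have h2 : T.card ≤ (G.edgeFinset.erase s(a, b)).card := Finset.card_image_le
  have h3 := Finset.card_erase_lt_of_mem (a := s(a, b)) (s := G.edgeFinset) (by simpa using hab)
  omega

end Nec

section Comb
open SimpleGraph

theorem path_iso {W : Type} [Finite W] (H : SimpleGraph W) (hc : H.Connected) (hac : H.IsAcyclic)
    (hdeg : ∀ v a b c, H.Adj v a → H.Adj v b → H.Adj v c → a = b ∨ a = c ∨ b = c) :
    ∃ m : ℕ, Nonempty (H ≃g pathGraph m) := by
  classical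
  have := Fintype.ofFinite W
  have := hc.nonempty
  obtain ⟨u, v, p, hp, hmax⟩ := Walk.exists_isPath_forall_isPath_length_le_length H
  have hinj : ∀ i j, i ≤ p.length → j ≤ p.length → p.getVert i = p.getVert j → i = j :=
    fun i j hi hj h => hp.getVert_injOn hi hj h
  have hadj : ∀ i, i < p.length → H.Adj (p.getVert i) (p.getVert (i + 1)) :=
    fun i hi => p.adj_getVert_succ hi
  have hsurj : ∀ w, w ∈ p.support := by
    by_contra! hcon
    obtain ⟨w, hw⟩ := hcon
    obtain ⟨q⟩ := hc.preconnected u w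
    obtain ⟨d, -, hd1, hd2⟩ := q.exists_boundary_dart {x | x ∈ p.support} p.start_mem_support hw
    simp only [Set.mem_ofPred_eq] at hd1 hd2
    obtain ⟨i, hi, hile⟩ := Walk.mem_support_iff_exists_getVert.1 hd1
    have hda := d.adj
    have hne : ∀ k, d.snd ≠ p.getVert k := by
      intro k hk
      rw [hk] at hd2
      exact hd2 (p.getVert_mem_support k)
    rcases Nat.eq_zero_or_pos i with h0 | hpos
    · subst h0
      rw [Walk.getVert_zero] at hi
      have hda' : H.Adj d.snd u := by rw [hi]; exact hda.symm
      have := hmax _ _ (Walk.cons hda' p) (hp.cons hd2)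
      simp at this
    · rcases Nat.lt_or_ge i p.length with hlt | hge
      · rw [← hi] at hda
        have h1 := hadj (i - 1) (by omega)
        rw [Nat.sub_add_cancel hpos] at h1
        rcases hdeg _ _ _ _ hda h1.symm (hadj i hlt) with h | h | h
        · exact hne _ h
        · exact hne _ h
        · have := hinj _ _ (by omega) (by omega) h
          omega
      · have : i = p.length := le_antisymm hile hge
        subst this
        rw [Walk.getVert_length] at hi
        have hda' : H.Adj d.snd v := by rw [hi]; exact hda.symm
        have := hmax _ _ (Walk.cons hda' p.reverse) (hp.reverse.cons (by simpa using hd2))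
        simp at this
  have hchord : ∀ i j, i < j → j ≤ p.length → H.Adj (p.getVert i) (p.getVert j) → i + 1 = j := by
    intro i j hij hj ha
    by_contra hne
    have hb := isAcyclic_iff_forall_adj_isBridge.1 hac ha
    rw [isBridge_iff] at hb
    apply hb
    have : ∀ k, i ≤ k → k ≤ j → (H.deleteEdges {s(p.getVert i, p.getVert j)}).Reachable
        (p.getVert i) (p.getVert k) := by
      intro k hk
      induction k, hk using Nat.le_induction with
      | base => intro _; exact Reachable.refl _
      | succ k hk ih =>
        intro hkj
        refine (ih (by omega)).trans (Adj.reachable ?_)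
        rw [deleteEdges_adj]
        refine ⟨hadj k (by omega), ?_⟩
        rw [Set.mem_singleton_iff, Sym2.eq_iff]
        rintro (⟨h1, h2⟩ | ⟨h1, h2⟩)
        · have := hinj _ _ (by omega) (by omega) h1
          have := hinj _ _ (by omega) (by omega) h2
          omega
        · have := hinj _ _ (by omega) (by omega) h1
          omega
    exact this j hij.le le_rfl
  let f : Fin (p.length + 1) → W := fun i => p.getVert i
  have hf : Function.Bijective f := by
    constructor
    · intro i j h
      exact Fin.ext (hinj _ _ (by omega) (by omega) h)
    · intro w
      obtain ⟨i, hi, hile⟩ := Walk.mem_support_iff_exists_getVert.1 (hsurj w)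
      exact ⟨⟨i, by omega⟩, hi⟩
  refine ⟨p.length + 1, ⟨RelIso.symm ⟨Equiv.ofBijective f hf, ?_⟩⟩⟩
  intro i j
  rw [pathGraph_adj]
  change H.Adj (p.getVert i) (p.getVert j) ↔ _
  constructor
  · intro h
    rcases lt_trichotomy i.val j.val with hlt | heq | hlt
    · exact Or.inl (hchord _ _ hlt (by omega) h)
    · rw [heq] at h
      exact absurd h (H.irrefl)
    · exact Or.inr (hchord _ _ hlt (by omega) h.symm)
  · rintro (h | h)
    · have := hadj i.val (by omega)
      rwa [h] at this
    · have := hadj j.val (by omega)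
      rw [h] at this
      exact this.symm

theorem paths_of {V : Type} [Fintype V] (G : SimpleGraph V) [DecidableRel G.Adj]
    (hac : G.IsAcyclic) (hdeg : ∀ v, G.degree v ≤ 2) : IsDisjointUnionOfPaths G := by
  classical
  intro c
  refine path_iso _ c.connected_toSimpleGraph (hac.induce _) ?_
  intro v x y z hx hy hz
  by_contra! hcon
  obtain ⟨h1, h2, h3⟩ := hcon
  have hsub : ({x.1, y.1, z.1} : Finset V) ⊆ G.neighborFinset v.1 := by
    intro w hw
    simp only [Finset.mem_insert, Finset.mem_singleton] at hw
    rw [mem_neighborFinset]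
    rcases hw with rfl | rfl | rfl
    · exact hx
    · exact hy
    · exact hz
  have := Finset.card_le_card hsub
  rw [card_neighborFinset_eq_degree, Finset.card_eq_three.2
    ⟨x.1, y.1, z.1, fun h => h1 (Subtype.ext h), fun h => h2 (Subtype.ext h),
      fun h => h3 (Subtype.ext h), rfl⟩] at this
  have := hdeg v.1
  omega

end Comb

theorem ci_iff {K V : Type} [Field K] [Fintype V] (ε : K) (hε : ε ≠ 0) (G : SimpleGraph V)
    (hbip : IsBipartiteGraph G) :
    IsCompleteIntersectionIdeal (eIdeal ε G) ↔ IsDisjointUnionOfPaths G := by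
  classical
  constructor
  · intro h
    exact paths_of G (acyclic ε hε G hbip h) (degree_le_two ε G h)
  · intro h
    obtain ⟨p, h1, h2⟩ := pos_of_paths G h
    exact ci_of_pos ε hε G hbip p h1 h2

end LSSAux

theorem LSSAux.lss_eq (K : Type) [Field K] {V : Type} (G : SimpleGraph V) :
    lssIdeal K G = LSSAux.eIdeal (-1 : K) G := by
  unfold lssIdeal LSSAux.eIdeal
  congr 1
  ext f
  constructor
  · rintro ⟨i, j, h, rfl⟩
    refine ⟨s(i, j), h, ?_⟩
    rw [LSSAux.eP_mk]; simp
  · rintro ⟨e, he, rfl⟩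
    induction e with
    | _ i j =>
      refine ⟨i, j, he, ?_⟩
      rw [LSSAux.eP_mk]; simp

theorem LSSAux.parity_eq (K : Type) [Field K] {V : Type} (G : SimpleGraph V) :
    parityBinomialEdgeIdeal K G = LSSAux.eIdeal (1 : K) G := by
  unfold parityBinomialEdgeIdeal LSSAux.eIdeal
  congr 1
  ext f
  constructor
  · rintro ⟨i, j, h, rfl⟩
    refine ⟨s(i, j), h, ?_⟩
    rw [LSSAux.eP_mk]; simp
  · rintro ⟨e, he, rfl⟩
    induction e with
    | _ i j =>
      refine ⟨i, j, he, ?_⟩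
      rw [LSSAux.eP_mk]; simp

/-- **Complete intersection LSS and parity binomial edge ideals of bipartite
graphs.**  For a bipartite graph `G` on `[n]`: `L_G` is a complete
intersection iff `𝓘_G` is a complete intersection iff `G` is a disjoint union
of paths. -/
theorem lssIdeal_completeIntersection_iff_bipartite
    (K : Type) [Field K] (n : ℕ) (G : SimpleGraph (Fin n))
    (hbip : IsBipartiteGraph G) :
    (IsCompleteIntersectionIdeal (lssIdeal K G) ↔
      IsCompleteIntersectionIdeal (parityBinomialEdgeIdeal K G)) ∧
    (IsCompleteIntersectionIdeal (lssIdeal K G) ↔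
      IsDisjointUnionOfPaths G) := by
  rw [LSSAux.lss_eq, LSSAux.parity_eq, LSSAux.ci_iff _ (neg_ne_zero.2 one_ne_zero) G hbip,
    LSSAux.ci_iff _ one_ne_zero G hbip]
  exact ⟨Iff.rfl, Iff.rfl⟩

end
end
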